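/- arXiv:1404.0861 — 2 statements merged into one kernel-verified Lean document; each statement's English description precedes it below -/
import Mathlib

section
/- Let 𝔽 be a finite field with q elements, n ≥ 1, and let (π, V) be a cuspidal representation of GL_n(𝔽). Let G = GL_{2n}(𝔽), let P ≤ G be the block upper-triangular parabolic subgroup of matrices [[A, B],[0, D]] with A, D ∈ GL_n(𝔽), and let ρ be the representation of P on V ⊗ V given by ρ([[A,B],[0,D]]) = π(A) ⊗ π(D). Then the induced representation Ind_P^G ρ is the direct sum of exactly two non-isomorphic irreducible representations St_2(π) and Id_2(π), and, ordering them so that dim St_2(π) ≥ dim Id_2(π), one has dim St_2(π) = q^n · dim Id_2(π). -/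
open Matrix TensorProduct

set_option synthInstance.maxHeartbeats 1000000
set_option maxHeartbeats 1000000

/-- A submodule `W` is invariant under a representation `ρ` if `ρ g` maps `W` into
itself for every `g`. -/
def RepInvariant {G V : Type*} [Group G] [AddCommGroup V] [Module ℂ V]
    (ρ : Representation ℂ G V) (W : Submodule ℂ V) : Prop :=
  ∀ g : G, ∀ v ∈ W, ρ g v ∈ W

/-- The subrepresentation of a representation `ρ` on an invariant submodule `W`. -/
def subRep {G V : Type*} [Group G] [AddCommGroup V] [Module ℂ V]
    (ρ : Representation ℂ G V) (W : Submodule ℂ V) (h : RepInvariant ρ W) :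
    Representation ℂ G W where
  toFun g := (ρ g).restrict fun v hv => h g v hv
  map_one' := by
    refine LinearMap.ext fun v => Subtype.ext ?_
    simp [LinearMap.restrict_apply]
  map_mul' g₁ g₂ := by
    refine LinearMap.ext fun v => Subtype.ext ?_
    simp [LinearMap.restrict_apply]

/-- A representation is irreducible if the underlying space is nonzero and its only
invariant subspaces are `⊥` and `⊤`. -/
def IsIrreducibleRep {G V : Type*} [Group G] [AddCommGroup V] [Module ℂ V]
    (ρ : Representation ℂ G V) : Prop :=
  (⊥ : Submodule ℂ V) ≠ ⊤ ∧ ∀ W : Submodule ℂ V, RepInvariant ρ W → W = ⊥ ∨ W = ⊤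

/-- Two representations of the same group are isomorphic if there is an equivariant
linear equivalence between their underlying spaces. -/
def RepIso {G V₁ V₂ : Type*} [Group G] [AddCommGroup V₁] [Module ℂ V₁] [AddCommGroup V₂]
    [Module ℂ V₂] (ρ₁ : Representation ℂ G V₁) (ρ₂ : Representation ℂ G V₂) : Prop :=
  ∃ e : V₁ ≃ₗ[ℂ] V₂, ∀ (g : G) (v : V₁), e (ρ₁ g v) = ρ₂ g (e v)

/-- `u ∈ GL_m(𝔽)` is block upper-triangular unipotent of type `(r, m - r)`, i.e. of the
form `[[I_r, X], [0, I_{m-r}]]`: its diagonal entries are `1` and its off-diagonal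
entries vanish outside the top-right `r × (m - r)` block. -/
def IsBlockUnipotent {𝔽 : Type*} [Field 𝔽] {m : ℕ} (r : ℕ) (u : GL (Fin m) 𝔽) : Prop :=
  (∀ i : Fin m, (u : Matrix (Fin m) (Fin m) 𝔽) i i = 1) ∧
    ∀ i j : Fin m, i ≠ j → ¬((i : ℕ) < r ∧ r ≤ (j : ℕ)) →
      (u : Matrix (Fin m) (Fin m) 𝔽) i j = 0

/-- A finite-dimensional complex representation `ρ` of `GL_m(𝔽)` is cuspidal if it is
irreducible and, for every `0 < r < m`, the only vector fixed by `ρ u` for all block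
upper-triangular unipotent matrices `u = [[I_r, X], [0, I_{m-r}]]` is zero. -/
def IsCuspidal {𝔽 : Type*} [Field 𝔽] {m : ℕ} {V : Type*} [AddCommGroup V] [Module ℂ V]
    (ρ : Representation ℂ (GL (Fin m) 𝔽) V) : Prop :=
  IsIrreducibleRep ρ ∧
    ∀ r : ℕ, 0 < r → r < m →
      ∀ v : V, (∀ u : GL (Fin m) 𝔽, IsBlockUnipotent r u → ρ u v = v) → v = 0

/-- The block upper-triangular parabolic subgroup `P` of `GL_{n₁+n₂}(𝔽)` of matrices
`[[A, B], [0, D]]` with `A` of size `n₁ × n₁` and `D` of size `n₂ × n₂`. -/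
def parabolicGL (𝔽 : Type*) [Field 𝔽] (n₁ n₂ : ℕ) : Subgroup (GL (Fin (n₁ + n₂)) 𝔽) where
  carrier := {g | Matrix.BlockTriangular (g : Matrix (Fin (n₁ + n₂)) (Fin (n₁ + n₂)) 𝔽)
    fun i => if (i : ℕ) < n₁ then (0 : ℕ) else 1}
  one_mem' := by simpa using Matrix.blockTriangular_one (α := ℕ)
  mul_mem' := by
    intro a b ha hb
    simpa [Units.val_mul] using Matrix.BlockTriangular.mul ha hb
  inv_mem' := by
    intro a ha
    haveI : Invertible ((a : Matrix (Fin (n₁ + n₂)) (Fin (n₁ + n₂)) 𝔽)) := a.invertible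
    simpa [Matrix.coe_units_inv] using Matrix.blockTriangular_inv_of_blockTriangular ha

/-- The space of the induced representation `Ind_P^G θ`, realized as the space of
functions `f : G → W` with `f (p * g) = θ p (f g)` for all `p ∈ P`, `g ∈ G`. -/
def inducedSpace {G : Type*} [Group G] (P : Subgroup G) {W : Type*} [AddCommGroup W]
    [Module ℂ W] (θ : Representation ℂ P W) : Submodule ℂ (G → W) where
  carrier := {f | ∀ (p : P) (g : G), f (↑p * g) = θ p (f g)}
  zero_mem' := by intro p g; simp
  add_mem' := by intro f₁ f₂ h₁ h₂ p g; simp [h₁ p g, h₂ p g]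
  smul_mem' := by intro c f h p g; simp [h p g]

/-- The induced representation `Ind_P^G θ`: the group `G` acts on `inducedSpace P θ` by
right translation, `(g • f) x = f (x * g)`. -/
def inducedRep {G : Type*} [Group G] (P : Subgroup G) {W : Type*} [AddCommGroup W]
    [Module ℂ W] (θ : Representation ℂ P W) :
    Representation ℂ G (inducedSpace P θ) where
  toFun g :=
    { toFun := fun f => ⟨fun x => (f : G → W) (x * g),
        fun p x => by simpa [mul_assoc] using f.2 p (x * g)⟩
      map_add' := fun f₁ f₂ => Subtype.ext (funext fun x => rfl)
      map_smul' := fun c f => Subtype.ext (funext fun x => rfl) }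
  map_one' := by
    refine LinearMap.ext fun f => Subtype.ext (funext fun x => ?_)
    simp
  map_mul' g h := by
    refine LinearMap.ext fun f => Subtype.ext (funext fun x => ?_)
    simp [mul_assoc]

section Schur

variable {G V : Type*} [Group G] [AddCommGroup V] [Module ℂ V] {π : Representation ℂ G V}

theorem IsIrreducibleRep.nontrivial (h : IsIrreducibleRep π) : Nontrivial V :=
  (Submodule.nontrivial_iff ℂ).1 ⟨⊥, ⊤, h.1⟩

/-- Contraction of the second tensor factor with a linear functional. -/
noncomputable def sndContract (l : V →ₗ[ℂ] ℂ) : V ⊗[ℂ] V →ₗ[ℂ] V :=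
  (TensorProduct.rid ℂ V).toLinearMap ∘ₗ l.lTensor V

@[simp] theorem sndContract_tmul (l : V →ₗ[ℂ] ℂ) (x y : V) :
    sndContract l (x ⊗ₜ y) = l y • x := by
  simp [sndContract]

theorem sndContract_map_one (l : V →ₗ[ℂ] ℂ) (u : Module.End ℂ V) (z : V ⊗[ℂ] V) :
    sndContract l (TensorProduct.map u 1 z) = u (sndContract l z) := by
  induction z with
  | zero => simp
  | add x y hx hy => simp [hx, hy]
  | tmul x y => simp

theorem sum_sndContract_coord {ι : Type*} [Fintype ι] (b : Module.Basis ι ℂ V)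
    (z : V ⊗[ℂ] V) : ∑ i, sndContract (b.coord i) z ⊗ₜ[ℂ] b i = z := by
  induction z with
  | zero => simp
  | add x y hx hy =>
    conv_rhs => rw [← hx, ← hy]
    simp [TensorProduct.add_tmul, Finset.sum_add_distrib]
  | tmul x y =>
    simp only [sndContract_tmul, TensorProduct.smul_tmul, ← TensorProduct.tmul_sum,
      Module.Basis.coord_apply]
    rw [b.sum_repr]

variable [FiniteDimensional ℂ V]

/-- **Schur's lemma**. -/
theorem IsIrreducibleRep.exists_eq_smul_one (h : IsIrreducibleRep π) (M : Module.End ℂ V)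
    (hM : ∀ g v, M (π g v) = π g (M v)) : ∃ c : ℂ, ∀ v, M v = c • v := by
  have := h.nontrivial
  obtain ⟨c, hc⟩ := Module.End.exists_eigenvalue M
  have hinv : RepInvariant π (M.eigenspace c) := by
    intro g v hv
    rw [Module.End.mem_eigenspace_iff] at hv ⊢
    rw [hM, hv, map_smul]
  rcases h.2 _ hinv with h0 | h0
  · exact absurd h0 hc
  · exact ⟨c, fun v => Module.End.mem_eigenspace_iff.1 (h0 ▸ Submodule.mem_top)⟩

/-- If no nonzero vector of `V` is fixed by all operators in `S`, then no nonzero vector of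
`V ⊗ V` is fixed by all `u ⊗ 1` with `u ∈ S`. -/
theorem eq_zero_of_forall_map_one_eq (S : Set (Module.End ℂ V))
    (hS : ∀ v : V, (∀ u ∈ S, u v = v) → v = 0) (z : V ⊗[ℂ] V)
    (hz : ∀ u ∈ S, TensorProduct.map u 1 z = z) : z = 0 := by
  rw [← sum_sndContract_coord (Module.finBasis ℂ V) z]
  refine Finset.sum_eq_zero fun i _ => ?_
  have hi : sndContract ((Module.finBasis ℂ V).coord i) z = 0 :=
    hS _ fun u hu => by rw [← sndContract_map_one, hz u hu]
  rw [hi, TensorProduct.zero_tmul]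

/-- Schur's lemma for the external tensor square of an irreducible representation. -/
theorem IsIrreducibleRep.exists_eq_smul_of_tensor (h : IsIrreducibleRep π)
    (M : Module.End ℂ (V ⊗[ℂ] V))
    (hM : ∀ g₁ g₂ z, M (TensorProduct.map (π g₁) (π g₂) z)
      = TensorProduct.map (π g₁) (π g₂) (M z)) :
    ∃ c : ℂ, ∀ z, M z = c • z := by
  have := h.nontrivial
  let b := Module.finBasis ℂ V
  have h1 : ∀ (v : V) (l : V →ₗ[ℂ] ℂ), ∃ c : ℂ, ∀ x, sndContract l (M (x ⊗ₜ v)) = c • x := by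
    intro v l
    refine h.exists_eq_smul_one
      (sndContract l ∘ₗ M ∘ₗ (TensorProduct.mk ℂ V V).flip v) fun g x => ?_
    have := hM g 1 (x ⊗ₜ v)
    rw [map_one, TensorProduct.map_tmul, Module.End.one_apply] at this
    simp only [LinearMap.comp_apply, LinearMap.flip_apply, TensorProduct.mk_apply]
    rw [this, sndContract_map_one]
  choose c hc using h1
  let N : Module.End ℂ V := b.constr ℂ fun i => ∑ j, c (b i) (b.coord j) • b j
  have hN : ∀ x v, M (x ⊗ₜ v) = x ⊗ₜ N v := by
    intro x
    suffices M ∘ₗ TensorProduct.mk ℂ V V x = TensorProduct.mk ℂ V V x ∘ₗ N from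
      fun v => LinearMap.congr_fun this v
    refine b.ext fun i => ?_
    simp only [LinearMap.comp_apply, TensorProduct.mk_apply]
    rw [← sum_sndContract_coord b (M (x ⊗ₜ b i))]
    simp only [hc, N, b.constr_basis, TensorProduct.tmul_sum, TensorProduct.smul_tmul]
  obtain ⟨x, hx⟩ := exists_ne (0 : V)
  obtain ⟨l, hl⟩ : ∃ l : V →ₗ[ℂ] ℂ, l x ≠ 0 := by
    by_contra! hcon
    exact hx ((Module.forall_dual_apply_eq_zero_iff ℂ x).1 hcon)
  have hcomm : ∀ g v, N (π g v) = π g (N v) := by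
    intro g v
    have := hM 1 g (x ⊗ₜ v)
    rw [hN, map_one, TensorProduct.map_tmul, TensorProduct.map_tmul, hN,
      Module.End.one_apply] at this
    have := congrArg (fun z => (TensorProduct.lid ℂ V) (l.rTensor V z)) this
    simpa [hl] using this
  obtain ⟨a, ha⟩ := h.exists_eq_smul_one N hcomm
  refine ⟨a, fun z => ?_⟩
  induction z with
  | zero => simp
  | add x y hx hy => simp [hx, hy]
  | tmul x y => rw [hN, ha, TensorProduct.tmul_smul]

theorem trace_comm_comp_map (A B : Module.End ℂ V) :
    LinearMap.trace ℂ (V ⊗[ℂ] V)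
      ((TensorProduct.comm ℂ V V).toLinearMap ∘ₗ TensorProduct.map A B)
      = LinearMap.trace ℂ V (A * B) := by
  let b := Module.finBasis ℂ V
  rw [LinearMap.trace_eq_matrix_trace ℂ (b.tensorProduct b),
    LinearMap.trace_eq_matrix_trace ℂ b, LinearMap.toMatrix_mul, Matrix.trace, Matrix.trace,
    Fintype.sum_prod_type]
  simp only [Matrix.diag_apply, Matrix.mul_apply]
  rw [Finset.sum_comm]
  refine Finset.sum_congr rfl fun i _ => Finset.sum_congr rfl fun j _ => ?_
  simp [LinearMap.toMatrix_apply]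

/-- If a sum over a finite type of operators `A x ⊗ B x` is a nonzero multiple of the swap, then
the operators `B x` span `End V`. -/
theorem sq_finrank_le_card_of_sum_map_eq_smul_comm {X : Type*} [Fintype X]
    (A B : X → Module.End ℂ V) (c : ℂ) (hc : c ≠ 0)
    (h : ∀ z, ∑ x, TensorProduct.map (B x) (A x) z = c • TensorProduct.comm ℂ V V z) :
    Module.finrank ℂ V ^ 2 ≤ Fintype.card X := by
  let b := Module.finBasis ℂ V
  have hr1 : ∀ (l : V →ₗ[ℂ] ℂ) (v : V), l.smulRight v ∈ Submodule.span ℂ (Set.range B) := by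
    intro l v
    have : l.smulRight v = c⁻¹ • ∑ x, l (A x v) • B x := by
      ext y
      have := congrArg (sndContract l) (h (y ⊗ₜ v))
      rw [map_sum, map_smul, TensorProduct.comm_tmul, sndContract_tmul] at this
      simp only [TensorProduct.map_tmul, sndContract_tmul] at this
      rw [LinearMap.smul_apply, LinearMap.sum_apply]
      simp only [LinearMap.smul_apply]
      rw [this, smul_smul, inv_mul_cancel₀ hc, one_smul, LinearMap.smulRight_apply]
    rw [this]
    exact Submodule.smul_mem _ _ (Submodule.sum_mem _ fun x _ =>
      Submodule.smul_mem _ _ (Submodule.subset_span ⟨x, rfl⟩))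
  have htop : Submodule.span ℂ (Set.range B) = ⊤ := by
    refine eq_top_iff.2 fun f _ => ?_
    have : f = ∑ i, (b.coord i).smulRight (f (b i)) := by
      refine b.ext fun j => ?_
      simp [Finsupp.single_apply]
    rw [this]
    exact Submodule.sum_mem _ fun i _ => hr1 _ _
  have := finrank_range_le_card (R := ℂ) (b := B)
  rw [Set.finrank, htop, finrank_top, Module.finrank_linearMap] at this
  rwa [sq]

end Schur

section Decomposition

variable {G V : Type*} [Group G] [AddCommGroup V] [Module ℂ V] {σ : Representation ℂ G V}

/-- **Maschke's theorem**: an invariant subspace is the image of an equivariant projection. -/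
theorem RepInvariant.exists_equivariant_projection [Finite G] {W : Submodule ℂ V}
    (hW : RepInvariant σ W) :
    ∃ A : Module.End ℂ V, (∀ g v, A (σ g v) = σ g (A v)) ∧ (∀ v, A v ∈ W) ∧
      ∀ v ∈ W, A v = v := by
  have := Fintype.ofFinite G
  obtain ⟨p, hp⟩ := W.subtype.exists_leftInverse_of_injective W.ker_subtype
  have hcard : (Fintype.card G : ℂ) ≠ 0 := Nat.cast_ne_zero.2 Fintype.card_ne_zero
  refine ⟨(Fintype.card G : ℂ)⁻¹ • ∑ g, σ g ∘ₗ W.subtype ∘ₗ p ∘ₗ σ g⁻¹, ?_, ?_, ?_⟩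
  · intro h v
    simp only [LinearMap.smul_apply, LinearMap.sum_apply, LinearMap.comp_apply, map_smul, map_sum]
    congr 1
    refine Fintype.sum_equiv (Equiv.mulLeft h⁻¹) _ _ fun g => ?_
    simp only [Equiv.coe_mulLeft, _root_.mul_inv_rev, inv_inv, map_mul, Module.End.mul_apply]
    rw [← Module.End.mul_apply (σ h), ← map_mul, mul_inv_cancel, map_one, Module.End.one_apply]
  · intro v
    simp only [LinearMap.smul_apply, LinearMap.sum_apply, LinearMap.comp_apply]
    exact W.smul_mem _ (W.sum_mem fun g _ => hW _ _ (p _).2)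
  · intro v hv
    have h1 : ∀ g, (σ g ∘ₗ W.subtype ∘ₗ p ∘ₗ σ g⁻¹) v = v := by
      intro g
      have h2 := LinearMap.congr_fun hp ⟨σ g⁻¹ v, hW _ _ hv⟩
      simp only [LinearMap.comp_apply, Submodule.subtype_apply, LinearMap.id_apply] at h2 ⊢
      rw [h2, ← Module.End.mul_apply, ← map_mul, mul_inv_cancel, map_one, Module.End.one_apply]
    rw [LinearMap.smul_apply, LinearMap.sum_apply, Finset.sum_congr rfl fun g _ => h1 g,
      Finset.sum_const, Finset.card_univ, ← Nat.cast_smul_eq_nsmul ℂ, smul_smul,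
      inv_mul_cancel₀ hcard, one_smul]

theorem repInvariant_eigenspace {T : Module.End ℂ V} (hT : ∀ g v, T (σ g v) = σ g (T v)) (a : ℂ) :
    RepInvariant σ (T.eigenspace a) := by
  intro g v hv
  rw [Module.End.mem_eigenspace_iff] at hv ⊢
  rw [hT, hv, map_smul]

/-- If the commutant of `σ` is spanned by `1` and `T`, then the nonzero eigenspaces of `T` are
irreducible. -/
theorem isIrreducibleRep_eigenspace [Finite G] {T : Module.End ℂ V}
    (hT : ∀ g v, T (σ g v) = σ g (T v))
    (hC : ∀ A : Module.End ℂ V, (∀ g v, A (σ g v) = σ g (A v)) →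
      ∃ a b : ℂ, ∀ v, A v = a • v + b • T v)
    (c : ℂ) (hc : T.eigenspace c ≠ ⊥) :
    IsIrreducibleRep (subRep σ (T.eigenspace c) (repInvariant_eigenspace hT c)) := by
  refine ⟨fun h => hc ?_, fun W hW => ?_⟩
  · have := congrArg (Submodule.map (T.eigenspace c).subtype) h
    simpa using this.symm
  · have hW' : RepInvariant σ (W.map (T.eigenspace c).subtype) := by
      rintro g _ ⟨v, hv, rfl⟩
      exact ⟨_, hW g v hv, rfl⟩
    obtain ⟨A, hA, hAW, hAid⟩ := hW'.exists_equivariant_projection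
    obtain ⟨a, b, hab⟩ := hC A hA
    have hAv : ∀ v ∈ T.eigenspace c, A v = (a + b * c) • v := by
      intro v hv
      rw [hab, Module.End.mem_eigenspace_iff.1 hv, add_smul, mul_smul]
    by_cases hz : a + b * c = 0
    · left
      rw [Submodule.eq_bot_iff]
      intro w hw
      have h1 := hAid w ⟨w, hw, rfl⟩
      rw [hAv _ w.2, hz, zero_smul] at h1
      exact Subtype.ext h1.symm
    · right
      refine eq_top_iff.2 fun v _ => ?_
      obtain ⟨w, hw, hwv⟩ := hAW v
      rw [hAv _ v.2] at hwv
      have : v = (a + b * c)⁻¹ • w := by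
        apply Subtype.ext
        rw [Submodule.coe_smul]
        change (v : V) = (a + b * c)⁻¹ • (T.eigenspace c).subtype w
        rw [hwv, smul_smul, inv_mul_cancel₀ hz, one_smul]
      rw [this]
      exact W.smul_mem _ hw

section Quadratic

variable {T : Module.End ℂ V} {c₁ c₂ : ℂ}

theorem apply_sub_smul_mem_eigenspace (hq : ∀ v, T (T v) = (c₁ + c₂) • T v - (c₁ * c₂) • v)
    (v : V) : T v - c₂ • v ∈ T.eigenspace c₁ := by
  rw [Module.End.mem_eigenspace_iff, map_sub, map_smul, hq]
  module

theorem eigenspace_inf_eq_bot (hne : c₁ ≠ c₂) : T.eigenspace c₁ ⊓ T.eigenspace c₂ = ⊥ := by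
  rw [Submodule.eq_bot_iff]
  rintro v ⟨h1, h2⟩
  have h1 := Module.End.mem_eigenspace_iff.1 h1
  rw [Module.End.mem_eigenspace_iff.1 h2] at h1
  have : (c₂ - c₁) • v = 0 := by rw [sub_smul, h1, sub_self]
  exact (smul_eq_zero.1 this).resolve_left (sub_ne_zero.2 hne.symm)

theorem eigenspace_sup_eq_top (hq : ∀ v, T (T v) = (c₁ + c₂) • T v - (c₁ * c₂) • v)
    (hne : c₁ ≠ c₂) : T.eigenspace c₁ ⊔ T.eigenspace c₂ = ⊤ := by
  refine eq_top_iff.2 fun v _ => ?_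
  have h1 := apply_sub_smul_mem_eigenspace hq v
  have h2 : T v - c₁ • v ∈ T.eigenspace c₂ :=
    apply_sub_smul_mem_eigenspace (fun v => by rw [hq, add_comm, mul_comm]) v
  have : v = (c₁ - c₂)⁻¹ • (T v - c₂ • v) - (c₁ - c₂)⁻¹ • (T v - c₁ • v) := by
    rw [← smul_sub, sub_sub_sub_cancel_left, ← sub_smul, smul_smul,
      inv_mul_cancel₀ (sub_ne_zero.2 hne), one_smul]
  rw [this]
  exact Submodule.sub_mem _ (Submodule.mem_sup_left (Submodule.smul_mem _ _ h1))
    (Submodule.mem_sup_right (Submodule.smul_mem _ _ h2))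

theorem not_repIso_eigenspace (hT : ∀ g v, T (σ g v) = σ g (T v))
    (hC : ∀ A : Module.End ℂ V, (∀ g v, A (σ g v) = σ g (A v)) →
      ∃ a b : ℂ, ∀ v, A v = a • v + b • T v)
    (hq : ∀ v, T (T v) = (c₁ + c₂) • T v - (c₁ * c₂) • v)
    (hne : c₁ ≠ c₂) (hc : T.eigenspace c₁ ≠ ⊥) :
    ¬ RepIso (subRep σ (T.eigenspace c₁) (repInvariant_eigenspace hT c₁))
      (subRep σ (T.eigenspace c₂) (repInvariant_eigenspace hT c₂)) := by
  rintro ⟨e, he⟩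
  let p : V →ₗ[ℂ] T.eigenspace c₁ :=
    (T - c₂ • 1).codRestrict _ fun v => apply_sub_smul_mem_eigenspace hq v
  have hp : ∀ g v, p (σ g v) = subRep σ _ (repInvariant_eigenspace hT c₁) g (p v) := by
    intro g v
    apply Subtype.ext
    change T (σ g v) - c₂ • σ g v = σ g (T v - c₂ • v)
    rw [hT, map_sub, map_smul]
  obtain ⟨a, b, hab⟩ := hC ((T.eigenspace c₂).subtype ∘ₗ e.toLinearMap ∘ₗ p) fun g v => by
    simp only [LinearMap.comp_apply, LinearEquiv.coe_coe]
    rw [hp, he]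
    rfl
  obtain ⟨v, hv, hv0⟩ := Submodule.exists_mem_ne_zero_of_ne_bot hc
  have hpv : p v = (c₁ - c₂) • ⟨v, hv⟩ := by
    apply Subtype.ext
    change T v - c₂ • v = (c₁ - c₂) • v
    rw [Module.End.mem_eigenspace_iff.1 hv, sub_smul]
  have h1 := hab v
  have h2 : (((T.eigenspace c₂).subtype ∘ₗ e.toLinearMap ∘ₗ p) v) ∈
      T.eigenspace c₁ ⊓ T.eigenspace c₂ := by
    refine ⟨?_, (e (p v)).2⟩
    rw [h1, Module.End.mem_eigenspace_iff.1 hv]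
    exact Submodule.add_mem _ (Submodule.smul_mem _ _ hv)
      (Submodule.smul_mem _ _ (Submodule.smul_mem _ _ hv))
  rw [eigenspace_inf_eq_bot hne, Submodule.mem_bot] at h2
  have h3 : e (p v) = 0 := Subtype.ext h2
  rw [LinearEquiv.map_eq_zero_iff, hpv] at h3
  have h4 := (smul_eq_zero.1 h3).resolve_left (sub_ne_zero.2 hne)
  exact hv0 (congrArg Subtype.val h4)

theorem trace_eq_of_quadratic [FiniteDimensional ℂ V]
    (hq : ∀ v, T (T v) = (c₁ + c₂) • T v - (c₁ * c₂) • v) (hne : c₁ ≠ c₂) :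
    LinearMap.trace ℂ V T = c₁ * Module.finrank ℂ (T.eigenspace c₁)
      + c₂ * Module.finrank ℂ (T.eigenspace c₂) := by
  have key : ∀ {d₁ d₂ : ℂ}, (∀ v, T (T v) = (d₁ + d₂) • T v - (d₁ * d₂) • v) → d₁ ≠ d₂ →
      LinearMap.IsProj (T.eigenspace d₁) ((d₁ - d₂)⁻¹ • (T - d₂ • 1)) := by
    intro d₁ d₂ hq hne
    refine ⟨fun v => Submodule.smul_mem _ _ (apply_sub_smul_mem_eigenspace hq v), fun v hv => ?_⟩
    simp only [LinearMap.smul_apply, LinearMap.sub_apply, Module.End.one_apply]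
    rw [Module.End.mem_eigenspace_iff.1 hv, ← sub_smul, smul_smul,
      inv_mul_cancel₀ (sub_ne_zero.2 hne), one_smul]
  have h1 := (key hq hne).trace
  have h2 := (key (fun v => by rw [hq, add_comm, mul_comm]) hne.symm).trace
  rw [← h1, ← h2]
  simp only [map_smul, map_sub, smul_eq_mul]
  have := sub_ne_zero.2 hne
  have := sub_ne_zero.2 hne.symm
  field_simp
  ring

end Quadratic

end Decomposition

section Numerics

theorem prod_pow_lt_two_mul_prod_pow_sub_one {q : ℝ} (hq : 3 ≤ q) (k : ℕ) :
    ∏ i ∈ Finset.range k, q ^ (i + 1) < 2 * ∏ i ∈ Finset.range k, (q ^ (i + 1) - 1) := by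
  have hq0 : (0 : ℝ) < q := by linarith
  have key : (∏ i ∈ Finset.range k, q ^ (i + 1)) * (1 + q⁻¹ ^ k) ≤
      2 * ∏ i ∈ Finset.range k, (q ^ (i + 1) - 1) := by
    induction k with
    | zero => norm_num
    | succ k ih =>
      rw [Finset.prod_range_succ, Finset.prod_range_succ]
      have hpos : 0 ≤ q ^ (k + 1) - 1 := sub_nonneg.2 (one_le_pow₀ (by linarith))
      have h1 := mul_le_mul_of_nonneg_right ih hpos
      rw [mul_assoc (2 : ℝ)] at h1
      refine le_trans ?_ h1
      rw [mul_assoc, mul_assoc]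
      refine mul_le_mul_of_nonneg_left ?_ (Finset.prod_nonneg fun i _ => by positivity)
      have hx : 1 ≤ q ^ k := one_le_pow₀ (by linarith)
      have hinv : q⁻¹ ^ k ≤ 1 := pow_le_one₀ (by positivity) (inv_le_one_of_one_le₀ (by linarith))
      have e1 : q ^ (k + 1) * (1 + q⁻¹ ^ (k + 1)) = q ^ (k + 1) + 1 := by
        rw [mul_add, ← mul_pow, mul_inv_cancel₀ hq0.ne', one_pow, mul_one]
      have e2 : q⁻¹ ^ k * q ^ (k + 1) = q := by
        rw [pow_succ, ← mul_assoc, ← mul_pow, inv_mul_cancel₀ hq0.ne', one_pow, one_mul]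
      rw [e1]
      nlinarith
  refine lt_of_lt_of_le ?_ key
  have : 0 < ∏ i ∈ Finset.range k, q ^ (i + 1) := Finset.prod_pos fun i _ => by positivity
  have : 0 < q⁻¹ ^ k := by positivity
  nlinarith

theorem prod_two_pow_lt_four_mul_prod_two_pow_sub_one (k : ℕ) :
    ∏ i ∈ Finset.range k, (2 : ℝ) ^ (i + 1) <
      4 * ∏ i ∈ Finset.range k, ((2 : ℝ) ^ (i + 1) - 1) := by
  have key (k : ℕ) : (∏ i ∈ Finset.range (k + 1), (2 : ℝ) ^ (i + 1)) * (1 + 2 * 2⁻¹ ^ (k + 1)) ≤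
      4 * ∏ i ∈ Finset.range (k + 1), ((2 : ℝ) ^ (i + 1) - 1) := by
    induction k with
    | zero => norm_num
    | succ k ih =>
      rw [Finset.prod_range_succ, Finset.prod_range_succ _ (k + 1)]
      have hpos : 0 ≤ (2 : ℝ) ^ (k + 1 + 1) - 1 := sub_nonneg.2 (one_le_pow₀ (by norm_num))
      have h1 := mul_le_mul_of_nonneg_right ih hpos
      rw [mul_assoc (4 : ℝ)] at h1
      refine le_trans ?_ h1
      rw [mul_assoc, mul_assoc]
      refine mul_le_mul_of_nonneg_left ?_ (Finset.prod_nonneg fun i _ => by positivity)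
      have e1 : (2 : ℝ) ^ (k + 1 + 1) * 2⁻¹ ^ (k + 1 + 1) = 1 := by
        rw [← mul_pow]; norm_num
      have e2 : (2⁻¹ : ℝ) ^ (k + 1) = 2 * 2⁻¹ ^ (k + 1 + 1) := by
        rw [pow_succ _ (k + 1)]; ring
      have hinv : (2⁻¹ : ℝ) ^ (k + 1 + 1) ≤ 1 / 4 := by
        have : (2⁻¹ : ℝ) ^ k ≤ 1 := pow_le_one₀ (by norm_num) (by norm_num)
        rw [pow_succ, pow_succ]; linarith
      rw [e2]
      nlinarith
  rcases k with _ | k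
  · norm_num
  · refine lt_of_lt_of_le ?_ (key k)
    have : 0 < ∏ i ∈ Finset.range (k + 1), (2 : ℝ) ^ (i + 1) :=
      Finset.prod_pos fun i _ => by positivity
    have : (0 : ℝ) < 2⁻¹ ^ (k + 1) := by positivity
    nlinarith

/-- Arithmetic of the equation relating the dimensions of the two eigenspaces of the Hecke
operator: unless the multiplicity `m` is one, it is too large. -/
theorem eq_mul_of_dimension_equation {Q a b m : ℕ} (hQ : IsPrimePow Q) (hb : 0 < b)
    (hba : b < a) (hab : a.Coprime b)
    (h : a * b * (Q - 1) ^ 2 = Q * m ^ 2 * (a - b) ^ 2)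
    (hm : m ^ 2 < 2 * (Q - 1) ∨ (Even Q ∧ m ^ 2 < 4 * (Q - 1))) : a = Q * b := by
  have hQ2 : 2 ≤ Q := hQ.two_le
  obtain ⟨d, hd⟩ : ∃ d, a = b + d := ⟨a - b, by omega⟩
  have hd0 : 0 < d := by omega
  have hsub : a - b = d := by omega
  rw [hsub] at h
  have hcop : b.Coprime d := by
    rw [hd] at hab
    simpa using hab.symm
  obtain ⟨t, ht⟩ : d ∣ Q - 1 := by
    have h1 : Nat.Coprime d (a * b) :=
      Nat.Coprime.mul_right (by rw [hd]; simpa using hcop.symm) hcop.symm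
    have h2 : d ^ 2 ∣ a * b * (Q - 1) ^ 2 := ⟨_, h.trans (mul_comm _ _)⟩
    exact (Nat.pow_dvd_pow_iff two_ne_zero).1 ((h1.pow_left 2).dvd_of_dvd_mul_left h2)
  have hQt : Q = d * t + 1 := by omega
  have ht0 : 0 < t := by
    rcases Nat.eq_zero_or_pos t with rfl | h0
    · omega
    · exact h0
  rw [ht] at h
  have h' : a * b * t ^ 2 = Q * m ^ 2 :=
    Nat.eq_of_mul_eq_mul_right (pow_pos hd0 2) (by linarith)
  obtain ⟨s, rfl⟩ : t ∣ m := by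
    have h1 : Nat.Coprime t Q := by rw [hQt]; simp
    have h2 : t ^ 2 ∣ Q * m ^ 2 := ⟨_, h'.symm.trans (mul_comm _ _)⟩
    exact (Nat.pow_dvd_pow_iff two_ne_zero).1 ((h1.pow_left 2).dvd_of_dvd_mul_left h2)
  have hs : a * b = Q * s ^ 2 :=
    Nat.eq_of_mul_eq_mul_right (pow_pos ht0 2) (by linarith)
  have hdQ : d + 1 ≤ Q := by nlinarith
  have hm4 : (t * s) ^ 2 + 4 < 4 * Q := by
    rcases hm with hm | hm <;> omega
  have hodd : Even Q → Odd d ∧ Odd t := fun he => by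
    have : Odd (d * t) := by
      rw [hQt, Nat.even_add_one, Nat.not_even_iff_odd] at he
      exact he
    exact Nat.odd_mul.1 this
  have hst : s ^ 2 ≤ (t * s) ^ 2 := Nat.pow_le_pow_left (Nat.le_mul_of_pos_left _ ht0) 2
  rcases (hab.isPrimePow_dvd_mul hQ).1 ⟨_, hs⟩ with ⟨a', rfl⟩ | ⟨b', rfl⟩
  · have hs' : a' * b = s ^ 2 :=
      Nat.eq_of_mul_eq_mul_left (by omega : 0 < Q) (by linarith)
    obtain rfl | rfl | h3 : a' = 1 ∨ a' = 2 ∨ 3 ≤ a' := by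
      have : a' ≠ 0 := by rintro rfl; omega
      omega
    · have hm' : (t * s) ^ 2 + t * (d * t) = t ^ 2 * Q := by
        rw [mul_pow, ← hs']; nlinarith
      obtain rfl | rfl | h3 : t = 1 ∨ t = 2 ∨ 3 ≤ t := by omega
      · have : b = 1 := by omega
        rw [this]
      · rcases hm with hm | ⟨he, -⟩
        · omega
        · exact absurd (hodd he).2 (by decide)
      · exfalso
        have hdt : d * t = Q - 1 := ht.symm
        rw [hdt] at hm'
        obtain ⟨R, rfl⟩ : ∃ R, Q = R + 1 := ⟨Q - 1, by omega⟩
        simp only [Nat.add_sub_cancel] at hm'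
        nlinarith [Nat.mul_le_mul h3 h3]
    · rcases hm with hm | ⟨he, -⟩
      · omega
      · exfalso
        have h1 : Even s := by
          have : Even (s ^ 2) := ⟨b, by omega⟩
          exact (Nat.even_pow.1 this).1
        obtain ⟨r, rfl⟩ := h1
        have h2 : Even b := ⟨r * r, by nlinarith⟩
        have h3 : Even d := by
          have : Even (b + d) := ⟨Q, by omega⟩
          exact (Nat.even_add.1 this).1 h2
        exact (Nat.not_even_iff_odd.2 (hodd he).1) h3
    · exfalso
      have : 2 * Q ≤ b := by nlinarith
      nlinarith
  · exfalso
    have hs' : (Q * b' + d) * b' = s ^ 2 := by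
      refine Nat.eq_of_mul_eq_mul_left (by omega : 0 < Q) ?_
      rw [← hs, hd]; ring
    obtain rfl | h2 : b' = 1 ∨ 2 ≤ b' := by
      have : b' ≠ 0 := by rintro rfl; omega
      omega
    · have hm' : (t * s) ^ 2 = t ^ 2 * Q + t * (d * t) := by
        rw [mul_pow, ← hs']; ring
      obtain rfl | h2 : t = 1 ∨ 2 ≤ t := by omega
      · rcases hm with hm | ⟨he, -⟩
        · omega
        · obtain ⟨r, rfl⟩ := he
          have h1 : (1 * s) ^ 2 + 1 = 4 * r := by omega
          rw [one_mul] at h1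
          have h2 : s ^ 2 % 4 = 3 := by omega
          rw [Nat.pow_mod] at h2
          have h3 := Nat.mod_lt s (by norm_num : 4 > 0)
          interval_cases s % 4 <;> omega
      · nlinarith [Nat.mul_le_mul h2 h2]
    · nlinarith [Nat.mul_le_mul h2 h2]

end Numerics

section Numerics

theorem eq_mul_or_eq_mul_of_dimension_equation {Q d₁ d₂ m : ℕ} (hQ : IsPrimePow Q)
    (h₁ : 0 < d₁) (h₂ : 0 < d₂)
    (h : (d₁ : ℝ) * d₂ * (Q - 1) ^ 2 = Q * m ^ 2 * (d₁ - d₂) ^ 2)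
    (hm : m ^ 2 < 2 * (Q - 1) ∨ (Even Q ∧ m ^ 2 < 4 * (Q - 1))) :
    d₁ = Q * d₂ ∨ d₂ = Q * d₁ := by
  wlog hlt : d₂ ≤ d₁ generalizing d₁ d₂
  · exact (this h₂ h₁ (by linarith) (by omega)).symm
  left
  have hQ2 : 2 ≤ Q := hQ.two_le
  have hne : d₂ ≠ d₁ := by
    rintro rfl
    have hd : (0 : ℝ) < d₂ := by exact_mod_cast h₂
    have hQ' : (2 : ℝ) ≤ Q := by exact_mod_cast hQ2
    have : (0 : ℝ) < d₂ * d₂ * (Q - 1) ^ 2 := by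
      have : (0 : ℝ) < (Q : ℝ) - 1 := by linarith
      positivity
    rw [h] at this
    simp at this
  obtain ⟨g, a, b, hg, hab, rfl, rfl⟩ := Nat.exists_coprime' (Nat.gcd_pos_of_pos_left d₂ h₁)
  have hba : b < a := lt_of_mul_lt_mul_right (lt_of_le_of_ne hlt hne) g.zero_le
  have hb : 0 < b := Nat.pos_of_mul_pos_right h₂
  have hnat : a * b * (Q - 1) ^ 2 = Q * m ^ 2 * (a - b) ^ 2 := by
    have hg' : (g : ℝ) ^ 2 ≠ 0 := by positivity
    have : ((a * b * (Q - 1) ^ 2 : ℕ) : ℝ) = ((Q * m ^ 2 * (a - b) ^ 2 : ℕ) : ℝ) := by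
      push_cast [Nat.cast_sub hba.le, Nat.cast_sub (by omega : 1 ≤ Q)] at h ⊢
      refine mul_right_cancel₀ hg' ?_
      linear_combination h
    exact_mod_cast this
  rw [eq_mul_of_dimension_equation hQ hb hba hab hnat hm, mul_assoc]

theorem sq_lt_of_mul_prod_le {q n m : ℕ} (hq : 2 ≤ q) (hn : 1 ≤ n)
    (h : (m : ℝ) ^ 2 * ∏ i ∈ Finset.range (n - 1), ((q : ℝ) ^ (i + 1) - 1) ≤
      (∏ i ∈ Finset.range (n - 1), (q : ℝ) ^ (i + 1)) * ((q : ℝ) ^ n - 1)) :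
    m ^ 2 < 2 * (q ^ n - 1) ∨ (Even (q ^ n) ∧ m ^ 2 < 4 * (q ^ n - 1)) := by
  have hQ : 2 ≤ q ^ n := le_trans hq (Nat.le_self_pow (by omega) q)
  have hQ' : (0 : ℝ) < (q : ℝ) ^ n - 1 := by
    have : (2 : ℝ) ≤ (q : ℝ) ^ n := by exact_mod_cast hQ
    linarith
  have key : ∀ c : ℕ, ∏ i ∈ Finset.range (n - 1), (q : ℝ) ^ (i + 1) <
      c * ∏ i ∈ Finset.range (n - 1), ((q : ℝ) ^ (i + 1) - 1) → m ^ 2 < c * (q ^ n - 1) := by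
    intro c hc
    have hP : 0 < ∏ i ∈ Finset.range (n - 1), ((q : ℝ) ^ (i + 1) - 1) :=
      Finset.prod_pos fun i _ => sub_pos.2 (one_lt_pow₀ (by exact_mod_cast hq) (by omega))
    have h1 := h.trans_lt (mul_lt_mul_of_pos_right hc hQ')
    have h2 : (m : ℝ) ^ 2 < c * ((q : ℝ) ^ n - 1) :=
      lt_of_mul_lt_mul_right (by linarith) hP.le
    have : ((m ^ 2 : ℕ) : ℝ) < ((c * (q ^ n - 1) : ℕ) : ℝ) := by
      push_cast [Nat.cast_sub (by omega : 1 ≤ q ^ n)]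
      exact h2
    exact_mod_cast this
  obtain rfl | hq3 : q = 2 ∨ 3 ≤ q := by omega
  · right
    refine ⟨(Nat.even_pow.2 ⟨even_two, by omega⟩), key 4 ?_⟩
    exact_mod_cast prod_two_pow_lt_four_mul_prod_two_pow_sub_one (n - 1)
  · left
    exact key 2 (prod_pow_lt_two_mul_prod_pow_sub_one (by exact_mod_cast hq3) (n - 1))

end Numerics

section Columns

variable {𝔽 : Type*} [Field 𝔽] {n : ℕ}

/-- The vectors of `𝔽ⁿ` supported on the first `c` coordinates. -/
def initialSubmodule (𝔽 : Type*) [Field 𝔽] (n c : ℕ) : Submodule 𝔽 (Fin n → 𝔽) where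
  carrier := {x | ∀ i : Fin n, c ≤ (i : ℕ) → x i = 0}
  zero_mem' := fun _ _ => rfl
  add_mem' := fun hx hy i hi => by simp [hx i hi, hy i hi]
  smul_mem' := fun a x hx i hi => by simp [hx i hi]

theorem initialSubmodule_mono {c d : ℕ} (h : c ≤ d) :
    initialSubmodule 𝔽 n c ≤ initialSubmodule 𝔽 n d := fun _ hx i hi => hx i (h.trans hi)

theorem card_initialSubmodule [Fintype 𝔽] {c : ℕ} (hc : c ≤ n) :
    Nat.card (initialSubmodule 𝔽 n c) = Fintype.card 𝔽 ^ c := by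
  let e : initialSubmodule 𝔽 n c ≃ (Fin c → 𝔽) :=
    { toFun := fun x i => x.1 (Fin.castLE hc i)
      invFun := fun y => ⟨fun i => if h : (i : ℕ) < c then y ⟨i, h⟩ else 0, fun i hi => by
        simp [not_lt.2 hi]⟩
      left_inv := fun x => by
        ext i
        by_cases h : (i : ℕ) < c
        · simp [h]
        · simp [h, x.2 i (not_lt.1 h)]
      right_inv := fun y => by
        ext i
        simp }
  rw [Nat.card_congr e, Nat.card_eq_fintype_card]
  simp

/-- The indicator vector of the coordinate `c` (zero if `c` is out of range). -/
def coordVec (𝔽 : Type*) [Field 𝔽] (n c : ℕ) : Fin n → 𝔽 := fun i => if (i : ℕ) = c then 1 else 0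

theorem coordVec_dotProduct_eq_zero {c : ℕ} {x : Fin n → 𝔽} (hx : x ∈ initialSubmodule 𝔽 n c) :
    coordVec 𝔽 n c ⬝ᵥ x = 0 := by
  refine Finset.sum_eq_zero fun i _ => ?_
  by_cases h : (i : ℕ) = c
  · simp [hx i h.ge]
  · simp [coordVec, h]

theorem coordVec_dotProduct {c : ℕ} (hc : c < n) (x : Fin n → 𝔽) :
    coordVec 𝔽 n c ⬝ᵥ x = x ⟨c, hc⟩ := by
  rw [dotProduct, Finset.sum_eq_single ⟨c, hc⟩]
  · simp [coordVec]
  · intro i _ hi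
    have : (i : ℕ) ≠ c := fun h => hi (Fin.ext h)
    simp [coordVec, this]
  · simp

theorem coordVec_vecMul {c : ℕ} (M : Matrix (Fin n) (Fin n) 𝔽)
    (h : ∀ i j : Fin n, (i : ℕ) = c → M i j = (1 : Matrix (Fin n) (Fin n) 𝔽) i j) :
    coordVec 𝔽 n c ᵥ* M = coordVec 𝔽 n c := by
  ext j
  by_cases hc : c < n
  · rw [vecMul, coordVec_dotProduct hc, h _ _ rfl, one_apply]
    simp only [coordVec, Fin.ext_iff, eq_comm]
  · have : coordVec 𝔽 n c = 0 := by
      ext i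
      have : (i : ℕ) ≠ c := by omega
      simp [coordVec, this]
    simp [this]

/-- The unipotent matrix `1 + x eᵢᵀ` where `i = c`. -/
def columnUnipotent (c : ℕ) (x : initialSubmodule 𝔽 n c) : GL (Fin n) 𝔽 where
  val := 1 + vecMulVec x.1 (coordVec 𝔽 n c)
  inv := 1 - vecMulVec x.1 (coordVec 𝔽 n c)
  val_inv := by
    rw [add_mul, mul_sub, mul_sub, vecMulVec_mul_vecMulVec, coordVec_dotProduct_eq_zero x.2]
    simp
  inv_val := by
    rw [sub_mul, mul_add, mul_add, vecMulVec_mul_vecMulVec, coordVec_dotProduct_eq_zero x.2]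
    simp

theorem columnUnipotent_val (c : ℕ) (x : initialSubmodule 𝔽 n c) :
    (columnUnipotent c x : Matrix (Fin n) (Fin n) 𝔽) = 1 + vecMulVec x.1 (coordVec 𝔽 n c) := rfl

theorem columnUnipotent_zero (c : ℕ) :
    columnUnipotent c (0 : initialSubmodule 𝔽 n c) = 1 := by
  ext1
  simp [columnUnipotent_val]

theorem columnUnipotent_add (c : ℕ) (x y : initialSubmodule 𝔽 n c) :
    columnUnipotent c (x + y) = columnUnipotent c x * columnUnipotent c y := by
  ext1
  rw [Units.val_mul, columnUnipotent_val, columnUnipotent_val, columnUnipotent_val, add_mul,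
    mul_add, mul_add, vecMulVec_mul_vecMulVec, coordVec_dotProduct_eq_zero y.2]
  simp only [Submodule.coe_add, add_vecMulVec, mul_one, one_mul, zero_smul,
    vecMulVec_zero, add_zero]
  abel

/-- The rows of `g` of index at least `c` are those of the identity matrix. -/
def FixesRows (c : ℕ) (g : GL (Fin n) 𝔽) : Prop :=
  ∀ i j : Fin n, c ≤ (i : ℕ) → (g : Matrix (Fin n) (Fin n) 𝔽) i j =
    (1 : Matrix (Fin n) (Fin n) 𝔽) i j

theorem FixesRows.mono {c d : ℕ} (h : c ≤ d) {g : GL (Fin n) 𝔽} (hg : FixesRows c g) :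
    FixesRows d g := fun i j hi => hg i j (h.trans hi)

theorem FixesRows.mulVec_apply {c : ℕ} {g : GL (Fin n) 𝔽} (hg : FixesRows c g)
    (x : Fin n → 𝔽) (i : Fin n) (hi : c ≤ (i : ℕ)) :
    ((g : Matrix (Fin n) (Fin n) 𝔽) *ᵥ x) i = x i := by
  have : (fun j => (g : Matrix (Fin n) (Fin n) 𝔽) i j) = Pi.single i 1 := by
    ext j
    rw [hg i j hi, one_apply, Pi.single_apply]
    simp only [eq_comm]
  rw [mulVec, this]
  simp

theorem FixesRows.mulVec_mem {c j : ℕ} (hcj : c ≤ j) {g : GL (Fin n) 𝔽} (hg : FixesRows c g)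
    {x : Fin n → 𝔽} (hx : x ∈ initialSubmodule 𝔽 n j) :
    (g : Matrix (Fin n) (Fin n) 𝔽) *ᵥ x ∈ initialSubmodule 𝔽 n j := fun i hi => by
  rw [hg.mulVec_apply x i (hcj.trans hi), hx i hi]

theorem FixesRows.mul_columnUnipotent {c j : ℕ} (hcj : c ≤ j) {g : GL (Fin n) 𝔽}
    (hg : FixesRows c g) (x : initialSubmodule 𝔽 n j) :
    g * columnUnipotent j x = columnUnipotent j ⟨_, hg.mulVec_mem hcj x.2⟩ * g := by
  ext1
  rw [Units.val_mul, Units.val_mul, columnUnipotent_val, columnUnipotent_val, mul_add, add_mul,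
    mul_vecMulVec, vecMulVec_mul, coordVec_vecMul]
  · simp
  · intro i k hi
    exact hg i k (hi ▸ hcj)

theorem fixesRows_columnUnipotent {c j : ℕ} (x : initialSubmodule 𝔽 n j)
    (hx : x.1 ∈ initialSubmodule 𝔽 n c) : FixesRows c (columnUnipotent j x) := by
  intro i k hi
  rw [columnUnipotent_val, Matrix.add_apply, vecMulVec_apply, hx i hi]
  simp

/-- Every nonzero row supported on the first `c + 1` coordinates is the row of index `c` of an
invertible matrix fixing the later rows. -/
theorem exists_fixesRows_row_eq {c : ℕ} (hc : c < n) {y : Fin n → 𝔽}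
    (hy : y ∈ initialSubmodule 𝔽 n (c + 1)) (hy0 : y ≠ 0) :
    ∃ g : GL (Fin n) 𝔽, FixesRows (c + 1) g ∧
      ∀ x, coordVec 𝔽 n c ⬝ᵥ ((g : Matrix (Fin n) (Fin n) 𝔽) *ᵥ x) = y ⬝ᵥ x := by
  obtain ⟨k, hk⟩ : ∃ k, y k ≠ 0 := by
    by_contra! h
    exact hy0 (funext h)
  have hkc : (k : ℕ) < c + 1 := by
    by_contra h
    exact hk (hy k (not_lt.1 h))
  let c' : Fin n := ⟨c, hc⟩
  let M : Matrix (Fin n) (Fin n) 𝔽 := (updateRow 1 k y).submatrix (Equiv.swap k c') id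
  have hdet : M.det ≠ 0 := by
    simp only [M]
    rw [det_permute]
    have : (updateRow (1 : Matrix (Fin n) (Fin n) 𝔽) k y).det = y k := by
      have h := cramer_transpose_apply (1 : Matrix (Fin n) (Fin n) 𝔽) y k
      rw [transpose_one, cramer_one] at h
      exact h.symm
    rw [this]
    refine mul_ne_zero ?_ hk
    rcases Int.units_eq_one_or (Equiv.Perm.sign (Equiv.swap k c')) with h | h <;> simp [h]
  refine ⟨GeneralLinearGroup.mkOfDetNeZero M hdet, fun i j hi => ?_, fun x => ?_⟩
  · change updateRow 1 k y (Equiv.swap k c' i) j = _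
    have h1 : i ≠ k := by rintro rfl; omega
    have h2 : i ≠ c' := by rintro rfl; simp [c'] at hi
    rw [Equiv.swap_apply_of_ne_of_ne h1 h2, updateRow_ne h1]
  · rw [coordVec_dotProduct hc]
    change (fun j => updateRow 1 k y (Equiv.swap k c' c') j) ⬝ᵥ x = _
    rw [Equiv.swap_apply_right]
    congr 1
    ext j
    rw [updateRow_self]

/-- Block unipotent matrices are products of column unipotents. -/
theorem apply_eq_of_isBlockUnipotent {V : Type*} [AddCommGroup V] [Module ℂ V]
    (π : Representation ℂ (GL (Fin n) 𝔽) V) {k : ℕ} {z : V}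
    (hz : ∀ j, k ≤ j → ∀ x : initialSubmodule 𝔽 n j, x.1 ∈ initialSubmodule 𝔽 n k →
      π (columnUnipotent j x) z = z)
    {u : GL (Fin n) 𝔽} (hu : IsBlockUnipotent k u) : π u z = z := by
  suffices H : ∀ m : ℕ, ∀ u : GL (Fin n) 𝔽, IsBlockUnipotent k u →
      (∀ i j : Fin n, m ≤ (j : ℕ) → (u : Matrix (Fin n) (Fin n) 𝔽) i j =
        (1 : Matrix (Fin n) (Fin n) 𝔽) i j) → π u z = z from
    H n u hu fun i j hj => absurd j.2 (not_lt.2 hj)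
  intro m
  induction m with
  | zero =>
    intro u _ h
    have : u = 1 := by
      ext i j
      exact h i j (Nat.zero_le _)
    rw [this, map_one, Module.End.one_apply]
  | succ m ih =>
    intro u hu h
    by_cases hmn : m < n
    swap
    · exact ih u hu fun i j hj => absurd j.2 (by omega)
    by_cases hmk : m < k
    · refine ih u hu fun i j hj => ?_
      rcases eq_or_lt_of_le hj with hj | hj
      · by_cases hij : i = j
        · rw [hij, hu.1, one_apply_eq]
        · rw [hu.2 i j hij (by omega), one_apply_ne hij]
      · exact h i j hj
    · let x : Fin n → 𝔽 := fun i =>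
        if (i : ℕ) < k then (u : Matrix (Fin n) (Fin n) 𝔽) i ⟨m, hmn⟩ else 0
      have hxk : x ∈ initialSubmodule 𝔽 n k := fun i hi => by simp [x, not_lt.2 hi]
      have hxm : x ∈ initialSubmodule 𝔽 n m := initialSubmodule_mono (not_lt.1 hmk) hxk
      let t := columnUnipotent m ⟨x, hxm⟩
      have hrow : ∀ i j : Fin n, k ≤ (i : ℕ) → (u : Matrix (Fin n) (Fin n) 𝔽) i j =
          (1 : Matrix (Fin n) (Fin n) 𝔽) i j := by
        intro i j hi
        by_cases hij : i = j
        · rw [hij, hu.1, one_apply_eq]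
        · rw [hu.2 i j hij (by omega), one_apply_ne hij]
      have hval : ((t⁻¹ * u : GL (Fin n) 𝔽) : Matrix (Fin n) (Fin n) 𝔽) =
          u - vecMulVec x (coordVec 𝔽 n m) := by
        change (1 - vecMulVec x (coordVec 𝔽 n m)) * (u : Matrix (Fin n) (Fin n) 𝔽) = _
        rw [sub_mul, vecMulVec_mul, coordVec_vecMul _ fun i j hi => hrow i j (by omega), one_mul]
      have hent : ∀ i j : Fin n, ((t⁻¹ * u : GL (Fin n) 𝔽) : Matrix (Fin n) (Fin n) 𝔽) i j =
          (u : Matrix (Fin n) (Fin n) 𝔽) i j - if (j : ℕ) = m then x i else 0 := by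
        intro i j
        rw [hval, Matrix.sub_apply, vecMulVec_apply]
        simp [coordVec]
      have hu' : IsBlockUnipotent k (t⁻¹ * u) := by
        refine ⟨fun i => ?_, fun i j hij hk => ?_⟩
        · rw [hent, hu.1]
          split_ifs with hi
          · rw [hxk i (by omega), sub_zero]
          · rw [sub_zero]
        · rw [hent, hu.2 i j hij hk]
          split_ifs with hj
          · rw [hxk i (by omega), sub_zero]
          · rw [sub_zero]
      have h1 := ih (t⁻¹ * u) hu' fun i j hj => by
        rw [hent]
        rcases eq_or_lt_of_le hj with hj | hj
        · have hjm : j = ⟨m, hmn⟩ := Fin.ext hj.symm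
          subst hjm
          rw [if_pos rfl]
          by_cases hi : (i : ℕ) < k
          · have hne : i ≠ ⟨m, hmn⟩ := by
              rintro rfl
              exact hmk hi
            simp [x, hi, one_apply_ne hne]
          · rw [hxk i (not_lt.1 hi), sub_zero, hrow i _ (not_lt.1 hi)]
        · rw [h i j hj, if_neg (by omega), sub_zero]
      calc π u z = π (t * (t⁻¹ * u)) z := by rw [mul_inv_cancel_left]
        _ = z := by
          rw [map_mul, Module.End.mul_apply, h1]
          exact hz m (not_lt.1 hmk) _ hxk

end Columns

section Isotypic

variable {S V : Type*} [AddCommGroup S] [Fintype S] [AddCommGroup V] [Module ℂ V]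

/-- The projection onto the `χ`-isotypic part of a representation of a finite abelian group. -/
noncomputable def isotypicProj (τ : AddChar S (Module.End ℂ V)) (χ : AddChar S ℂ) :
    Module.End ℂ V :=
  (Fintype.card S : ℂ)⁻¹ • ∑ x, χ (-x) • τ x

theorem mul_isotypicProj (τ : AddChar S (Module.End ℂ V)) (χ : AddChar S ℂ) (x : S) :
    τ x * isotypicProj τ χ = χ x • isotypicProj τ χ := by
  rw [isotypicProj, mul_smul_comm, smul_comm (χ x)]
  congr 1
  rw [Finset.mul_sum, Finset.smul_sum]
  refine Fintype.sum_bijective (x + ·) (AddGroup.addLeft_bijective x) _ _ fun y => ?_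
  rw [mul_smul_comm, ← AddChar.map_add_eq_mul, smul_smul, ← AddChar.map_add_eq_mul]
  congr 2
  abel

theorem isotypicProj_mul_self (τ : AddChar S (Module.End ℂ V)) (χ : AddChar S ℂ) :
    isotypicProj τ χ * isotypicProj τ χ = isotypicProj τ χ := by
  have hS : (Fintype.card S : ℂ) ≠ 0 := Nat.cast_ne_zero.2 Fintype.card_ne_zero
  conv_lhs => rw [isotypicProj, smul_mul_assoc, Finset.sum_mul]
  simp_rw [smul_mul_assoc]
  change (Fintype.card S : ℂ)⁻¹ • ∑ x, χ (-x) • (τ x * isotypicProj τ χ) = _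
  simp_rw [mul_isotypicProj, smul_smul, ← AddChar.map_add_eq_mul, neg_add_cancel,
    AddChar.map_zero_eq_one, one_smul]
  rw [Finset.sum_const, Finset.card_univ, ← Nat.cast_smul_eq_nsmul ℂ, smul_smul,
    inv_mul_cancel₀ hS, one_smul]

theorem sum_isotypicProj (τ : AddChar S (Module.End ℂ V)) :
    ∑ χ : AddChar S ℂ, isotypicProj τ χ = 1 := by
  classical
  have hS : (Fintype.card S : ℂ) ≠ 0 := Nat.cast_ne_zero.2 Fintype.card_ne_zero
  simp_rw [isotypicProj]
  rw [← Finset.smul_sum, Finset.sum_comm]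
  simp_rw [← Finset.sum_smul, AddChar.sum_apply_eq_ite, neg_eq_zero, ite_smul, zero_smul]
  rw [Finset.sum_ite_eq' Finset.univ 0, if_pos (Finset.mem_univ _), AddChar.map_zero_eq_one,
    smul_smul, inv_mul_cancel₀ hS, one_smul]

theorem mul_isotypicProj_eq (τ : AddChar S (Module.End ℂ V)) {χ χ' : AddChar S ℂ}
    {g : Module.End ℂ V} {s : S →+ S} (hs : Function.Bijective s)
    (hg : ∀ x, g * τ x = τ (s x) * g) (hχ : ∀ x, χ' (s x) = χ x) :
    g * isotypicProj τ χ = isotypicProj τ χ' * g := by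
  rw [isotypicProj, isotypicProj, mul_smul_comm, smul_mul_assoc, Finset.mul_sum, Finset.sum_mul]
  congr 1
  refine Fintype.sum_bijective s hs _ _ fun x => ?_
  rw [mul_smul_comm, smul_mul_assoc, hg, ← map_neg, hχ]

end Isotypic

section CuspidalDimension

variable {𝔽 : Type*} [Field 𝔽] {n : ℕ}

variable {V : Type*} [AddCommGroup V] [Module ℂ V] (π : Representation ℂ (GL (Fin n) 𝔽) V)

/-- The representation of the group of column unipotents of index `c`. -/
def columnRep (c : ℕ) : AddChar (initialSubmodule 𝔽 n c) (Module.End ℂ V) where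
  toFun x := π (columnUnipotent c x)
  map_zero_eq_one' := by rw [columnUnipotent_zero, map_one]
  map_add_eq_mul' x y := by rw [columnUnipotent_add, map_mul]

theorem columnRep_apply (c : ℕ) (x : initialSubmodule 𝔽 n c) :
    columnRep π c x = π (columnUnipotent c x) := rfl

variable [Fintype 𝔽]

noncomputable instance (c : ℕ) : Fintype (initialSubmodule 𝔽 n c) := Fintype.ofFinite _

/-- The character `x ↦ ψ (y ⬝ᵥ x)`, for the standard primitive character `ψ` of `𝔽`. -/
noncomputable def dotChar (c : ℕ) (y : Fin n → 𝔽) : AddChar (initialSubmodule 𝔽 n c) ℂ where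
  toFun x := AddChar.FiniteField.primitiveChar_to_Complex 𝔽 (y ⬝ᵥ x.1)
  map_zero_eq_one' := by simp
  map_add_eq_mul' x x' := by simp [AddChar.map_add_eq_mul]

theorem dotChar_apply (c : ℕ) (y : Fin n → 𝔽) (x : initialSubmodule 𝔽 n c) :
    dotChar c y x = AddChar.FiniteField.primitiveChar_to_Complex 𝔽 (y ⬝ᵥ x.1) := rfl

theorem dotChar_bijective (c : ℕ) :
    Function.Bijective fun y : initialSubmodule 𝔽 n c => dotChar c y.1 := by
  rw [Fintype.bijective_iff_injective_and_card]
  refine ⟨fun y y' h => ?_, AddChar.card_eq.symm⟩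
  ext i
  by_cases hi : c ≤ (i : ℕ)
  · rw [y.2 i hi, y'.2 i hi]
  by_contra hne
  refine AddChar.FiniteField.primitiveChar_to_Complex_isPrimitive 𝔽 (sub_ne_zero.2 hne) ?_
  ext a
  have hx : Pi.single i a ∈ initialSubmodule 𝔽 n c := fun j hj => by
    have : j ≠ i := by
      rintro rfl
      exact hi hj
    simp [this]
  have h1 := DFunLike.congr_fun h ⟨_, hx⟩
  simp only [dotChar_apply, dotProduct_single] at h1
  rw [AddChar.mulShift_apply, sub_mul, AddChar.map_sub_eq_div, h1, AddChar.one_apply]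
  exact div_self (AddChar.val_isUnit _ _).ne_zero

theorem FixesRows.mul_isotypicProj {c : ℕ} {g : GL (Fin n) 𝔽} (hg : FixesRows c g)
    {y y' : Fin n → 𝔽} (h : ∀ x ∈ initialSubmodule 𝔽 n c,
      y' ⬝ᵥ ((g : Matrix (Fin n) (Fin n) 𝔽) *ᵥ x) = y ⬝ᵥ x) :
    π g * isotypicProj (columnRep π c) (dotChar c y) =
      isotypicProj (columnRep π c) (dotChar c y') * π g := by
  let s : initialSubmodule 𝔽 n c →+ initialSubmodule 𝔽 n c :=
    { toFun := fun x => ⟨_, hg.mulVec_mem le_rfl x.2⟩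
      map_zero' := Subtype.ext (by simp)
      map_add' := fun x x' => Subtype.ext (by simp [mulVec_add]) }
  have hs : Function.Injective s := fun x x' hx => by
    have h1 := congrArg (fun v => ((g⁻¹ : GL (Fin n) 𝔽) : Matrix (Fin n) (Fin n) 𝔽) *ᵥ v.1) hx
    simp only [s, AddMonoidHom.coe_mk, ZeroHom.coe_mk, mulVec_mulVec] at h1
    rw [Units.inv_mul, one_mulVec, one_mulVec] at h1
    exact Subtype.ext h1
  refine mul_isotypicProj_eq (s := s) _ (Finite.injective_iff_bijective.1 hs) (fun x => ?_)
    fun x => ?_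
  · rw [columnRep_apply, columnRep_apply, ← map_mul, ← map_mul, hg.mul_columnUnipotent le_rfl]
    rfl
  · rw [dotChar_apply, dotChar_apply, ← h x.1 x.2]
    rfl

variable {π}

/-- One step in the derivation of the Kirillov model: the idempotent `E` cuts out vectors with a
nondegenerate character along the columns of index at least `c + 2`. -/
theorem IsCuspidal.exists_idempotent_step [FiniteDimensional ℂ V] (hπ : IsCuspidal π) {c : ℕ}
    (hc : c + 1 < n) {E : Module.End ℂ V} (hE : E * E = E)
    (hcomm : ∀ g, FixesRows (c + 1) g → π g * E = E * π g)
    (hfix : ∀ j, c + 2 ≤ j → ∀ x : initialSubmodule 𝔽 n j,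
      x.1 ∈ initialSubmodule 𝔽 n (c + 1) → π (columnUnipotent j x) * E = E) :
    ∃ E' : Module.End ℂ V, E' * E' = E' ∧ (∀ g, FixesRows c g → π g * E' = E' * π g) ∧
      (∀ j, c + 1 ≤ j → ∀ x : initialSubmodule 𝔽 n j,
        x.1 ∈ initialSubmodule 𝔽 n c → π (columnUnipotent j x) * E' = E') ∧
      LinearMap.trace ℂ V E = ((Fintype.card 𝔽 : ℂ) ^ (c + 1) - 1) * LinearMap.trace ℂ V E' := by
  classical
  set A : (Fin n → 𝔽) → Module.End ℂ V :=
    fun y => isotypicProj (columnRep π (c + 1)) (dotChar (c + 1) y) with hA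
  have hcol : ∀ x : initialSubmodule 𝔽 n (c + 1),
      π (columnUnipotent (c + 1) x) * E = E * π (columnUnipotent (c + 1) x) :=
    fun x => hcomm _ (fixesRows_columnUnipotent x x.2)
  have hEA : ∀ y, A y * E = E * A y := fun y => by
    simp only [hA, isotypicProj, columnRep_apply, smul_mul_assoc, mul_smul_comm, Finset.sum_mul,
      Finset.mul_sum, hcol]
  have hAmul : ∀ y (x : initialSubmodule 𝔽 n (c + 1)),
      π (columnUnipotent (c + 1) x) * A y = dotChar (c + 1) y x • A y :=
    fun y x => mul_isotypicProj (columnRep π (c + 1)) _ x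
  have hfixA : ∀ y j, c + 2 ≤ j → ∀ x : initialSubmodule 𝔽 n j,
      x.1 ∈ initialSubmodule 𝔽 n (c + 1) → π (columnUnipotent j x) * (E * A y) = E * A y := by
    intro y j hj x hx
    rw [← mul_assoc, hfix j hj x hx]
  have hfixA' : ∀ y (x : initialSubmodule 𝔽 n (c + 1)), y ⬝ᵥ x.1 = 0 →
      π (columnUnipotent (c + 1) x) * (E * A y) = E * A y := by
    intro y x h
    rw [← mul_assoc, hcol, mul_assoc, hAmul, dotChar_apply, h, AddChar.map_zero_eq_one, one_smul]
  set e := coordVec 𝔽 n c with he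
  refine ⟨E * A e, ?_, fun g hg => ?_, fun j hj x hx => ?_, ?_⟩
  · rw [mul_assoc, ← mul_assoc (A e), hEA, mul_assoc, ← mul_assoc, hE]
    congr 1
    exact isotypicProj_mul_self _ _
  · have hg' := hg.mono (Nat.le_succ c)
    rw [← mul_assoc, hcomm g hg', mul_assoc, mul_assoc]
    congr 1
    refine hg'.mul_isotypicProj π fun x _ => ?_
    rw [he, coordVec_dotProduct (by omega), coordVec_dotProduct (by omega)]
    exact hg.mulVec_apply x _ le_rfl
  · rcases eq_or_lt_of_le hj with rfl | hj
    · exact hfixA' _ x (coordVec_dotProduct_eq_zero hx)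
    · exact hfixA _ j hj x (initialSubmodule_mono (Nat.le_succ c) hx)
  · have hzero : E * A 0 = 0 := by
      refine LinearMap.ext fun v => ?_
      refine hπ.2 (c + 1) (Nat.succ_pos c) hc _ fun u hu => ?_
      refine apply_eq_of_isBlockUnipotent π (fun j hj x hx => ?_) hu
      rw [← Module.End.mul_apply]
      congr 1
      rcases eq_or_lt_of_le hj with rfl | hj
      · exact hfixA' 0 x (zero_dotProduct _)
      · exact hfixA 0 j hj x hx
    have htr : ∀ y : initialSubmodule 𝔽 n (c + 1), y ≠ 0 →
        LinearMap.trace ℂ V (E * A y.1) = LinearMap.trace ℂ V (E * A e) := by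
      intro y hy
      obtain ⟨g, hg, hgy⟩ := exists_fixesRows_row_eq (Nat.lt_of_succ_lt hc) y.2
        (fun h => hy (Subtype.ext h))
      have h1 : π g * A y.1 = A e * π g := hg.mul_isotypicProj π fun x _ => hgy x
      have h2 : π g * π g⁻¹ = 1 := by rw [← map_mul, mul_inv_cancel, map_one]
      have h3 : π g⁻¹ * π g = 1 := by rw [← map_mul, inv_mul_cancel, map_one]
      calc LinearMap.trace ℂ V (E * A y.1) =
          LinearMap.trace ℂ V (π g⁻¹ * (π g * (E * A y.1))) := by
            rw [← mul_assoc, h3, one_mul]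
        _ = LinearMap.trace ℂ V (E * A e * (π g * π g⁻¹)) := by
            rw [LinearMap.trace_mul_comm, ← mul_assoc (π g), hcomm g hg, mul_assoc E, h1]
            simp only [mul_assoc]
        _ = _ := by rw [h2, mul_one]
    have hsum : ∑ y : initialSubmodule 𝔽 n (c + 1), A y.1 = 1 := by
      rw [← sum_isotypicProj (columnRep π (c + 1))]
      exact Fintype.sum_bijective _ (dotChar_bijective (c + 1)) _ _ fun _ => rfl
    calc LinearMap.trace ℂ V E = ∑ y : initialSubmodule 𝔽 n (c + 1),
          LinearMap.trace ℂ V (E * A y.1) := by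
            rw [← map_sum, ← Finset.mul_sum, hsum, mul_one]
      _ = ∑ y ∈ Finset.univ.erase (0 : initialSubmodule 𝔽 n (c + 1)),
          LinearMap.trace ℂ V (E * A e) := by
            rw [← Finset.add_sum_erase _ _ (Finset.mem_univ 0), Submodule.coe_zero, hzero, map_zero,
              zero_add]
            exact Finset.sum_congr rfl fun y hy => htr y (Finset.ne_of_mem_erase hy)
      _ = _ := by
            rw [Finset.sum_const, Finset.card_erase_of_mem (Finset.mem_univ _), Finset.card_univ,
              ← Nat.card_eq_fintype_card, card_initialSubmodule hc.le, nsmul_eq_mul,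
              Nat.cast_sub (Nat.one_le_pow _ _ Fintype.card_pos)]
            push_cast
            rfl

/-- The dimension of a cuspidal representation of `GL_n(𝔽)` is a multiple of
`(q - 1) (q ^ 2 - 1) ⋯ (q ^ (n - 1) - 1)`. -/
theorem IsCuspidal.exists_finrank_eq [FiniteDimensional ℂ V] (hπ : IsCuspidal π) (hn : 1 ≤ n) :
    ∃ m : ℕ, (Module.finrank ℂ V : ℂ) =
      m * ∏ i ∈ Finset.range (n - 1), ((Fintype.card 𝔽 : ℂ) ^ (i + 1) - 1) := by
  have key : ∀ c, c ≤ n - 1 → ∃ E : Module.End ℂ V, E * E = E ∧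
      (∀ g, FixesRows c g → π g * E = E * π g) ∧
      (∀ j, c + 1 ≤ j → ∀ x : initialSubmodule 𝔽 n j,
        x.1 ∈ initialSubmodule 𝔽 n c → π (columnUnipotent j x) * E = E) ∧
      (Module.finrank ℂ V : ℂ) =
        (∏ i ∈ Finset.Ico c (n - 1), ((Fintype.card 𝔽 : ℂ) ^ (i + 1) - 1)) *
          LinearMap.trace ℂ V E := by
    intro c hc
    refine Nat.decreasingInduction (motive := fun c _ => ∃ E : Module.End ℂ V, E * E = E ∧
      (∀ g, FixesRows c g → π g * E = E * π g) ∧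
      (∀ j, c + 1 ≤ j → ∀ x : initialSubmodule 𝔽 n j,
        x.1 ∈ initialSubmodule 𝔽 n c → π (columnUnipotent j x) * E = E) ∧
      (Module.finrank ℂ V : ℂ) =
        (∏ i ∈ Finset.Ico c (n - 1), ((Fintype.card 𝔽 : ℂ) ^ (i + 1) - 1)) *
          LinearMap.trace ℂ V E) (fun c hc ⟨E, hE, hcomm, hfix, hdim⟩ => ?_) ?_ hc
    · obtain ⟨E', h1, h2, h3, h4⟩ := hπ.exists_idempotent_step (by omega) hE hcomm hfix
      refine ⟨E', h1, h2, h3, ?_⟩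
      rw [hdim, h4, Finset.prod_eq_prod_Ico_succ_bot hc]
      ring
    · refine ⟨1, mul_one 1, fun g _ => by rw [mul_one, one_mul], fun j hj x _ => ?_, ?_⟩
      · have : columnUnipotent j x = 1 := by
          have h0 : coordVec 𝔽 n j = 0 := by
            ext i
            have : (i : ℕ) ≠ j := by omega
            simp [coordVec, this]
          ext1
          rw [columnUnipotent_val, h0]
          simp
        rw [this, map_one, one_mul]
      · simp [LinearMap.trace_one]
  obtain ⟨E, hE, -, -, hdim⟩ := key 0 (Nat.zero_le _)
  refine ⟨Module.finrank ℂ E.range, ?_⟩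
  rw [hdim, (LinearMap.IsIdempotentElem.isProj_range E hE).trace, Finset.range_eq_Ico, mul_comm]

end CuspidalDimension

section Induced

variable {G : Type*} [Group G] {P : Subgroup G} {W : Type*} [AddCommGroup W] [Module ℂ W]
  (θ : Representation ℂ P W)

theorem inducedRep_apply (g : G) (f : inducedSpace P θ) (x : G) :
    (inducedRep P θ g f).1 x = f.1 (x * g) := rfl

open Classical in
/-- The function in the induced representation supported on `P` with value `v` at `1`. -/
noncomputable def supportedOn : W →ₗ[ℂ] inducedSpace P θ where
  toFun v := ⟨fun x => if h : x ∈ P then θ ⟨x, h⟩ v else 0, fun p g => by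
    beta_reduce
    by_cases h : g ∈ P
    · rw [dif_pos h, dif_pos (P.mul_mem p.2 h), ← Module.End.mul_apply, ← map_mul]
      rfl
    · rw [dif_neg h, dif_neg fun h' => h ((P.mul_mem_cancel_left p.2).1 h'), map_zero]⟩
  map_add' v w := Subtype.ext <| funext fun x => by
    by_cases h : x ∈ P <;> simp [h]
  map_smul' c v := Subtype.ext <| funext fun x => by
    by_cases h : x ∈ P <;> simp [h]

theorem supportedOn_apply_of_mem (v : W) (p : P) : (supportedOn θ v).1 p = θ p v :=
  dif_pos p.2

theorem supportedOn_apply_of_notMem (v : W) {x : G} (hx : x ∉ P) : (supportedOn θ v).1 x = 0 :=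
  dif_neg hx

theorem supportedOn_apply_one (v : W) : (supportedOn θ v).1 1 = v := by
  have := supportedOn_apply_of_mem θ v 1
  rwa [map_one, Module.End.one_apply] at this

theorem inducedRep_supportedOn (p : P) (v : W) :
    inducedRep P θ p (supportedOn θ v) = supportedOn θ (θ p v) := by
  refine Subtype.ext (funext fun x => ?_)
  rw [inducedRep_apply]
  by_cases h : x ∈ P
  · have h1 := supportedOn_apply_of_mem θ v (⟨x, h⟩ * p)
    have h2 := supportedOn_apply_of_mem θ (θ p v) ⟨x, h⟩
    rw [map_mul] at h1
    exact h1.trans h2.symm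
  · rw [supportedOn_apply_of_notMem θ _ h,
      supportedOn_apply_of_notMem θ _ fun h' => h ((P.mul_mem_cancel_right p.2).1 h')]

/-- Evaluation of induced functions. -/
def evalAt (x : G) : inducedSpace P θ →ₗ[ℂ] W where
  toFun f := f.1 x
  map_add' _ _ := rfl
  map_smul' _ _ := rfl

theorem evalAt_apply (x : G) (f : inducedSpace P θ) : evalAt θ x f = f.1 x := rfl

theorem supportedOn_apply_mul {A : Module.End ℂ (inducedSpace P θ)}
    (hA : ∀ g f, A (inducedRep P θ g f) = inducedRep P θ g (A f)) (v : W) (g : G) (p : P) :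
    (A (supportedOn θ v)).1 (g * p) = (A (supportedOn θ (θ p v))).1 g := by
  rw [← inducedRep_supportedOn, hA, inducedRep_apply]

variable [Fintype G]

theorem sum_inducedRep_supportedOn (f : inducedSpace P θ) :
    ∑ g : G, inducedRep P θ g⁻¹ (supportedOn θ (f.1 g)) = (Nat.card P : ℂ) • f := by
  classical
  refine Subtype.ext (funext fun x => ?_)
  have h1 : ∀ g : G, (inducedRep P θ g⁻¹ (supportedOn θ (f.1 g))).1 x =
      if x * g⁻¹ ∈ P then f.1 x else 0 := by
    intro g
    rw [inducedRep_apply]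
    split_ifs with h
    · have h2 := supportedOn_apply_of_mem θ (f.1 g) ⟨_, h⟩
      rw [← f.2] at h2
      simpa using h2
    · exact supportedOn_apply_of_notMem θ _ h
  rw [← evalAt_apply θ x, map_sum]
  simp_rw [evalAt_apply, h1]
  rw [← Finset.sum_filter, Finset.sum_const, ← Nat.cast_smul_eq_nsmul ℂ]
  congr 2
  rw [Nat.card_eq_fintype_card, Fintype.card_subtype]
  refine Finset.card_bij (fun g _ => x * g⁻¹) (fun g hg => by simpa using hg)
    (fun g _ g' _ h => by simpa using h) fun p hp => ⟨p⁻¹ * x, by simpa using hp, by simp⟩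

theorem card_subgroup_ne_zero : (Nat.card P : ℂ) ≠ 0 := Nat.cast_ne_zero.2 Nat.card_pos.ne'

/-- An intertwining operator vanishing on functions supported on `P` is zero. -/
theorem eq_zero_of_supportedOn_eq_zero {A : Module.End ℂ (inducedSpace P θ)}
    (hA : ∀ g f, A (inducedRep P θ g f) = inducedRep P θ g (A f))
    (h : ∀ v, A (supportedOn θ v) = 0) : A = 0 := by
  refine LinearMap.ext fun f => ?_
  have h1 := congrArg A (sum_inducedRep_supportedOn θ f)
  rw [map_sum, map_smul] at h1
  simp only [hA, h, map_zero, Finset.sum_const_zero] at h1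
  exact (smul_eq_zero.1 h1.symm).resolve_left card_subgroup_ne_zero

/-- An intertwining operator with no contribution from the trivial double coset has trace zero. -/
theorem trace_eq_zero_of_supportedOn_apply_one
    {A : Module.End ℂ (inducedSpace P θ)}
    (hA : ∀ g f, A (inducedRep P θ g f) = inducedRep P θ g (A f))
    (h : ∀ v, (A (supportedOn θ v)).1 1 = 0) : LinearMap.trace ℂ _ A = 0 := by
  let E : Module.End ℂ (inducedSpace P θ) := supportedOn θ ∘ₗ evalAt θ 1
  have hE : ∀ f, E f = supportedOn θ (f.1 1) := fun _ => rfl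
  have hEE : E * E = E := LinearMap.ext fun f => by
    rw [Module.End.mul_apply, hE, hE, supportedOn_apply_one]
  have hEA : E * A * E = 0 := LinearMap.ext fun f => by
    rw [Module.End.mul_apply, Module.End.mul_apply, hE, hE, h, map_zero, LinearMap.zero_apply]
  have hsum : ∑ g : G, inducedRep P θ g⁻¹ * (E * inducedRep P θ g) =
      (Nat.card P : ℂ) • (1 : Module.End ℂ (inducedSpace P θ)) := by
    refine LinearMap.ext fun f => ?_
    rw [LinearMap.sum_apply]
    refine Eq.trans (Finset.sum_congr rfl fun g _ => ?_) (sum_inducedRep_supportedOn θ f)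
    rw [Module.End.mul_apply, Module.End.mul_apply, hE, inducedRep_apply, one_mul]
  have hterm : ∀ g : G,
      LinearMap.trace ℂ _ (A * (inducedRep P θ g⁻¹ * (E * inducedRep P θ g))) = 0 := by
    intro g
    have h1 : A * inducedRep P θ g⁻¹ = inducedRep P θ g⁻¹ * A := LinearMap.ext (hA g⁻¹)
    have h2 : inducedRep P θ g * inducedRep P θ g⁻¹ = 1 := by
      rw [← map_mul, mul_inv_cancel, map_one]
    rw [← mul_assoc, h1, mul_assoc, LinearMap.trace_mul_comm, mul_assoc, mul_assoc, h2, mul_one,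
      ← hEE, ← mul_assoc, LinearMap.trace_mul_comm, ← mul_assoc, hEA, map_zero]
  have h1 := congrArg (fun B => LinearMap.trace ℂ _ (A * B)) hsum
  simp only [Finset.mul_sum, map_sum, hterm, Finset.sum_const_zero, mul_smul_comm, mul_one,
    map_smul, smul_eq_mul] at h1
  exact (mul_eq_zero.1 h1.symm).resolve_left card_subgroup_ne_zero

end Induced

section Blocks

variable {𝔽 : Type*} {n : ℕ}

/-- The `2n × 2n` matrix with the given `n × n` blocks. -/
def blockMatrix (A B C D : Matrix (Fin n) (Fin n) 𝔽) : Matrix (Fin (n + n)) (Fin (n + n)) 𝔽 :=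
  (fromBlocks A B C D).submatrix finSumFinEquiv.symm finSumFinEquiv.symm

theorem exists_eq_blockMatrix (M : Matrix (Fin (n + n)) (Fin (n + n)) 𝔽) :
    ∃ A B C D, M = blockMatrix A B C D := by
  let M' := M.submatrix finSumFinEquiv finSumFinEquiv
  refine ⟨M'.toBlocks₁₁, M'.toBlocks₁₂, M'.toBlocks₂₁, M'.toBlocks₂₂, ?_⟩
  rw [blockMatrix, fromBlocks_toBlocks]
  simp [M']

theorem blockMatrix_injective {A B C D A' B' C' D' : Matrix (Fin n) (Fin n) 𝔽}
    (h : blockMatrix A B C D = blockMatrix A' B' C' D') : A = A' ∧ B = B' ∧ C = C' ∧ D = D' := by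
  have h1 := congrArg (fun M => M.submatrix finSumFinEquiv finSumFinEquiv) h
  simpa [blockMatrix, fromBlocks_inj] using h1

theorem blockMatrix_castAdd_castAdd (A B C D : Matrix (Fin n) (Fin n) 𝔽) (i j : Fin n) :
    blockMatrix A B C D (Fin.castAdd n i) (Fin.castAdd n j) = A i j := by
  simp [blockMatrix]

theorem blockMatrix_natAdd_natAdd (A B C D : Matrix (Fin n) (Fin n) 𝔽) (i j : Fin n) :
    blockMatrix A B C D (Fin.natAdd n i) (Fin.natAdd n j) = D i j := by
  simp only [blockMatrix, submatrix_apply, finSumFinEquiv_symm_apply_natAdd, fromBlocks_apply₂₂]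

theorem blockMatrix_natAdd_castAdd (A B C D : Matrix (Fin n) (Fin n) 𝔽) (i j : Fin n) :
    blockMatrix A B C D (Fin.natAdd n i) (Fin.castAdd n j) = C i j := by
  simp only [blockMatrix, submatrix_apply, finSumFinEquiv_symm_apply_natAdd,
    finSumFinEquiv_symm_apply_castAdd, fromBlocks_apply₂₁]

variable [Field 𝔽]

theorem blockMatrix_mul (A B C D A' B' C' D' : Matrix (Fin n) (Fin n) 𝔽) :
    blockMatrix A B C D * blockMatrix A' B' C' D' =
      blockMatrix (A * A' + B * C') (A * B' + B * D') (C * A' + D * C') (C * B' + D * D') := by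
  rw [blockMatrix, blockMatrix, submatrix_mul_equiv, fromBlocks_multiply]
  rfl

theorem blockMatrix_one : blockMatrix (1 : Matrix (Fin n) (Fin n) 𝔽) 0 0 1 = 1 := by
  rw [blockMatrix, fromBlocks_one, submatrix_one_equiv]

theorem mem_parabolicGL_iff {g : GL (Fin (n + n)) 𝔽} {A B C D : Matrix (Fin n) (Fin n) 𝔽}
    (hg : (g : Matrix (Fin (n + n)) (Fin (n + n)) 𝔽) = blockMatrix A B C D) :
    g ∈ parabolicGL 𝔽 n n ↔ C = 0 := by
  change BlockTriangular (g : Matrix (Fin (n + n)) (Fin (n + n)) 𝔽) _ ↔ _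
  rw [hg]
  constructor
  · intro h
    ext i j
    have h1 := h (i := Fin.natAdd n i) (j := Fin.castAdd n j) (by simp)
    rwa [blockMatrix_natAdd_castAdd] at h1
  · rintro rfl i j hij
    by_cases hi : (i : ℕ) < n
    · simp [hi] at hij
    by_cases hj : (j : ℕ) < n
    · have h1 : i = Fin.natAdd n ⟨i - n, by omega⟩ := by
        ext
        simp
        omega
      have h2 : j = Fin.castAdd n ⟨j, hj⟩ := rfl
      rw [h1, h2, blockMatrix_natAdd_castAdd]
      rfl
    · simp [hi, hj] at hij

/-- The element `[[1, X], [0, 1]]` of the unipotent radical. -/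
def unipotentGL (X : Matrix (Fin n) (Fin n) 𝔽) : GL (Fin (n + n)) 𝔽 where
  val := blockMatrix 1 X 0 1
  inv := blockMatrix 1 (-X) 0 1
  val_inv := by rw [blockMatrix_mul, ← blockMatrix_one]; simp
  inv_val := by rw [blockMatrix_mul, ← blockMatrix_one]; simp

/-- The element `[[A, 0], [0, D]]` of the Levi subgroup. -/
def leviGL (A D : GL (Fin n) 𝔽) : GL (Fin (n + n)) 𝔽 where
  val := blockMatrix A 0 0 D
  inv := blockMatrix (A⁻¹ : GL (Fin n) 𝔽) 0 0 (D⁻¹ : GL (Fin n) 𝔽)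
  val_inv := by rw [blockMatrix_mul, ← blockMatrix_one]; simp only [Units.mul_inv]; simp
  inv_val := by rw [blockMatrix_mul, ← blockMatrix_one]; simp only [Units.inv_mul]; simp

/-- The Weyl element `[[0, 1], [1, 0]]`. -/
def weylGL (𝔽 : Type*) [Field 𝔽] (n : ℕ) : GL (Fin (n + n)) 𝔽 where
  val := blockMatrix 0 1 1 0
  inv := blockMatrix 0 1 1 0
  val_inv := by rw [blockMatrix_mul, ← blockMatrix_one]; simp
  inv_val := by rw [blockMatrix_mul, ← blockMatrix_one]; simp

theorem unipotentGL_val (X : Matrix (Fin n) (Fin n) 𝔽) :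
    (unipotentGL X : Matrix (Fin (n + n)) (Fin (n + n)) 𝔽) = blockMatrix 1 X 0 1 := rfl

theorem leviGL_val (A D : GL (Fin n) 𝔽) :
    (leviGL A D : Matrix (Fin (n + n)) (Fin (n + n)) 𝔽) = blockMatrix A 0 0 D := rfl

theorem weylGL_val :
    (weylGL 𝔽 n : Matrix (Fin (n + n)) (Fin (n + n)) 𝔽) = blockMatrix 0 1 1 0 := rfl

theorem unipotentGL_mem (X : Matrix (Fin n) (Fin n) 𝔽) : unipotentGL X ∈ parabolicGL 𝔽 n n :=
  (mem_parabolicGL_iff (unipotentGL_val X)).2 rfl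

theorem leviGL_mem (A D : GL (Fin n) 𝔽) : leviGL A D ∈ parabolicGL 𝔽 n n :=
  (mem_parabolicGL_iff (leviGL_val A D)).2 rfl

theorem unipotentGL_zero : unipotentGL (0 : Matrix (Fin n) (Fin n) 𝔽) = 1 := by
  ext1
  rw [unipotentGL_val, blockMatrix_one]
  rfl

theorem weylGL_mul_self : weylGL 𝔽 n * weylGL 𝔽 n = 1 := by
  ext1
  rw [Units.val_mul, weylGL_val, blockMatrix_mul, Units.val_one, ← blockMatrix_one]
  simp

theorem weylGL_mul_unipotentGL_mul_weylGL_val (X : Matrix (Fin n) (Fin n) 𝔽) :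
    ((weylGL 𝔽 n * unipotentGL X * weylGL 𝔽 n : GL (Fin (n + n)) 𝔽) :
      Matrix (Fin (n + n)) (Fin (n + n)) 𝔽) = blockMatrix 1 0 X 1 := by
  rw [Units.val_mul, Units.val_mul, weylGL_val, unipotentGL_val, blockMatrix_mul, blockMatrix_mul]
  simp

theorem unipotentGL_add (X Y : Matrix (Fin n) (Fin n) 𝔽) :
    unipotentGL (X + Y) = unipotentGL X * unipotentGL Y := by
  ext1
  simp [Units.val_mul, unipotentGL_val, blockMatrix_mul, add_comm]

theorem unipotentGL_mul_leviGL (X : Matrix (Fin n) (Fin n) 𝔽) (A D : GL (Fin n) 𝔽) :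
    unipotentGL X * leviGL A D =
      leviGL A D * unipotentGL (((A⁻¹ : GL (Fin n) 𝔽) : Matrix (Fin n) (Fin n) 𝔽) * X *
        (D : Matrix (Fin n) (Fin n) 𝔽)) := by
  ext1
  rw [Units.val_mul, Units.val_mul, unipotentGL_val, unipotentGL_val, leviGL_val, blockMatrix_mul,
    blockMatrix_mul, Matrix.mul_assoc, ← Matrix.mul_assoc (A : Matrix (Fin n) (Fin n) 𝔽),
    Units.mul_inv]
  simp

theorem weylGL_mul_leviGL (A D : GL (Fin n) 𝔽) :
    weylGL 𝔽 n * leviGL A D = leviGL D A * weylGL 𝔽 n := by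
  ext1
  simp [Units.val_mul, weylGL_val, leviGL_val, blockMatrix_mul]

theorem exists_eq_unipotentGL_mul_leviGL {p : GL (Fin (n + n)) 𝔽} (hp : p ∈ parabolicGL 𝔽 n n) :
    ∃ X A D, p = unipotentGL X * leviGL A D := by
  obtain ⟨A, B, C, D, h⟩ := exists_eq_blockMatrix (p : Matrix (Fin (n + n)) (Fin (n + n)) 𝔽)
  obtain ⟨A', B', C', D', h'⟩ :=
    exists_eq_blockMatrix ((p⁻¹ : GL (Fin (n + n)) 𝔽) : Matrix (Fin (n + n)) (Fin (n + n)) 𝔽)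
  obtain rfl := (mem_parabolicGL_iff h).1 hp
  obtain rfl := (mem_parabolicGL_iff h').1 (inv_mem hp)
  have h1 := p.mul_inv
  have h2 := p.inv_mul
  rw [h, h', blockMatrix_mul, ← blockMatrix_one] at h1 h2
  obtain ⟨hA, -, -, hD⟩ := blockMatrix_injective h1
  obtain ⟨hA', -, -, hD'⟩ := blockMatrix_injective h2
  simp only [mul_zero, add_zero, zero_mul, zero_add] at hA hD hA' hD'
  refine ⟨B * D', ⟨A, A', hA, hA'⟩, ⟨D, D', hD, hD'⟩, ?_⟩
  ext1
  rw [Units.val_mul, unipotentGL_val, leviGL_val, blockMatrix_mul, h]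
  simp [Matrix.mul_assoc, hD']

/-- The Bruhat decomposition of elements of the big cell. -/
theorem exists_eq_mul_weylGL_mul {g : GL (Fin (n + n)) 𝔽} {A B C D : Matrix (Fin n) (Fin n) 𝔽}
    (hg : (g : Matrix (Fin (n + n)) (Fin (n + n)) 𝔽) = blockMatrix A B C D) (hC : IsUnit C) :
    ∃ p ∈ parabolicGL 𝔽 n n, ∃ X, g = p * weylGL 𝔽 n * unipotentGL X := by
  obtain ⟨c, rfl⟩ := hC
  set c' : Matrix (Fin n) (Fin n) 𝔽 := ((c⁻¹ : GL (Fin n) 𝔽) : Matrix (Fin n) (Fin n) 𝔽) with hc'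
  refine ⟨g * (unipotentGL (c' * D))⁻¹ * weylGL 𝔽 n, ?_, c' * D, ?_⟩
  · refine (mem_parabolicGL_iff (A := B - A * (c' * D)) (B := A) (C := 0)
      (D := (c : Matrix (Fin n) (Fin n) 𝔽)) ?_).2 rfl
    rw [Units.val_mul, Units.val_mul, hg, weylGL_val]
    change blockMatrix A B c D * blockMatrix 1 (-(c' * D)) 0 1 * _ = _
    rw [blockMatrix_mul, blockMatrix_mul]
    have h1 : (c : Matrix (Fin n) (Fin n) 𝔽) * (c' * D) = D := by
      rw [← Matrix.mul_assoc, hc', Units.mul_inv, one_mul]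
    simp [h1, sub_eq_add_neg, add_comm]
  · rw [mul_assoc (g * _), weylGL_mul_self, mul_one, inv_mul_cancel_right]

end Blocks

section MiddleCells

variable {𝔽 : Type*} [Field 𝔽] {n : ℕ}

theorem exists_mul_mul_eq_self (C : Matrix (Fin n) (Fin n) 𝔽) :
    ∃ C' : Matrix (Fin n) (Fin n) 𝔽, C * C' * C = C := by
  let f := Matrix.toLin' C
  obtain ⟨s, hs⟩ := f.rangeRestrict.exists_rightInverse_of_surjective f.range_rangeRestrict
  obtain ⟨t, ht⟩ := s.exists_extend
  refine ⟨LinearMap.toMatrix' t, Matrix.toLin'.injective (LinearMap.ext fun x => ?_)⟩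
  rw [Matrix.toLin'_mul, Matrix.toLin'_mul, Matrix.toLin'_toMatrix']
  have h1 : t (f x) = s (f.rangeRestrict x) := LinearMap.congr_fun ht (f.rangeRestrict x)
  have h2 := congrArg Subtype.val (LinearMap.congr_fun hs (f.rangeRestrict x))
  change f (t (f x)) = f x
  rw [h1]
  exact h2

theorem exists_mulVec_mem_iff_mem_initialSubmodule [Fintype 𝔽] (M : Submodule 𝔽 (Fin n → 𝔽)) :
    ∃ h : GL (Fin n) 𝔽, ∀ x, (h : Matrix (Fin n) (Fin n) 𝔽) *ᵥ x ∈ M ↔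
      x ∈ initialSubmodule 𝔽 n (Module.finrank 𝔽 M) := by
  set k := Module.finrank 𝔽 M with hk
  have hkn : k ≤ n := by simpa using M.finrank_le
  have hfin : Module.finrank 𝔽 (initialSubmodule 𝔽 n k) = k := by
    have h1 := card_initialSubmodule (𝔽 := 𝔽) hkn
    rw [Module.natCard_eq_pow_finrank (K := 𝔽), Nat.card_eq_fintype_card] at h1
    exact Nat.pow_right_injective Fintype.one_lt_card h1
  let e : initialSubmodule 𝔽 n k ≃ₗ[𝔽] M := LinearEquiv.ofFinrankEq _ _ (hfin.trans hk)
  obtain ⟨g, hg⟩ := Submodule.exists_linearEquiv_restrict_eq e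
  let h : GL (Fin n) 𝔽 :=
    { val := LinearMap.toMatrix' g.toLinearMap
      inv := LinearMap.toMatrix' g.symm.toLinearMap
      val_inv := by
        rw [← LinearMap.toMatrix'_comp]
        simp
      inv_val := by
        rw [← LinearMap.toMatrix'_comp]
        simp }
  have hh : ∀ x, (h : Matrix (Fin n) (Fin n) 𝔽) *ᵥ x = g x := fun x => by
    rw [← Matrix.toLin'_apply]
    change Matrix.toLin' (LinearMap.toMatrix' g.toLinearMap) x = _
    rw [Matrix.toLin'_toMatrix']
    rfl
  refine ⟨h, fun x => ?_⟩
  rw [hh]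
  constructor
  · intro hx
    have h1 := hg (e.symm ⟨_, hx⟩)
    rw [e.apply_symm_apply] at h1
    rw [g.injective h1]
    exact Subtype.prop _
  · intro hx
    have h1 := hg ⟨x, hx⟩
    rw [← h1]
    exact Subtype.prop _

theorem IsBlockUnipotent.sub_one_mulVec_mem {k : ℕ} {u : GL (Fin n) 𝔽} (hu : IsBlockUnipotent k u)
    (x : Fin n → 𝔽) :
    ((u : Matrix (Fin n) (Fin n) 𝔽) - 1) *ᵥ x ∈ initialSubmodule 𝔽 n k := by
  intro i hi
  rw [mulVec, dotProduct]
  refine Finset.sum_eq_zero fun j _ => ?_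
  by_cases hij : i = j
  · simp [hij, hu.1]
  · simp [hu.2 i j hij (by omega), hij]

theorem IsBlockUnipotent.sub_one_mulVec_eq_zero {k : ℕ} {u : GL (Fin n) 𝔽}
    (hu : IsBlockUnipotent k u) {x : Fin n → 𝔽} (hx : x ∈ initialSubmodule 𝔽 n k) :
    ((u : Matrix (Fin n) (Fin n) 𝔽) - 1) *ᵥ x = 0 := by
  ext i
  rw [mulVec, dotProduct]
  refine Finset.sum_eq_zero fun j _ => ?_
  by_cases hij : i = j
  · simp [hij, hu.1]
  by_cases hj : (j : ℕ) < k
  · simp [hu.2 i j hij (by omega), hij]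
  · simp [hx j (not_lt.1 hj)]

theorem exists_mul_eq_of_mulVec_mem (A C N : Matrix (Fin n) (Fin n) 𝔽)
    (h : ∀ x, ∃ y, A *ᵥ y = N *ᵥ x ∧ C *ᵥ y = 0) :
    ∃ E : Matrix (Fin n) (Fin n) 𝔽, A * E = N ∧ C * E = 0 := by
  choose y hA hC using fun j => h (Pi.single j 1)
  refine ⟨of fun i j => y j i, ?_, ?_⟩
  · ext i j
    have := congrFun (hA j) i
    rw [mulVec_single_one] at this
    exact this
  · ext i j
    exact congrFun (hC j) i

/-- An element outside the closed and the big cell is fixed, modulo the unipotent radical, by a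
conjugate of a unipotent radical of `GL_n`. -/
theorem exists_unipotent_mul_eq [Fintype 𝔽] {g : GL (Fin (n + n)) 𝔽}
    {A B C D : Matrix (Fin n) (Fin n) 𝔽}
    (hg : (g : Matrix (Fin (n + n)) (Fin (n + n)) 𝔽) = blockMatrix A B C D) (hC0 : C ≠ 0)
    (hC : ¬ IsUnit C) :
    ∃ k, 0 < k ∧ k < n ∧ ∃ h : GL (Fin n) 𝔽, ∀ u, IsBlockUnipotent k u →
      ∃ X E, unipotentGL X * leviGL (h * u * h⁻¹) 1 * g = g * unipotentGL E := by
  let K := (Matrix.toLin' C).ker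
  let M := K.map (Matrix.toLin' A)
  have hinj : Function.Injective ((Matrix.toLin' A).domRestrict K) := by
    rw [← LinearMap.ker_eq_bot, LinearMap.ker_eq_bot']
    intro x hx
    obtain ⟨A', B', C', D', hg'⟩ :=
      exists_eq_blockMatrix ((g⁻¹ : GL (Fin (n + n)) 𝔽) : Matrix (Fin (n + n)) (Fin (n + n)) 𝔽)
    have h1 := g.inv_mul
    rw [hg, hg', blockMatrix_mul, ← blockMatrix_one] at h1
    have h2 := congrArg (· *ᵥ x.1) (blockMatrix_injective h1).1
    have hA : A *ᵥ x.1 = 0 := hx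
    have hCx : C *ᵥ x.1 = 0 := x.2
    simp only [add_mulVec, ← mulVec_mulVec, hA, hCx, mulVec_zero, add_zero, one_mulVec] at h2
    exact Subtype.ext h2.symm
  have hfin : Module.finrank 𝔽 M = Module.finrank 𝔽 K := by
    have h1 : ((Matrix.toLin' A).domRestrict K).range = M := by
      rw [LinearMap.range_domRestrict]
    rw [← h1]
    exact LinearMap.finrank_range_of_inj hinj
  have hk0 : 0 < Module.finrank 𝔽 M := by
    rw [hfin, Nat.pos_iff_ne_zero]
    intro h0
    rw [Submodule.finrank_eq_zero, LinearMap.ker_eq_bot] at h0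
    exact hC (Matrix.mulVec_injective_iff_isUnit.1 h0)
  have hkn : Module.finrank 𝔽 M < n := by
    rw [hfin]
    refine lt_of_le_of_ne (by simpa using K.finrank_le) fun h0 => hC0 ?_
    have h1 : K = ⊤ := Submodule.eq_top_of_finrank_eq (by simpa using h0)
    rw [LinearMap.ker_eq_top] at h1
    exact Matrix.toLin'.injective (h1.trans (map_zero _).symm)
  obtain ⟨h, hh⟩ := exists_mulVec_mem_iff_mem_initialSubmodule M
  obtain ⟨C', hC'⟩ := exists_mul_mul_eq_self C
  refine ⟨_, hk0, hkn, h, fun u hu => ?_⟩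
  set H : Matrix (Fin n) (Fin n) 𝔽 := (h : Matrix (Fin n) (Fin n) 𝔽) with hH
  set H' : Matrix (Fin n) (Fin n) 𝔽 :=
    ((h⁻¹ : GL (Fin n) 𝔽) : Matrix (Fin n) (Fin n) 𝔽) with hH'
  have hHH' : H * H' = 1 := Units.mul_inv h
  set Z : Matrix (Fin n) (Fin n) 𝔽 := H * ((u : Matrix (Fin n) (Fin n) 𝔽) - 1) * H' with hZ
  have hZrange : ∀ x, Z *ᵥ x ∈ M := fun x => by
    rw [hZ, ← mulVec_mulVec, ← mulVec_mulVec, hh]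
    exact hu.sub_one_mulVec_mem _
  have hZker : ∀ x ∈ M, Z *ᵥ x = 0 := fun x hx => by
    rw [hZ, ← mulVec_mulVec, ← mulVec_mulVec, hu.sub_one_mulVec_eq_zero, mulVec_zero]
    rw [← hh, mulVec_mulVec, hHH', one_mulVec]
    exact hx
  have hZA : Z * A * (C' * C) = Z * A := by
    refine Matrix.toLin'.injective (LinearMap.ext fun x => ?_)
    have h1 : Z *ᵥ (A *ᵥ (x - (C' * C) *ᵥ x)) = 0 := by
      refine hZker _ ⟨_, ?_, rfl⟩
      change C *ᵥ _ = 0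
      rw [mulVec_sub, mulVec_mulVec, ← Matrix.mul_assoc, hC', sub_self]
    rw [mulVec_sub, mulVec_sub, sub_eq_zero, mulVec_mulVec, mulVec_mulVec, mulVec_mulVec] at h1
    rw [Matrix.toLin'_apply, Matrix.toLin'_apply, h1]
  obtain ⟨E, hAE, hCE⟩ := exists_mul_eq_of_mulVec_mem A C (Z * (B - A * C' * D)) fun x => by
    rw [← mulVec_mulVec]
    obtain ⟨y, hy, hy'⟩ := hZrange ((B - A * C' * D) *ᵥ x)
    exact ⟨y, hy', hy⟩
  refine ⟨-(Z * A * C'), E, ?_⟩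
  have hval : ((h * u * h⁻¹ : GL (Fin n) 𝔽) : Matrix (Fin n) (Fin n) 𝔽) = 1 + Z := by
    rw [hZ, mul_sub, sub_mul, mul_one, hHH']
    simp [H, hH']
  ext1
  simp only [Units.val_mul, unipotentGL_val, leviGL_val, hg, blockMatrix_mul] at hval ⊢
  rw [hval]
  congr 1
  · have : -(Z * A * C') * C = -(Z * A) := by
      rw [neg_mul, Matrix.mul_assoc, hZA]
    simp [this, add_mul]
  · rw [hAE]
    simp [add_mul, mul_sub, Matrix.mul_assoc]
    abel
  · simp
  · simp [hCE]

end MiddleCells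

section Intertwiner

variable {𝔽 : Type*} [Field 𝔽] {n : ℕ} {V : Type*} [AddCommGroup V] [Module ℂ V]
  {π : Representation ℂ (GL (Fin n) 𝔽) V} {ρ : Representation ℂ (parabolicGL 𝔽 n n) (V ⊗[ℂ] V)}

/-- `ρ` is the inflation of `π ⊗ π` to the parabolic subgroup. -/
def IsInflation (π : Representation ℂ (GL (Fin n) 𝔽) V)
    (ρ : Representation ℂ (parabolicGL 𝔽 n n) (V ⊗[ℂ] V)) : Prop :=
  ∀ (p : parabolicGL 𝔽 n n) (A D : GL (Fin n) 𝔽) (B : Matrix (Fin n) (Fin n) 𝔽),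
    (p.1 : Matrix (Fin (n + n)) (Fin (n + n)) 𝔽) = blockMatrix A B 0 D →
      ρ p = TensorProduct.map (π A) (π D)

theorem IsInflation.apply_leviGL (hρ : IsInflation π ρ) (A D : GL (Fin n) 𝔽) :
    ρ ⟨leviGL A D, leviGL_mem A D⟩ = TensorProduct.map (π A) (π D) :=
  hρ _ A D 0 (leviGL_val A D)

theorem IsInflation.apply_unipotentGL (hρ : IsInflation π ρ) (X : Matrix (Fin n) (Fin n) 𝔽) :
    ρ ⟨unipotentGL X, unipotentGL_mem X⟩ = 1 := by
  rw [hρ _ 1 1 X (unipotentGL_val X), map_one]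
  exact TensorProduct.map_id

theorem IsInflation.leviGL_mul (hρ : IsInflation π ρ) (f : inducedSpace (parabolicGL 𝔽 n n) ρ)
    (A D : GL (Fin n) 𝔽) (g : GL (Fin (n + n)) 𝔽) :
    f.1 (leviGL A D * g) = TensorProduct.map (π A) (π D) (f.1 g) := by
  rw [← hρ.apply_leviGL]
  exact f.2 ⟨leviGL A D, leviGL_mem A D⟩ g

theorem IsInflation.unipotentGL_mul (hρ : IsInflation π ρ)
    (f : inducedSpace (parabolicGL 𝔽 n n) ρ)
    (X : Matrix (Fin n) (Fin n) 𝔽) (g : GL (Fin (n + n)) 𝔽) :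
    f.1 (unipotentGL X * g) = f.1 g := by
  have h := f.2 ⟨unipotentGL X, unipotentGL_mem X⟩ g
  rwa [hρ.apply_unipotentGL] at h

section Commutant

variable {A : Module.End ℂ (inducedSpace (parabolicGL 𝔽 n n) ρ)}

theorem IsInflation.supportedOn_apply_mul_leviGL (hρ : IsInflation π ρ)
    (hA : ∀ g f, A (inducedRep _ ρ g f) = inducedRep _ ρ g (A f)) (v : V ⊗[ℂ] V)
    (g : GL (Fin (n + n)) 𝔽) (a d : GL (Fin n) 𝔽) :
    (A (supportedOn ρ v)).1 (g * leviGL a d) =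
      (A (supportedOn ρ (TensorProduct.map (π a) (π d) v))).1 g := by
  rw [← hρ.apply_leviGL]
  exact supportedOn_apply_mul ρ hA v g ⟨leviGL a d, leviGL_mem a d⟩

theorem IsInflation.supportedOn_apply_mul_unipotentGL (hρ : IsInflation π ρ)
    (hA : ∀ g f, A (inducedRep _ ρ g f) = inducedRep _ ρ g (A f)) (v : V ⊗[ℂ] V)
    (g : GL (Fin (n + n)) 𝔽) (X : Matrix (Fin n) (Fin n) 𝔽) :
    (A (supportedOn ρ v)).1 (g * unipotentGL X) = (A (supportedOn ρ v)).1 g := by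
  have h := supportedOn_apply_mul ρ hA v g ⟨unipotentGL X, unipotentGL_mem X⟩
  rwa [hρ.apply_unipotentGL] at h

variable [FiniteDimensional ℂ V]

theorem IsInflation.exists_supportedOn_apply_one (hρ : IsInflation π ρ) (hπ : IsIrreducibleRep π)
    (hA : ∀ g f, A (inducedRep _ ρ g f) = inducedRep _ ρ g (A f)) :
    ∃ a : ℂ, ∀ v, (A (supportedOn ρ v)).1 1 = a • v :=
  hπ.exists_eq_smul_of_tensor (evalAt ρ 1 ∘ₗ A ∘ₗ supportedOn ρ) fun a d v => by
    change (A (supportedOn ρ _)).1 1 = TensorProduct.map (π a) (π d) ((A (supportedOn ρ v)).1 1)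
    rw [← hρ.supportedOn_apply_mul_leviGL hA, ← hρ.leviGL_mul, one_mul, mul_one]

theorem IsInflation.exists_supportedOn_apply_weylGL (hρ : IsInflation π ρ)
    (hπ : IsIrreducibleRep π) (hA : ∀ g f, A (inducedRep _ ρ g f) = inducedRep _ ρ g (A f)) :
    ∃ b : ℂ, ∀ v, (A (supportedOn ρ v)).1 (weylGL 𝔽 n) = b • TensorProduct.comm ℂ V V v := by
  obtain ⟨b, hb⟩ := hπ.exists_eq_smul_of_tensor
    ((TensorProduct.comm ℂ V V).toLinearMap ∘ₗ evalAt ρ (weylGL 𝔽 n) ∘ₗ A ∘ₗ supportedOn ρ)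
    fun a d v => by
      change TensorProduct.comm ℂ V V ((A (supportedOn ρ _)).1 (weylGL 𝔽 n)) =
        TensorProduct.map (π a) (π d)
          (TensorProduct.comm ℂ V V ((A (supportedOn ρ v)).1 (weylGL 𝔽 n)))
      rw [← hρ.supportedOn_apply_mul_leviGL hA, weylGL_mul_leviGL, hρ.leviGL_mul,
        TensorProduct.map_comm]
  refine ⟨b, fun v => (TensorProduct.comm ℂ V V).injective ?_⟩
  rw [map_smul]
  refine (hb v).trans ?_
  congr 1
  exact ((TensorProduct.comm ℂ V V).symm_apply_apply v).symm

/-- An intertwining operator is determined by its values at `1` and at the Weyl element. -/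
theorem IsInflation.eq_zero_of_supportedOn_apply [Fintype 𝔽] (hρ : IsInflation π ρ)
    (hπ : IsCuspidal π) (hA : ∀ g f, A (inducedRep _ ρ g f) = inducedRep _ ρ g (A f))
    (h1 : ∀ v, (A (supportedOn ρ v)).1 1 = 0)
    (hw : ∀ v, (A (supportedOn ρ v)).1 (weylGL 𝔽 n) = 0) : A = 0 := by
  classical
  refine eq_zero_of_supportedOn_eq_zero ρ hA fun v => Subtype.ext (funext fun g => ?_)
  change (A (supportedOn ρ v)).1 g = 0
  obtain ⟨a, b, c, d, hg⟩ := exists_eq_blockMatrix (g : Matrix (Fin (n + n)) (Fin (n + n)) 𝔽)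
  by_cases hc0 : c = 0
  · have h2 := (A (supportedOn ρ v)).2 ⟨g, (mem_parabolicGL_iff hg).2 hc0⟩ 1
    rw [mul_one] at h2
    rw [h2, h1, map_zero]
  by_cases hc : IsUnit c
  · obtain ⟨p, hp, X, rfl⟩ := exists_eq_mul_weylGL_mul hg hc
    rw [hρ.supportedOn_apply_mul_unipotentGL hA]
    have h2 := (A (supportedOn ρ v)).2 ⟨p, hp⟩ (weylGL 𝔽 n)
    rw [h2, hw, map_zero]
  · obtain ⟨k, hk0, hkn, h, hu⟩ := exists_unipotent_mul_eq hg hc0 hc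
    refine eq_zero_of_forall_map_one_eq
      {x | ∃ u, IsBlockUnipotent k u ∧ x = π (h * u * h⁻¹)} (fun v hv => ?_) _ ?_
    · have h3 : π h⁻¹ v = 0 := hπ.2 k hk0 hkn _ fun u hu => by
        have h4 := congrArg (π h⁻¹) (hv _ ⟨u, hu, rfl⟩)
        rw [← Module.End.mul_apply, ← map_mul] at h4
        rw [← Module.End.mul_apply, ← map_mul]
        convert h4 using 3
        group
      have h4 := congrArg (π h) h3
      rwa [← Module.End.mul_apply, ← map_mul, mul_inv_cancel, map_one, map_zero] at h4
    · rintro _ ⟨u, hu', rfl⟩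
      obtain ⟨X, E, hXE⟩ := hu u hu'
      have h3 := hρ.unipotentGL_mul (A (supportedOn ρ v)) X (leviGL (h * u * h⁻¹) 1 * g)
      rw [hρ.leviGL_mul, ← mul_assoc, hXE, hρ.supportedOn_apply_mul_unipotentGL hA, map_one] at h3
      exact h3.symm

end Commutant

section Operator

variable [Fintype 𝔽]

/-- The standard intertwining operator `f ↦ (x ↦ ∑ X, τ (f (w u(X) x)))`. -/
noncomputable def IsInflation.intertwiner (hρ : IsInflation π ρ) :
    Module.End ℂ (inducedSpace (parabolicGL 𝔽 n n) ρ) where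
  toFun f := ⟨fun x => ∑ X : Matrix (Fin n) (Fin n) 𝔽,
      TensorProduct.comm ℂ V V (f.1 (weylGL 𝔽 n * unipotentGL X * x)), fun p x => by
    obtain ⟨Y, A, D, hp⟩ := exists_eq_unipotentGL_mul_leviGL p.2
    have hval : (p.1 : Matrix (Fin (n + n)) (Fin (n + n)) 𝔽) =
        blockMatrix A (Y * (D : Matrix (Fin n) (Fin n) 𝔽)) 0 D := by
      rw [hp, Units.val_mul, unipotentGL_val, leviGL_val, blockMatrix_mul]
      simp
    rw [hρ p A D _ hval, map_sum]
    let s : Matrix (Fin n) (Fin n) 𝔽 → Matrix (Fin n) (Fin n) 𝔽 := fun X =>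
      ((A⁻¹ : GL (Fin n) 𝔽) : Matrix (Fin n) (Fin n) 𝔽) * (X + Y) *
        (D : Matrix (Fin n) (Fin n) 𝔽)
    have hs : Function.Injective s := fun X X' h =>
      add_right_cancel ((A⁻¹).isUnit.mul_left_cancel (D.isUnit.mul_right_cancel h))
    refine Fintype.sum_bijective s (Finite.injective_iff_bijective.1 hs) _ _ fun X => ?_
    have h1 : weylGL 𝔽 n * unipotentGL X * (p.1 * x) =
        leviGL D A * (weylGL 𝔽 n * unipotentGL (s X) * x) := by
      rw [hp, ← mul_assoc, ← mul_assoc, mul_assoc (weylGL 𝔽 n) (unipotentGL X),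
        ← unipotentGL_add, mul_assoc (weylGL 𝔽 n), unipotentGL_mul_leviGL,
        ← mul_assoc (weylGL 𝔽 n), weylGL_mul_leviGL]
      simp only [s, mul_assoc]
    rw [h1, hρ.leviGL_mul, TensorProduct.map_comm]⟩
  map_add' f f' := Subtype.ext <| funext fun x => by
    simp [Finset.sum_add_distrib]
  map_smul' c f := Subtype.ext <| funext fun x => by
    simp [Finset.smul_sum]

theorem IsInflation.intertwiner_apply (hρ : IsInflation π ρ)
    (f : inducedSpace (parabolicGL 𝔽 n n) ρ) (x : GL (Fin (n + n)) 𝔽) :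
    (hρ.intertwiner f).1 x = ∑ X : Matrix (Fin n) (Fin n) 𝔽,
      TensorProduct.comm ℂ V V (f.1 (weylGL 𝔽 n * unipotentGL X * x)) := rfl

theorem IsInflation.intertwiner_inducedRep (hρ : IsInflation π ρ) (g : GL (Fin (n + n)) 𝔽)
    (f : inducedSpace (parabolicGL 𝔽 n n) ρ) :
    hρ.intertwiner (inducedRep _ ρ g f) = inducedRep _ ρ g (hρ.intertwiner f) := by
  refine Subtype.ext (funext fun x => ?_)
  rw [inducedRep_apply, hρ.intertwiner_apply, hρ.intertwiner_apply]
  simp only [inducedRep_apply, mul_assoc]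

theorem IsInflation.intertwiner_supportedOn_apply_one (hρ : IsInflation π ρ) (hn : 1 ≤ n)
    (v : V ⊗[ℂ] V) : (hρ.intertwiner (supportedOn ρ v)).1 1 = 0 := by
  have : Nonempty (Fin n) := ⟨⟨0, hn⟩⟩
  rw [hρ.intertwiner_apply]
  refine Finset.sum_eq_zero fun X _ => ?_
  rw [supportedOn_apply_of_notMem, map_zero]
  rw [mul_one, mem_parabolicGL_iff (A := 0) (B := 1) (C := 1) (D := X)]
  · exact one_ne_zero
  · rw [Units.val_mul, weylGL_val, unipotentGL_val, blockMatrix_mul]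
    simp

theorem IsInflation.intertwiner_supportedOn_apply_weylGL (hρ : IsInflation π ρ)
    (v : V ⊗[ℂ] V) :
    (hρ.intertwiner (supportedOn ρ v)).1 (weylGL 𝔽 n) = TensorProduct.comm ℂ V V v := by
  rw [hρ.intertwiner_apply, Finset.sum_eq_single 0]
  · rw [unipotentGL_zero, mul_one, weylGL_mul_self, supportedOn_apply_one]
  · intro X _ hX
    rw [supportedOn_apply_of_notMem, map_zero]
    rwa [mem_parabolicGL_iff (weylGL_mul_unipotentGL_mul_weylGL_val X)]
  · exact fun h => absurd (Finset.mem_univ _) h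

theorem IsInflation.intertwiner_intertwiner_supportedOn_apply_one (hρ : IsInflation π ρ)
    (v : V ⊗[ℂ] V) :
    (hρ.intertwiner (hρ.intertwiner (supportedOn ρ v))).1 1 =
      ((Fintype.card 𝔽 : ℂ) ^ n) ^ n • v := by
  rw [hρ.intertwiner_apply]
  have h1 : ∀ X : Matrix (Fin n) (Fin n) 𝔽, TensorProduct.comm ℂ V V
      ((hρ.intertwiner (supportedOn ρ v)).1 (weylGL 𝔽 n * unipotentGL X * 1)) = v := by
    intro X
    rw [mul_one, hρ.supportedOn_apply_mul_unipotentGL hρ.intertwiner_inducedRep,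
      hρ.intertwiner_supportedOn_apply_weylGL]
    exact (TensorProduct.comm ℂ V V).symm_apply_apply v
  simp only [h1]
  rw [Finset.sum_const, ← Nat.cast_smul_eq_nsmul ℂ, Finset.card_univ]
  congr 1
  have h2 : Fintype.card (Matrix (Fin n) (Fin n) 𝔽) = (Fintype.card 𝔽 ^ n) ^ n := by
    change Fintype.card (Fin n → Fin n → 𝔽) = _
    simp
  rw [h2]
  push_cast
  rfl

theorem IsInflation.intertwiner_intertwiner_supportedOn_apply_weylGL
    [Fintype (GL (Fin n) 𝔽)] (hρ : IsInflation π ρ)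
    (v : V ⊗[ℂ] V) :
    (hρ.intertwiner (hρ.intertwiner (supportedOn ρ v))).1 (weylGL 𝔽 n) =
      ∑ X : GL (Fin n) 𝔽, TensorProduct.map (π X) (π (-X⁻¹)) v := by
  rw [hρ.intertwiner_apply]
  have hval : ∀ X Y : Matrix (Fin n) (Fin n) 𝔽,
      ((weylGL 𝔽 n * unipotentGL Y * (weylGL 𝔽 n * unipotentGL X * weylGL 𝔽 n) :
        GL (Fin (n + n)) 𝔽) : Matrix (Fin (n + n)) (Fin (n + n)) 𝔽) =
        blockMatrix X 1 (1 + Y * X) Y := by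
    intro X Y
    rw [Units.val_mul, weylGL_mul_unipotentGL_mul_weylGL_val, Units.val_mul, weylGL_val,
      unipotentGL_val, blockMatrix_mul, blockMatrix_mul]
    simp
  have hzero : ∀ X Y : Matrix (Fin n) (Fin n) 𝔽, 1 + Y * X ≠ 0 → (supportedOn ρ v).1
      (weylGL 𝔽 n * unipotentGL Y * (weylGL 𝔽 n * unipotentGL X * weylGL 𝔽 n)) = 0 :=
    fun X Y h => supportedOn_apply_of_notMem _ _ fun hm =>
      h ((mem_parabolicGL_iff (hval X Y)).1 hm)
  symm
  refine Fintype.sum_of_injective (fun X : GL (Fin n) 𝔽 => (X : Matrix (Fin n) (Fin n) 𝔽))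
    Units.val_injective _ _ (fun X hX => ?_) fun X => ?_
  · rw [hρ.intertwiner_apply, Finset.sum_eq_zero, map_zero]
    intro Y _
    rw [hzero, map_zero]
    intro h
    refine hX ?_
    have h1 : -Y * X = 1 := by
      rw [neg_mul, neg_eq_iff_add_eq_zero, add_comm]
      exact h
    exact ⟨⟨X, -Y, mul_eq_one_comm.1 h1, h1⟩, rfl⟩
  · have hXX : ((-X⁻¹ : GL (Fin n) 𝔽) : Matrix (Fin n) (Fin n) 𝔽) *
        (X : Matrix (Fin n) (Fin n) 𝔽) = -1 := by
      rw [Units.val_neg, neg_mul, Units.inv_mul]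
    rw [hρ.intertwiner_apply, Finset.sum_eq_single ((-X⁻¹ : GL (Fin n) 𝔽) :
      Matrix (Fin n) (Fin n) 𝔽)]
    · have hv := hval X (-X⁻¹ : GL (Fin n) 𝔽)
      rw [hXX, add_neg_cancel] at hv
      have hm := (mem_parabolicGL_iff hv).2 rfl
      rw [← hρ ⟨_, hm⟩ X (-X⁻¹) 1 hv, ← supportedOn_apply_of_mem]
      exact ((TensorProduct.comm ℂ V V).symm_apply_apply _).symm
    · intro Y _ hY
      rw [hzero, map_zero]
      intro h
      refine hY (X.isUnit.mul_right_cancel ?_)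
      rw [hXX, eq_neg_iff_add_eq_zero, add_comm]
      exact h
    · exact fun h => absurd (Finset.mem_univ _) h

end Operator

end Intertwiner

section Dimension

theorem prod_pow_sub_pow_eq {R : Type*} [CommRing R] (x : R) (n : ℕ) :
    ∏ i ∈ Finset.range (n + 1), (x ^ (n + 1) - x ^ i) =
      (∏ i ∈ Finset.range n, x ^ (i + 1)) *
        ((∏ i ∈ Finset.range n, (x ^ (i + 1) - 1)) * (x ^ (n + 1) - 1)) := by
  rw [← Finset.prod_range_succ (fun i => x ^ (i + 1) - 1),
    ← Finset.prod_range_reflect (fun i => x ^ (i + 1) - 1)]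
  have h : ∏ i ∈ Finset.range n, x ^ (i + 1) = ∏ i ∈ Finset.range (n + 1), x ^ i := by
    rw [Finset.prod_range_succ', pow_zero, mul_one]
  rw [h, ← Finset.prod_mul_distrib]
  refine Finset.prod_congr rfl fun i hi => ?_
  have hi' := Finset.mem_range.1 hi
  rw [mul_sub, mul_one, ← pow_add]
  congr 2
  omega

theorem cast_card_GL {𝔽 R : Type*} [Field 𝔽] [Fintype 𝔽] [CommRing R] {n : ℕ} (hn : 1 ≤ n)
    [Fintype (GL (Fin n) 𝔽)] :
    (Fintype.card (GL (Fin n) 𝔽) : R) =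
      (∏ i ∈ Finset.range (n - 1), (Fintype.card 𝔽 : R) ^ (i + 1)) *
        ((∏ i ∈ Finset.range (n - 1), ((Fintype.card 𝔽 : R) ^ (i + 1) - 1)) *
          ((Fintype.card 𝔽 : R) ^ n - 1)) := by
  obtain ⟨k, rfl⟩ := Nat.exists_eq_add_of_le' hn
  rw [Nat.add_sub_cancel, ← prod_pow_sub_pow_eq, ← Nat.card_eq_fintype_card, Matrix.card_GL_field,
    Fin.prod_univ_eq_prod_range (fun i => Fintype.card 𝔽 ^ (k + 1) - Fintype.card 𝔽 ^ i),
    Nat.cast_prod]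
  refine Finset.prod_congr rfl fun i hi => ?_
  rw [Nat.cast_sub (Nat.pow_le_pow_right Fintype.card_pos (Finset.mem_range.1 hi).le)]
  push_cast
  rfl

theorem pow_pow_eq_mul_prod_sq {R : Type*} [CommRing R] (x : R) {n : ℕ} (hn : 1 ≤ n) :
    (x ^ n) ^ n = x ^ n * (∏ i ∈ Finset.range (n - 1), x ^ (i + 1)) ^ 2 := by
  obtain ⟨k, rfl⟩ := Nat.exists_eq_add_of_le' hn
  rw [Nat.add_sub_cancel, pow_succ', sq]
  congr 1
  conv_rhs => enter [2]; rw [← Finset.prod_range_reflect]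
  rw [← Finset.prod_mul_distrib, Finset.prod_congr rfl (g := fun _ => x ^ (k + 1)),
    Finset.prod_const, Finset.card_range]
  intro i hi
  have hi' := Finset.mem_range.1 hi
  rw [← pow_add]
  congr 1
  omega

theorem exists_add_eq_mul_eq (b c : ℂ) : ∃ x y : ℂ, x + y = b ∧ x * y = c := by
  obtain ⟨s, hs⟩ := IsAlgClosed.exists_pow_nat_eq (b ^ 2 - 4 * c) (n := 2) (by norm_num)
  exact ⟨(b + s) / 2, (b - s) / 2, by ring, by linear_combination -hs / 4⟩

/-- The multiplicities of the two eigenvalues of a traceless operator annihilated by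
`X ^ 2 - b X - a`. -/
theorem dimension_equation_of_trace_eq_zero {a b c₁ c₂ : ℂ} {Q d₁ d₂ m : ℕ} (ha : a ≠ 0)
    (hadd : c₁ + c₂ = b) (hmul : c₁ * c₂ = -a)
    (hb : (Q : ℂ) * (b * m) ^ 2 = a * ((Q : ℂ) - 1) ^ 2)
    (htr : c₁ * d₁ + c₂ * d₂ = 0) (hd : d₁ + d₂ ≠ 0) :
    0 < d₁ ∧ 0 < d₂ ∧ (d₁ : ℝ) * d₂ * (Q - 1) ^ 2 = Q * m ^ 2 * (d₁ - d₂) ^ 2 := by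
  have hc₁ : c₁ ≠ 0 := fun h => ha (by rw [h, zero_mul] at hmul; exact neg_eq_zero.1 hmul.symm)
  have hc₂ : c₂ ≠ 0 := fun h => ha (by rw [h, mul_zero] at hmul; exact neg_eq_zero.1 hmul.symm)
  have h₁ : d₁ ≠ 0 := by
    rintro rfl
    simp [hc₂] at htr
    omega
  have h₂ : d₂ ≠ 0 := by
    rintro rfl
    simp [hc₁] at htr
    omega
  refine ⟨Nat.pos_of_ne_zero h₁, Nat.pos_of_ne_zero h₂, ?_⟩
  have hd₁ : (d₁ : ℂ) ≠ 0 := Nat.cast_ne_zero.2 h₁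
  have h3 : (d₂ : ℂ) * c₂ ^ 2 = a * d₁ := by linear_combination c₂ * htr - d₁ * hmul
  have h4 : (d₁ : ℂ) * b = (d₁ - d₂) * c₂ := by linear_combination htr - d₁ * hadd
  have h5 : (d₁ : ℂ) * d₂ * b ^ 2 = a * (d₁ - d₂) ^ 2 := by
    refine mul_left_cancel₀ hd₁ ?_
    linear_combination d₂ * (d₁ * b + (d₁ - d₂) * c₂) * h4 + (d₁ - d₂) ^ 2 * h3
  have h6 : (d₁ : ℂ) * d₂ * (Q - 1) ^ 2 = Q * m ^ 2 * (d₁ - d₂) ^ 2 := by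
    refine mul_left_cancel₀ ha ?_
    linear_combination -(d₁ : ℂ) * d₂ * hb + Q * m ^ 2 * h5
  exact_mod_cast h6

theorem ne_of_mul_eq_neg {a b c₁ c₂ : ℂ} {Q m : ℕ} (hQ : 1 < Q) (ha : a ≠ 0)
    (hadd : c₁ + c₂ = b) (hmul : c₁ * c₂ = -a)
    (hb : (Q : ℂ) * (b * m) ^ 2 = a * ((Q : ℂ) - 1) ^ 2) : c₁ ≠ c₂ := by
  rintro rfl
  have h : ((Q : ℂ) - 1) ^ 2 + 4 * Q * m ^ 2 = 0 := by
    refine mul_left_cancel₀ ha ?_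
    rw [← hadd] at hb
    linear_combination -hb + 4 * Q * m ^ 2 * hmul
  have h' : ((Q : ℝ) - 1) ^ 2 + 4 * Q * m ^ 2 = 0 := by exact_mod_cast h
  have hQ' : (1 : ℝ) < Q := by exact_mod_cast hQ
  nlinarith [sq_nonneg (m : ℝ), mul_nonneg (Nat.cast_nonneg (α := ℝ) Q) (sq_nonneg (m : ℝ))]

end Dimension

section Scalars

variable {𝔽 : Type*} [Field 𝔽] {n : ℕ} {V : Type*} [AddCommGroup V] [Module ℂ V]
  [FiniteDimensional ℂ V] {π : Representation ℂ (GL (Fin n) 𝔽) V}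

theorem IsIrreducibleRep.exists_apply_neg_one (hπ : IsIrreducibleRep π) :
    ∃ ω : ℂ, ω ^ 2 = 1 ∧ π (-1) = ω • 1 := by
  obtain ⟨ω, hω⟩ := hπ.exists_eq_smul_one (π (-1)) fun g v => by
    rw [← Module.End.mul_apply, ← Module.End.mul_apply, ← map_mul, ← map_mul, neg_one_mul,
      mul_neg_one]
  refine ⟨ω, ?_, LinearMap.ext hω⟩
  have := hπ.nontrivial
  obtain ⟨v, hv⟩ := exists_ne (0 : V)
  have h : π (-1) (π (-1) v) = v := by
    rw [← Module.End.mul_apply, ← map_mul, neg_mul_neg, one_mul, map_one, Module.End.one_apply]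
  rw [hω, hω, smul_smul, ← sq] at h
  refine smul_left_injective ℂ hv ?_
  simpa using h

variable [Fintype (GL (Fin n) 𝔽)] {b : ℂ}

theorem IsIrreducibleRep.mul_finrank_sq (hπ : IsIrreducibleRep π)
    (hb : ∀ v, ∑ X : GL (Fin n) 𝔽, TensorProduct.map (π X) (π (-X⁻¹)) v =
      b • TensorProduct.comm ℂ V V v) :
    (b * Module.finrank ℂ V) ^ 2 = (Fintype.card (GL (Fin n) 𝔽) : ℂ) ^ 2 := by
  obtain ⟨ω, hω, hneg⟩ := hπ.exists_apply_neg_one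
  have := hπ.nontrivial
  have hd : (Module.finrank ℂ V : ℂ) ≠ 0 := Nat.cast_ne_zero.2 Module.finrank_pos.ne'
  have h1 : ∑ X : GL (Fin n) 𝔽, (TensorProduct.comm ℂ V V).toLinearMap ∘ₗ
      TensorProduct.map (π X) (π (-X⁻¹)) = b • LinearMap.id := by
    ext1
    refine LinearMap.ext fun v => LinearMap.ext fun w => ?_
    have h2 := congrArg (TensorProduct.comm ℂ V V) (hb (v ⊗ₜ w))
    rw [map_sum, map_smul] at h2
    simpa using h2
  have h2 := congrArg (LinearMap.trace ℂ (V ⊗[ℂ] V)) h1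
  rw [map_sum, map_smul, LinearMap.trace_id, Module.finrank_tensorProduct] at h2
  have h3 : ∀ X : GL (Fin n) 𝔽, LinearMap.trace ℂ (V ⊗[ℂ] V)
      ((TensorProduct.comm ℂ V V).toLinearMap ∘ₗ TensorProduct.map (π X) (π (-X⁻¹))) =
        ω * Module.finrank ℂ V := by
    intro X
    rw [trace_comm_comp_map, ← map_mul, mul_neg, mul_inv_cancel, hneg, map_smul,
      LinearMap.trace_one, smul_eq_mul]
  simp only [h3, Finset.sum_const, Finset.card_univ, nsmul_eq_mul, smul_eq_mul, Nat.cast_mul] at h2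
  have h4 : b * Module.finrank ℂ V = Fintype.card (GL (Fin n) 𝔽) * ω :=
    mul_right_cancel₀ hd (by linear_combination -h2)
  rw [h4, mul_pow, hω, mul_one]

end Scalars

section Main

variable {𝔽 : Type*} [Field 𝔽] [Fintype 𝔽] {n : ℕ} {V : Type*} [AddCommGroup V] [Module ℂ V]
  {π : Representation ℂ (GL (Fin n) 𝔽) V}
  {ρ : Representation ℂ (parabolicGL 𝔽 n n) (V ⊗[ℂ] V)}

theorem IsInflation.trace_intertwiner (hρ : IsInflation π ρ) (hn : 1 ≤ n) :
    LinearMap.trace ℂ _ hρ.intertwiner = 0 := by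
  classical
  exact trace_eq_zero_of_supportedOn_apply_one ρ hρ.intertwiner_inducedRep
    (hρ.intertwiner_supportedOn_apply_one hn)

variable [FiniteDimensional ℂ V]

theorem IsInflation.exists_eq_add_intertwiner (hρ : IsInflation π ρ) (hπ : IsCuspidal π)
    (hn : 1 ≤ n) (A : Module.End ℂ (inducedSpace (parabolicGL 𝔽 n n) ρ))
    (hA : ∀ g f, A (inducedRep _ ρ g f) = inducedRep _ ρ g (A f)) :
    ∃ a b : ℂ, (∀ v, (A (supportedOn ρ v)).1 1 = a • v) ∧
      (∀ v, (A (supportedOn ρ v)).1 (weylGL 𝔽 n) = b • TensorProduct.comm ℂ V V v) ∧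
      ∀ f, A f = a • f + b • hρ.intertwiner f := by
  obtain ⟨a, ha⟩ := hρ.exists_supportedOn_apply_one hπ.1 hA
  obtain ⟨b, hb⟩ := hρ.exists_supportedOn_apply_weylGL hπ.1 hA
  have hw : weylGL 𝔽 n ∉ parabolicGL 𝔽 n n := by
    have : Nonempty (Fin n) := ⟨⟨0, hn⟩⟩
    rw [mem_parabolicGL_iff weylGL_val]
    exact one_ne_zero
  refine ⟨a, b, ha, hb, fun f => ?_⟩
  have h : A - (a • 1 + b • hρ.intertwiner) = 0 := by
    refine hρ.eq_zero_of_supportedOn_apply hπ (fun g f => ?_) (fun v => ?_) fun v => ?_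
    · simp only [LinearMap.sub_apply, LinearMap.add_apply, LinearMap.smul_apply,
        Module.End.one_apply, hA, hρ.intertwiner_inducedRep, map_sub, map_add, map_smul]
    · change (A (supportedOn ρ v)).1 1 - (a • (supportedOn ρ v).1 1 +
        b • (hρ.intertwiner (supportedOn ρ v)).1 1) = 0
      rw [ha, supportedOn_apply_one, hρ.intertwiner_supportedOn_apply_one hn, smul_zero, add_zero,
        sub_self]
    · change (A (supportedOn ρ v)).1 (weylGL 𝔽 n) - (a • (supportedOn ρ v).1 (weylGL 𝔽 n) +
        b • (hρ.intertwiner (supportedOn ρ v)).1 (weylGL 𝔽 n)) = 0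
      rw [hb, supportedOn_apply_of_notMem _ _ hw, hρ.intertwiner_supportedOn_apply_weylGL,
        smul_zero, zero_add, sub_self]
  have hf := LinearMap.congr_fun h f
  exact sub_eq_zero.1 hf

/-- The quadratic relation satisfied by the intertwining operator, together with the value of its
linear coefficient. -/
theorem IsInflation.exists_intertwiner_intertwiner (hρ : IsInflation π ρ) (hπ : IsCuspidal π)
    (hn : 1 ≤ n) : ∃ (b : ℂ) (m : ℕ),
      (∀ f, hρ.intertwiner (hρ.intertwiner f) =
        ((Fintype.card 𝔽 : ℂ) ^ n) ^ n • f + b • hρ.intertwiner f) ∧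
      (Fintype.card 𝔽 : ℂ) ^ n * (b * m) ^ 2 =
        ((Fintype.card 𝔽 : ℂ) ^ n) ^ n * ((Fintype.card 𝔽 : ℂ) ^ n - 1) ^ 2 ∧
      (m ^ 2 < 2 * (Fintype.card 𝔽 ^ n - 1) ∨
        (Even (Fintype.card 𝔽 ^ n) ∧ m ^ 2 < 4 * (Fintype.card 𝔽 ^ n - 1))) := by
  have := Fintype.ofFinite (GL (Fin n) 𝔽)
  have := hπ.1.nontrivial
  obtain ⟨m, hm⟩ := hπ.exists_finrank_eq hn
  obtain ⟨a, b, ha, hb, hab⟩ := hρ.exists_eq_add_intertwiner hπ hn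
    (hρ.intertwiner * hρ.intertwiner) fun g f => by
      simp only [Module.End.mul_apply, hρ.intertwiner_inducedRep]
  obtain ⟨v, hv⟩ := exists_ne (0 : V ⊗[ℂ] V)
  have ha' : a = ((Fintype.card 𝔽 : ℂ) ^ n) ^ n := by
    have h := ha v
    rw [Module.End.mul_apply, hρ.intertwiner_intertwiner_supportedOn_apply_one] at h
    exact (smul_left_injective ℂ hv h).symm
  have hsum : ∀ v, ∑ X : GL (Fin n) 𝔽, TensorProduct.map (π X) (π (-X⁻¹)) v =
      b • TensorProduct.comm ℂ V V v := fun v => by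
    rw [← hρ.intertwiner_intertwiner_supportedOn_apply_weylGL]
    exact hb v
  have hcard := hπ.1.mul_finrank_sq hsum
  have hb0 : b ≠ 0 := by
    rintro rfl
    have : (Fintype.card (GL (Fin n) 𝔽) : ℂ) ≠ 0 := Nat.cast_ne_zero.2 Fintype.card_ne_zero
    refine this (pow_eq_zero_iff two_ne_zero |>.1 ?_)
    rw [← hcard, zero_mul, zero_pow two_ne_zero]
  have hle := sq_finrank_le_card_of_sum_map_eq_smul_comm (fun X : GL (Fin n) 𝔽 => π (-X⁻¹))
    (fun X => π X) b hb0 hsum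
  have hq : 1 < Fintype.card 𝔽 := Fintype.one_lt_card
  have hprod : 0 < ∏ i ∈ Finset.range (n - 1), ((Fintype.card 𝔽 : ℝ) ^ (i + 1) - 1) :=
    Finset.prod_pos fun i _ => sub_pos.2 (one_lt_pow₀ (by exact_mod_cast hq) (by omega))
  refine ⟨b, m, fun f => ha' ▸ hab f, ?_, sq_lt_of_mul_prod_le hq hn ?_⟩
  · have hprod' : ∏ i ∈ Finset.range (n - 1), ((Fintype.card 𝔽 : ℂ) ^ (i + 1) - 1) ≠ 0 := by
      exact_mod_cast hprod.ne'
    rw [cast_card_GL hn, hm] at hcard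
    rw [pow_pow_eq_mul_prod_sq _ hn]
    refine mul_right_cancel₀ (pow_ne_zero 2 hprod') ?_
    linear_combination (Fintype.card 𝔽 : ℂ) ^ n * hcard
  · have hm' : (Module.finrank ℂ V : ℝ) =
        m * ∏ i ∈ Finset.range (n - 1), ((Fintype.card 𝔽 : ℝ) ^ (i + 1) - 1) := by
      exact_mod_cast hm
    have hle' : (Module.finrank ℂ V : ℝ) ^ 2 ≤ Fintype.card (GL (Fin n) 𝔽) := by
      exact_mod_cast hle
    rw [cast_card_GL hn, hm'] at hle'
    refine le_of_mul_le_mul_right ?_ hprod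
    linarith

theorem IsInflation.exists_decomposition (hρ : IsInflation π ρ) (hπ : IsCuspidal π)
    (hn : 1 ≤ n) :
    ∃ (W₁ W₂ : Submodule ℂ (inducedSpace (parabolicGL 𝔽 n n) ρ))
      (h₁ : RepInvariant (inducedRep (parabolicGL 𝔽 n n) ρ) W₁)
      (h₂ : RepInvariant (inducedRep (parabolicGL 𝔽 n n) ρ) W₂),
      W₁ ⊓ W₂ = ⊥ ∧ W₁ ⊔ W₂ = ⊤ ∧
        IsIrreducibleRep (V := ↥W₁) (subRep (inducedRep (parabolicGL 𝔽 n n) ρ) W₁ h₁) ∧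
        IsIrreducibleRep (V := ↥W₂) (subRep (inducedRep (parabolicGL 𝔽 n n) ρ) W₂ h₂) ∧
        ¬ RepIso (V₁ := ↥W₁) (V₂ := ↥W₂)
            (subRep (inducedRep (parabolicGL 𝔽 n n) ρ) W₁ h₁)
            (subRep (inducedRep (parabolicGL 𝔽 n n) ρ) W₂ h₂) ∧
        Module.finrank ℂ W₁ = Fintype.card 𝔽 ^ n * Module.finrank ℂ W₂ := by
  have hq : 1 < Fintype.card 𝔽 := Fintype.one_lt_card
  have hQ : 1 < Fintype.card 𝔽 ^ n := Nat.one_lt_pow (by omega) hq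
  have ha : ((Fintype.card 𝔽 : ℂ) ^ n) ^ n ≠ 0 :=
    pow_ne_zero _ (pow_ne_zero _ (Nat.cast_ne_zero.2 Fintype.card_ne_zero))
  obtain ⟨b, m, hT, hb, hm⟩ := hρ.exists_intertwiner_intertwiner hπ hn
  obtain ⟨c₁, c₂, hadd, hmul⟩ := exists_add_eq_mul_eq b (-((Fintype.card 𝔽 : ℂ) ^ n) ^ n)
  have hb' : ((Fintype.card 𝔽 ^ n : ℕ) : ℂ) * (b * m) ^ 2 =
      ((Fintype.card 𝔽 : ℂ) ^ n) ^ n * (((Fintype.card 𝔽 ^ n : ℕ) : ℂ) - 1) ^ 2 := by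
    push_cast
    exact hb
  have hne := ne_of_mul_eq_neg hQ ha hadd hmul hb'
  have hquad : ∀ f, hρ.intertwiner (hρ.intertwiner f) =
      (c₁ + c₂) • hρ.intertwiner f - (c₁ * c₂) • f := fun f => by
    rw [hT, hadd, hmul]
    module
  have hquad' : ∀ f, hρ.intertwiner (hρ.intertwiner f) =
      (c₂ + c₁) • hρ.intertwiner f - (c₂ * c₁) • f := fun f => by
    rw [hquad, add_comm c₁, mul_comm c₁]
  have hC : ∀ A : Module.End ℂ (inducedSpace (parabolicGL 𝔽 n n) ρ),
      (∀ g f, A (inducedRep _ ρ g f) = inducedRep _ ρ g (A f)) →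
        ∃ a b : ℂ, ∀ f, A f = a • f + b • hρ.intertwiner f := fun A hA => by
    obtain ⟨a, b, -, -, h⟩ := hρ.exists_eq_add_intertwiner hπ hn A hA
    exact ⟨a, b, h⟩
  have htr := trace_eq_of_quadratic hquad hne
  rw [hρ.trace_intertwiner hn] at htr
  have hsup := eigenspace_sup_eq_top hquad hne
  have hinf := eigenspace_inf_eq_bot (T := hρ.intertwiner) hne
  have hd : Module.finrank ℂ (hρ.intertwiner.eigenspace c₁) +
      Module.finrank ℂ (hρ.intertwiner.eigenspace c₂) ≠ 0 := by
    have := hπ.1.nontrivial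
    have : Nontrivial (inducedSpace (parabolicGL 𝔽 n n) ρ) :=
      Function.Injective.nontrivial (f := supportedOn ρ) fun v w h => by
        rw [← supportedOn_apply_one ρ v, h, supportedOn_apply_one]
    rw [← Submodule.finrank_sup_add_finrank_inf_eq, hsup, finrank_top]
    exact (Nat.add_pos_left Module.finrank_pos _).ne'
  obtain ⟨h₁, h₂, h⟩ := dimension_equation_of_trace_eq_zero ha hadd hmul hb' htr.symm hd
  have hbot : ∀ c, 0 < Module.finrank ℂ (hρ.intertwiner.eigenspace c) →
      hρ.intertwiner.eigenspace c ≠ ⊥ := fun c hc h => by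
    rw [h, finrank_bot] at hc
    exact hc.false
  have hT' := hρ.intertwiner_inducedRep
  rcases eq_mul_or_eq_mul_of_dimension_equation
    ((FiniteField.isPrimePow_card 𝔽).pow (by omega)) h₁ h₂ h hm with h | h
  · exact ⟨_, _, repInvariant_eigenspace hT' c₁, repInvariant_eigenspace hT' c₂, hinf, hsup,
      isIrreducibleRep_eigenspace hT' hC c₁ (hbot _ h₁),
      isIrreducibleRep_eigenspace hT' hC c₂ (hbot _ h₂),
      not_repIso_eigenspace hT' hC hquad hne (hbot _ h₁), h⟩
  · exact ⟨_, _, repInvariant_eigenspace hT' c₂, repInvariant_eigenspace hT' c₁,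
      eigenspace_inf_eq_bot hne.symm, eigenspace_sup_eq_top hquad' hne.symm,
      isIrreducibleRep_eigenspace hT' hC c₂ (hbot _ h₂),
      isIrreducibleRep_eigenspace hT' hC c₁ (hbot _ h₁),
      not_repIso_eigenspace hT' hC hquad' hne.symm (hbot _ h₂), h⟩

end Main

/-- Let `𝔽` be a finite field with `q` elements, `(π, V)` a cuspidal representation of
`GL_n(𝔽)`, `G = GL_{2n}(𝔽)`, `P` the block upper-triangular parabolic with Levi
`GL_n × GL_n`, and `ρ` the representation of `P` on `V ⊗ V` with
`ρ [[A, B], [0, D]] = π A ⊗ π D`. Then `Ind_P^G ρ` is the direct sum of exactly two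
non-isomorphic irreducible representations `St₂(π)` and `Id₂(π)`, and, ordered so that
`dim St₂(π) ≥ dim Id₂(π)`, one has `dim St₂(π) = q ^ n * dim Id₂(π)`. -/
theorem principal_series_cuspidal_squared (𝔽 : Type*) [Field 𝔽] [Fintype 𝔽] (q n : ℕ)
    (hq : Fintype.card 𝔽 = q) (hn : 1 ≤ n) (V : Type*) [AddCommGroup V] [Module ℂ V]
    [FiniteDimensional ℂ V] (π : Representation ℂ (GL (Fin n) 𝔽) V) (hπ : IsCuspidal π)
    (ρ : Representation ℂ (parabolicGL 𝔽 n n) (V ⊗[ℂ] V))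
    (hρ : ∀ (p : parabolicGL 𝔽 n n) (A D : GL (Fin n) 𝔽),
      (∀ i j : Fin n,
        ((p : GL (Fin (n + n)) 𝔽) : Matrix (Fin (n + n)) (Fin (n + n)) 𝔽)
            (Fin.castAdd n i) (Fin.castAdd n j) = (A : Matrix (Fin n) (Fin n) 𝔽) i j) →
      (∀ i j : Fin n,
        ((p : GL (Fin (n + n)) 𝔽) : Matrix (Fin (n + n)) (Fin (n + n)) 𝔽)
            (Fin.natAdd n i) (Fin.natAdd n j) = (D : Matrix (Fin n) (Fin n) 𝔽) i j) →
      ρ p = TensorProduct.map (π A) (π D)) :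
    ∃ (W₁ W₂ : Submodule ℂ (inducedSpace (parabolicGL 𝔽 n n) ρ))
      (h₁ : RepInvariant (inducedRep (parabolicGL 𝔽 n n) ρ) W₁)
      (h₂ : RepInvariant (inducedRep (parabolicGL 𝔽 n n) ρ) W₂),
      W₁ ⊓ W₂ = ⊥ ∧ W₁ ⊔ W₂ = ⊤ ∧
        IsIrreducibleRep (V := ↥W₁) (subRep (inducedRep (parabolicGL 𝔽 n n) ρ) W₁ h₁) ∧
        IsIrreducibleRep (V := ↥W₂) (subRep (inducedRep (parabolicGL 𝔽 n n) ρ) W₂ h₂) ∧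
        ¬ RepIso (V₁ := ↥W₁) (V₂ := ↥W₂)
            (subRep (inducedRep (parabolicGL 𝔽 n n) ρ) W₁ h₁)
            (subRep (inducedRep (parabolicGL 𝔽 n n) ρ) W₂ h₂) ∧
        Module.finrank ℂ W₁ = q ^ n * Module.finrank ℂ W₂ := by
  subst hq
  refine IsInflation.exists_decomposition (fun p A D B h => hρ p A D (fun i j => ?_) fun i j => ?_)
    hπ hn
  · rw [h, blockMatrix_castAdd_castAdd]
  · rw [h, blockMatrix_natAdd_natAdd]
end

section
/- Let 𝔽 be a finite field with q elements, let n₁, n₂ ≥ 1, and let (π₁, V₁), (π₂, V₂) be cuspidal representations of GL_{n₁}(𝔽) and GL_{n₂}(𝔽) respectively; assume it is not the case that n₁ = n₂ and π₁ ≅ π₂. Let G = GL_{n₁+n₂}(𝔽), let P ≤ G be the block upper-triangular parabolic subgroup of matrices [[A, B],[0, D]] with A ∈ GL_{n₁}(𝔽), D ∈ GL_{n₂}(𝔽), and let ρ be the representation of P on V₁ ⊗ V₂ given by ρ([[A,B],[0,D]]) = π₁(A) ⊗ π₂(D). Then the induced representation Ind_P^G ρ is irreducible. -/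
open Matrix TensorProduct

set_option synthInstance.maxHeartbeats 1000000
set_option maxHeartbeats 1000000

section Generic

variable {G : Type*} [Group G]

theorem IsIrreducibleRep.nontrivial_s15 {V : Type*} [AddCommGroup V] [Module ℂ V]
    {ρ : Representation ℂ G V} (h : IsIrreducibleRep ρ) : Nontrivial V := by
  by_contra hV
  rw [not_nontrivial_iff_subsingleton] at hV
  exact h.1 (Subsingleton.elim _ _)

/-- Schur's lemma: an endomorphism commuting with an irreducible finite-dimensional
complex representation is scalar. -/
theorem IsIrreducibleRep.exists_eq_smul {V : Type*} [AddCommGroup V] [Module ℂ V]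
    [FiniteDimensional ℂ V] {ρ : Representation ℂ G V} (h : IsIrreducibleRep ρ)
    (T : V →ₗ[ℂ] V) (hT : ∀ g v, T (ρ g v) = ρ g (T v)) : ∃ c : ℂ, ∀ v, T v = c • v := by
  have := h.nontrivial_s15
  obtain ⟨c, hc⟩ := Module.End.exists_eigenvalue (K := ℂ) T
  refine ⟨c, fun v => ?_⟩
  have hinv : RepInvariant ρ (Module.End.eigenspace T c) := by
    intro g v hv
    rw [Module.End.mem_eigenspace_iff] at hv ⊢
    rw [hT, hv, map_smul]
  have htop := (h.2 _ hinv).resolve_left hc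
  exact Module.End.mem_eigenspace_iff.1 (htop ▸ Submodule.mem_top)

/-- Schur's lemma: a nonzero intertwining map between irreducible representations is an
isomorphism. -/
theorem IsIrreducibleRep.repIso_of_ne_zero {V₁ V₂ : Type*} [AddCommGroup V₁] [Module ℂ V₁]
    [AddCommGroup V₂] [Module ℂ V₂] {ρ₁ : Representation ℂ G V₁} {ρ₂ : Representation ℂ G V₂}
    (h₁ : IsIrreducibleRep ρ₁) (h₂ : IsIrreducibleRep ρ₂) (T : V₁ →ₗ[ℂ] V₂)
    (hT : ∀ g v, T (ρ₁ g v) = ρ₂ g (T v)) (hT0 : T ≠ 0) : RepIso ρ₁ ρ₂ := by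
  have hker : LinearMap.ker T = ⊥ := by
    refine (h₁.2 (LinearMap.ker T) fun g v hv => ?_).resolve_right
      fun h => hT0 (LinearMap.ker_eq_top.1 h)
    rw [LinearMap.mem_ker] at hv ⊢
    rw [hT, hv, map_zero]
  have hrange : LinearMap.range T = ⊤ := by
    refine (h₂.2 (LinearMap.range T) ?_).resolve_left fun h => hT0 (LinearMap.range_eq_bot.1 h)
    rintro g _ ⟨v, rfl⟩
    exact ⟨ρ₁ g v, hT g v⟩
  exact ⟨LinearEquiv.ofBijective T ⟨LinearMap.ker_eq_bot.1 hker, LinearMap.range_eq_top.1 hrange⟩,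
    hT⟩

theorem RepIso.symm {V₁ V₂ : Type*} [AddCommGroup V₁] [Module ℂ V₁]
    [AddCommGroup V₂] [Module ℂ V₂] {ρ₁ : Representation ℂ G V₁} {ρ₂ : Representation ℂ G V₂}
    (h : RepIso ρ₁ ρ₂) : RepIso ρ₂ ρ₁ := by
  obtain ⟨e, he⟩ := h
  exact ⟨e.symm, fun g v => by rw [LinearEquiv.symm_apply_eq, he, e.apply_symm_apply]⟩

/-- If every intertwining endomorphism of a nonzero representation of a finite group is
scalar, then the representation is irreducible. -/
theorem isIrreducibleRep_of_forall_scalar [Finite G] {V : Type*} [AddCommGroup V] [Module ℂ V]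
    [Nontrivial V] (ρ : Representation ℂ G V)
    (h : ∀ T : V →ₗ[ℂ] V, (∀ g v, T (ρ g v) = ρ g (T v)) → ∃ c : ℂ, ∀ v, T v = c • v) :
    IsIrreducibleRep ρ := by
  have := Fintype.ofFinite G
  refine ⟨bot_ne_top, fun W hW => or_iff_not_imp_left.2 fun hbot => ?_⟩
  obtain ⟨q, hq⟩ := W.subtype.exists_leftInverse_of_injective W.ker_subtype
  have hqW : ∀ w (hw : w ∈ W), q w = ⟨w, hw⟩ := fun w hw => LinearMap.congr_fun hq ⟨w, hw⟩
  let T : V →ₗ[ℂ] V := ∑ g : G, ρ g ∘ₗ W.subtype ∘ₗ q ∘ₗ ρ g⁻¹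
  have hTapp : ∀ v, T v = ∑ g : G, ρ g (q (ρ g⁻¹ v)) := fun v => by
    simp [T, LinearMap.sum_apply]
  obtain ⟨c, hc⟩ := h T fun g v => by
    rw [hTapp, hTapp, map_sum, ← Equiv.sum_comp (Equiv.mulLeft g)]
    refine Finset.sum_congr rfl fun x _ => ?_
    simp only [Equiv.coe_mulLeft, map_mul, Module.End.mul_apply, _root_.mul_inv_rev,
      Representation.inv_self_apply]
  have hTW : ∀ w ∈ W, T w = (Fintype.card G : ℂ) • w := fun w hw => by
    rw [hTapp, Finset.sum_congr rfl (g := fun _ => w), Finset.sum_const, Finset.card_univ,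
      Nat.cast_smul_eq_nsmul]
    intro g _
    rw [hqW _ (hW g⁻¹ w hw)]
    simp
  obtain ⟨w, hw, hw0⟩ := Submodule.exists_mem_ne_zero_of_ne_bot hbot
  have hc0 : c ≠ 0 := by
    have h1 : c • w = (Fintype.card G : ℂ) • w := by rw [← hc, hTW w hw]
    rw [smul_left_injective ℂ hw0 h1]
    exact Nat.cast_ne_zero.2 Fintype.card_ne_zero
  refine eq_top_iff.2 fun v _ => (Submodule.smul_mem_iff W hc0).1 ?_
  rw [← hc, hTapp]
  exact W.sum_mem fun g _ => hW g _ (q _).2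

open Classical in
/-- The element of the induced space supported on the coset `P * g` with value `v` at `g`. -/
noncomputable def inducedSingle (P : Subgroup G) {W : Type*} [AddCommGroup W] [Module ℂ W]
    (θ : Representation ℂ P W) (g : G) : W →ₗ[ℂ] inducedSpace P θ where
  toFun v := ⟨fun x => if h : x * g⁻¹ ∈ P then θ ⟨x * g⁻¹, h⟩ v else 0, fun p x => by
    by_cases h : x * g⁻¹ ∈ P
    · have h' : ↑p * x * g⁻¹ ∈ P := by rw [mul_assoc]; exact P.mul_mem p.2 h
      beta_reduce
      rw [dif_pos h, dif_pos h', ← Module.End.mul_apply, ← map_mul]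
      congr 2
      exact Subtype.ext (mul_assoc _ _ _)
    · have h' : ↑p * x * g⁻¹ ∉ P := by rwa [mul_assoc, P.mul_mem_cancel_left p.2]
      beta_reduce
      rw [dif_neg h, dif_neg h', map_zero]⟩
  map_add' v w := Subtype.ext <| funext fun x => by
    by_cases h : x * g⁻¹ ∈ P <;> simp [h]
  map_smul' c v := Subtype.ext <| funext fun x => by
    by_cases h : x * g⁻¹ ∈ P <;> simp [h]

section Induced

variable (P : Subgroup G) {W : Type*} [AddCommGroup W] [Module ℂ W] (θ : Representation ℂ P W)

theorem inducedSingle_apply_of_mem {g x : G} (v : W) (h : x * g⁻¹ ∈ P) :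
    (inducedSingle P θ g v : G → W) x = θ ⟨x * g⁻¹, h⟩ v :=
  dif_pos h

theorem inducedSingle_apply_of_notMem {g x : G} (v : W) (h : x * g⁻¹ ∉ P) :
    (inducedSingle P θ g v : G → W) x = 0 :=
  dif_neg h

theorem inducedSingle_apply_self (g : G) (v : W) :
    (inducedSingle P θ g v : G → W) g = v := by
  have h : g * g⁻¹ ∈ P := by simp
  have h1 : (⟨g * g⁻¹, h⟩ : P) = 1 := Subtype.ext (mul_inv_cancel g)
  rw [inducedSingle_apply_of_mem P θ v h, h1, map_one, Module.End.one_apply]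

theorem inducedSingle_mul (p : P) (g : G) (v : W) :
    inducedSingle P θ (p * g) (θ p v) = inducedSingle P θ g v := by
  refine Subtype.ext (funext fun x => ?_)
  have hx : x * (↑p * g)⁻¹ = x * g⁻¹ * (p : G)⁻¹ := by group
  by_cases h : x * g⁻¹ ∈ P
  · have h' : x * (↑p * g)⁻¹ ∈ P := hx ▸ P.mul_mem h (P.inv_mem p.2)
    rw [inducedSingle_apply_of_mem P θ v h, inducedSingle_apply_of_mem P θ _ h',
      ← Module.End.mul_apply, ← map_mul]
    congr 2
    exact Subtype.ext (by simp [mul_assoc])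
  · have h' : x * (↑p * g)⁻¹ ∉ P := by
      rwa [hx, P.mul_mem_cancel_right (P.inv_mem p.2)]
    rw [inducedSingle_apply_of_notMem P θ v h, inducedSingle_apply_of_notMem P θ _ h']

theorem inducedRep_inducedSingle (g x : G) (v : W) :
    inducedRep P θ x (inducedSingle P θ g v) = inducedSingle P θ (g * x⁻¹) v := by
  refine Subtype.ext (funext fun y => ?_)
  change (inducedSingle P θ g v : G → W) (y * x) = _
  have hy : y * (g * x⁻¹)⁻¹ = y * x * g⁻¹ := by group
  by_cases h : y * x * g⁻¹ ∈ P
  · rw [inducedSingle_apply_of_mem P θ v h, inducedSingle_apply_of_mem P θ v (hy ▸ h)]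
    congr 2
    exact Subtype.ext hy.symm
  · rw [inducedSingle_apply_of_notMem P θ v h,
      inducedSingle_apply_of_notMem P θ v (hy ▸ h)]

theorem sum_inducedSingle [Fintype G] [Fintype P] (f : inducedSpace P θ) :
    ∑ g : G, inducedSingle P θ g ((f : G → W) g) = (Fintype.card P : ℂ) • f := by
  classical
  refine Subtype.ext (funext fun x => ?_)
  rw [AddSubmonoidClass.coe_finsetSum, Finset.sum_apply]
  have key : ∀ g, (inducedSingle P θ g ((f : G → W) g) : G → W) x =
      if x * g⁻¹ ∈ P then (f : G → W) x else 0 := fun g => by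
    by_cases h : x * g⁻¹ ∈ P
    · rw [inducedSingle_apply_of_mem P θ _ h, if_pos h, ← f.2 ⟨x * g⁻¹, h⟩ g]
      simp
    · rw [inducedSingle_apply_of_notMem P θ _ h, if_neg h]
  rw [Finset.sum_congr rfl fun g _ => key g, ← Finset.sum_filter, Finset.sum_const,
    ← Nat.cast_smul_eq_nsmul ℂ]
  congr 2
  rw [Fintype.card_subtype]
  refine Finset.card_bij (fun g _ => x * g⁻¹) (by simp) (by simp) fun b hb => ?_
  exact ⟨b⁻¹ * x, by simpa using hb, by simp⟩

/-- Mackey's irreducibility criterion. -/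
theorem isIrreducibleRep_inducedRep [Finite G] [Nontrivial W]
    (hscalar : ∀ T : W →ₗ[ℂ] W, (∀ p w, T (θ p w) = θ p (T w)) → ∃ c : ℂ, ∀ w, T w = c • w)
    (hzero : ∀ g ∉ P, ∀ T : W →ₗ[ℂ] W,
      (∀ (x y : P), (y : G) * g = g * x → ∀ w, T (θ y w) = θ x (T w)) → T = 0) :
    IsIrreducibleRep (V := ↥(inducedSpace P θ)) (inducedRep P θ) := by
  classical
  have := Fintype.ofFinite G
  have : Nontrivial (inducedSpace P θ) := by
    obtain ⟨v, hv⟩ := exists_ne (0 : W)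
    refine ⟨inducedSingle P θ 1 v, 0, fun h => hv ?_⟩
    rw [← inducedSingle_apply_self P θ 1 v, h]
    rfl
  refine isIrreducibleRep_of_forall_scalar _ fun T hT => ?_
  let M : G → W →ₗ[ℂ] W := fun g =>
    { toFun := fun v => (T (inducedSingle P θ g v) : G → W) 1
      map_add' := fun v w => by simp
      map_smul' := fun c v => by simp }
  have hMdef : ∀ g v, M g v = (T (inducedSingle P θ g v) : G → W) 1 := fun _ _ => rfl
  have hM_right : ∀ (g : G) (p : P) (v : W), M (g * (p : G)⁻¹) v = θ p (M g v) := by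
    intro g p v
    rw [hMdef, hMdef, ← inducedRep_inducedSingle, hT, ← (T (inducedSingle P θ g v)).2]
    change (T (inducedSingle P θ g v) : G → W) (1 * p) = _
    rw [one_mul, mul_one]
  have hM_left : ∀ (g : G) (p : P) (v : W), M (p * g) (θ p v) = M g v := by
    intro g p v
    rw [hMdef, inducedSingle_mul, ← hMdef]
  have hM : ∀ g (x y : P), (y : G) * g = g * x → ∀ w, M g (θ y w) = θ x (M g w) := by
    intro g x y hxy w
    have h1 : (y : G) * (g * (x : G)⁻¹) = g := by rw [← mul_assoc, hxy, mul_inv_cancel_right]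
    rw [← hM_right, ← hM_left (g * (x : G)⁻¹) y, h1]
  obtain ⟨c, hc⟩ := hscalar (M 1) fun p w => hM 1 p p (by simp) w
  have hsum : ∀ f : inducedSpace P θ, (T f : G → W) 1 = c • (f : G → W) 1 := by
    intro f
    have hcard : (Fintype.card P : ℂ) ≠ 0 := Nat.cast_ne_zero.2 Fintype.card_ne_zero
    refine smul_right_injective W hcard ?_
    have h1 : (Fintype.card P : ℂ) • (T f : G → W) 1 =
        ∑ g : G, M g ((f : G → W) g) := by
      have : (Fintype.card P : ℂ) • T f = ∑ g : G, T (inducedSingle P θ g ((f : G → W) g)) := by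
        rw [← map_smul, ← sum_inducedSingle, map_sum]
      have h2 := congrFun (congrArg Subtype.val this) 1
      rw [AddSubmonoidClass.coe_finsetSum, Finset.sum_apply] at h2
      exact h2
    change (Fintype.card P : ℂ) • (T f : G → W) 1 = (Fintype.card P : ℂ) • c • (f : G → W) 1
    have h2 : ∀ g, M g ((f : G → W) g) = if g ∈ P then c • (f : G → W) 1 else 0 := by
      intro g
      by_cases hg : g ∈ P
      · have h3 := f.2 ⟨g, hg⟩ 1
        have h4 := hM_left 1 ⟨g, hg⟩ ((f : G → W) 1)
        rw [← h3] at h4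
        simp only [mul_one] at h4
        rw [if_pos hg, h4, hc]
      · rw [if_neg hg, hzero g hg (M g) (hM g), LinearMap.zero_apply]
    rw [h1, Finset.sum_congr rfl fun g _ => h2 g, ← Finset.sum_filter, Finset.sum_const,
      ← Nat.cast_smul_eq_nsmul ℂ, Fintype.card_subtype]
  refine ⟨c, fun f => Subtype.ext (funext fun x => ?_)⟩
  have h1 := hsum (inducedRep P θ x f)
  rw [hT] at h1
  change (T f : G → W) (1 * x) = c • (f : G → W) (1 * x) at h1
  rw [one_mul] at h1
  exact h1

end Induced

end Generic

section TensorContraction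

variable {V₁ V₂ : Type*} [AddCommGroup V₁] [Module ℂ V₁] [AddCommGroup V₂] [Module ℂ V₂]

/-- Contraction of the first tensor factor with a linear functional. -/
noncomputable def contractLeft₁ (f : V₁ →ₗ[ℂ] ℂ) : V₁ ⊗[ℂ] V₂ →ₗ[ℂ] V₂ :=
  (TensorProduct.lid ℂ V₂).toLinearMap ∘ₗ f.rTensor V₂

/-- Contraction of the second tensor factor with a linear functional. -/
noncomputable def contractRight₂ (f : V₂ →ₗ[ℂ] ℂ) : V₁ ⊗[ℂ] V₂ →ₗ[ℂ] V₁ :=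
  (TensorProduct.rid ℂ V₁).toLinearMap ∘ₗ f.lTensor V₁

@[simp]
theorem contractLeft₁_tmul (f : V₁ →ₗ[ℂ] ℂ) (v : V₁) (w : V₂) :
    contractLeft₁ f (v ⊗ₜ[ℂ] w) = f v • w := by
  simp [contractLeft₁]

@[simp]
theorem contractRight₂_tmul (f : V₂ →ₗ[ℂ] ℂ) (v : V₁) (w : V₂) :
    contractRight₂ f (v ⊗ₜ[ℂ] w) = f w • v := by
  simp [contractRight₂]

theorem contractLeft₁_map_id (f : V₁ →ₗ[ℂ] ℂ) (T : V₂ →ₗ[ℂ] V₂) (t : V₁ ⊗[ℂ] V₂) :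
    contractLeft₁ f (TensorProduct.map LinearMap.id T t) = T (contractLeft₁ f t) := by
  induction t with
  | zero => simp
  | tmul v w => simp
  | add s t hs ht => simp only [map_add, hs, ht]

theorem contractRight₂_map_id (f : V₂ →ₗ[ℂ] ℂ) (T : V₁ →ₗ[ℂ] V₁) (t : V₁ ⊗[ℂ] V₂) :
    contractRight₂ f (TensorProduct.map T LinearMap.id t) = T (contractRight₂ f t) := by
  induction t with
  | zero => simp
  | tmul v w => simp
  | add s t hs ht => simp only [map_add, hs, ht]

theorem eq_zero_of_contractLeft₁ [FiniteDimensional ℂ V₁] (t : V₁ ⊗[ℂ] V₂)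
    (h : ∀ f : V₁ →ₗ[ℂ] ℂ, contractLeft₁ f t = 0) : t = 0 := by
  let b := Module.finBasis ℂ V₁
  have key : t = ∑ i, b i ⊗ₜ[ℂ] contractLeft₁ (b.coord i) t := by
    clear h
    induction t with
    | zero => simp
    | tmul v w =>
      conv_lhs => rw [← b.sum_repr v, TensorProduct.sum_tmul]
      simp [TensorProduct.smul_tmul]
    | add s t hs ht =>
      conv_lhs => rw [hs, ht]
      simp only [map_add, TensorProduct.tmul_add, Finset.sum_add_distrib]
  rw [key]
  exact Finset.sum_eq_zero fun i _ => by rw [h, TensorProduct.tmul_zero]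

theorem eq_zero_of_contractRight₂ [FiniteDimensional ℂ V₂] (t : V₁ ⊗[ℂ] V₂)
    (h : ∀ f : V₂ →ₗ[ℂ] ℂ, contractRight₂ f t = 0) : t = 0 := by
  let b := Module.finBasis ℂ V₂
  have key : t = ∑ i, contractRight₂ (b.coord i) t ⊗ₜ[ℂ] b i := by
    clear h
    induction t with
    | zero => simp
    | tmul v w =>
      conv_lhs => rw [← b.sum_repr w, TensorProduct.tmul_sum]
      simp [TensorProduct.smul_tmul]
    | add s t hs ht =>
      conv_lhs => rw [hs, ht]
      simp only [map_add, TensorProduct.add_tmul, Finset.sum_add_distrib]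
  rw [key]
  exact Finset.sum_eq_zero fun i _ => by rw [h, TensorProduct.zero_tmul]

theorem apply_contractLeft₁ (f₁ : V₁ →ₗ[ℂ] ℂ) (f₂ : V₂ →ₗ[ℂ] ℂ) (t : V₁ ⊗[ℂ] V₂) :
    f₂ (contractLeft₁ f₁ t) = f₁ (contractRight₂ f₂ t) := by
  induction t with
  | zero => simp
  | tmul v w => simp [mul_comm]
  | add s t hs ht => simp only [map_add, hs, ht]

/-- Schur's lemma for an external tensor product of irreducible representations. -/
theorem exists_eq_smul_of_commute_tensor {G₁ G₂ : Type*} [Group G₁] [Group G₂]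
    [FiniteDimensional ℂ V₁] [FiniteDimensional ℂ V₂]
    {π₁ : Representation ℂ G₁ V₁} {π₂ : Representation ℂ G₂ V₂}
    (h₁ : IsIrreducibleRep π₁) (h₂ : IsIrreducibleRep π₂)
    (T : V₁ ⊗[ℂ] V₂ →ₗ[ℂ] V₁ ⊗[ℂ] V₂)
    (hT : ∀ a d t, T (TensorProduct.map (π₁ a) (π₂ d) t) =
      TensorProduct.map (π₁ a) (π₂ d) (T t)) :
    ∃ c : ℂ, ∀ t, T t = c • t := by
  have hT₁ : ∀ a t, T (TensorProduct.map (π₁ a) LinearMap.id t) =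
      TensorProduct.map (π₁ a) LinearMap.id (T t) := fun a t => by
    have := hT a 1 t
    rwa [map_one π₂] at this
  have hT₂ : ∀ d t, T (TensorProduct.map LinearMap.id (π₂ d) t) =
      TensorProduct.map LinearMap.id (π₂ d) (T t) := fun d t => by
    have := hT 1 d t
    rwa [map_one π₁] at this
  have := h₁.nontrivial_s15
  obtain ⟨v₀, hv₀⟩ := exists_ne (0 : V₁)
  obtain ⟨f₀, hf₀⟩ := Module.Projective.exists_dual_eq_one ℂ hv₀
  let N : V₂ →ₗ[ℂ] V₂ := contractLeft₁ f₀ ∘ₗ T ∘ₗ TensorProduct.mk ℂ V₁ V₂ v₀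
  have hNdef : ∀ w, N w = contractLeft₁ f₀ (T (v₀ ⊗ₜ[ℂ] w)) := fun _ => rfl
  obtain ⟨c, hc⟩ := h₂.exists_eq_smul N fun d w => by
    rw [hNdef, hNdef, ← contractLeft₁_map_id, ← hT₂, TensorProduct.map_tmul, LinearMap.id_apply]
  have hTN : ∀ v w, T (v ⊗ₜ[ℂ] w) = v ⊗ₜ[ℂ] N w := fun v w => by
    rw [← sub_eq_zero]
    refine eq_zero_of_contractRight₂ _ fun f => ?_
    obtain ⟨l, hl⟩ := h₁.exists_eq_smul
      (contractRight₂ f ∘ₗ T ∘ₗ (TensorProduct.mk ℂ V₁ V₂).flip w) fun a v => by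
        simp only [LinearMap.comp_apply, LinearMap.flip_apply, TensorProduct.mk_apply]
        rw [← contractRight₂_map_id, ← hT₁, TensorProduct.map_tmul, LinearMap.id_apply]
    have hl' : ∀ v, contractRight₂ f (T (v ⊗ₜ[ℂ] w)) = l • v := hl
    rw [map_sub, contractRight₂_tmul, hNdef, apply_contractLeft₁, hl', hl', map_smul, hf₀,
      smul_eq_mul, mul_one, sub_self]
  refine ⟨c, fun t => ?_⟩
  induction t with
  | zero => simp
  | tmul v w => rw [hTN, hc, TensorProduct.tmul_smul]
  | add s t hs ht => rw [map_add, hs, ht, smul_add]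

end TensorContraction

section GLAction

variable {𝔽 : Type*} [Field 𝔽]

/-- The action of `GL_m` on column vectors, by linear maps. -/
def glLin {m : ℕ} : GL (Fin m) 𝔽 →* ((Fin m → 𝔽) →ₗ[𝔽] (Fin m → 𝔽)) :=
  (Matrix.toLinAlgEquiv' : Matrix (Fin m) (Fin m) 𝔽 ≃ₐ[𝔽] _).toRingEquiv.toMonoidHom.comp
    (Units.coeHom _)

theorem glLin_apply {m : ℕ} (g : GL (Fin m) 𝔽) (v : Fin m → 𝔽) :
    glLin g v = (g : Matrix (Fin m) (Fin m) 𝔽) *ᵥ v := rfl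

theorem glLin_single {m : ℕ} (g : GL (Fin m) 𝔽) (i j : Fin m) :
    glLin g (Pi.single j 1) i = (g : Matrix (Fin m) (Fin m) 𝔽) i j := by
  rw [glLin_apply]
  simp

@[simp]
theorem glLin_mul_apply {m : ℕ} (g h : GL (Fin m) 𝔽) (v : Fin m → 𝔽) :
    glLin (g * h) v = glLin g (glLin h v) := by
  rw [map_mul, Module.End.mul_apply]

@[simp]
theorem glLin_inv_apply_self {m : ℕ} (g : GL (Fin m) 𝔽) (v : Fin m → 𝔽) :
    glLin g⁻¹ (glLin g v) = v := by
  rw [← glLin_mul_apply, inv_mul_cancel, map_one, Module.End.one_apply]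

@[simp]
theorem glLin_self_apply_inv {m : ℕ} (g : GL (Fin m) 𝔽) (v : Fin m → 𝔽) :
    glLin g (glLin g⁻¹ v) = v := by
  rw [← glLin_mul_apply, mul_inv_cancel, map_one, Module.End.one_apply]

theorem exists_glLin_eq {m : ℕ} (f : (Fin m → 𝔽) →ₗ[𝔽] (Fin m → 𝔽))
    (hf : Function.Injective f) : ∃ g : GL (Fin m) 𝔽, ∀ v, glLin g v = f v := by
  let e := LinearEquiv.ofInjectiveEndo f hf
  refine ⟨⟨LinearMap.toMatrix' f, LinearMap.toMatrix' e.symm.toLinearMap, ?_, ?_⟩, fun v => ?_⟩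
  · rw [← LinearMap.toMatrix'_comp, ← LinearMap.toMatrix'_id]
    congr 1
    exact LinearMap.ext fun v => e.apply_symm_apply v
  · rw [← LinearMap.toMatrix'_comp, ← LinearMap.toMatrix'_id]
    congr 1
    exact LinearMap.ext fun v => e.symm_apply_apply v
  · rw [glLin_apply]
    simp

/-- The perturbation of the identity by a square-zero map is invertible. -/
theorem exists_glLin_eq_add {m : ℕ} (N : (Fin m → 𝔽) →ₗ[𝔽] (Fin m → 𝔽))
    (hN : ∀ v, N (N v) = 0) : ∃ g : GL (Fin m) 𝔽, ∀ v, glLin g v = v + N v := by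
  refine exists_glLin_eq (LinearMap.id + N) ((injective_iff_map_eq_zero _).2 fun v hv => ?_)
  have h1 : v + N v = 0 := hv
  have h2 : N v = 0 := by simpa [hN] using congrArg N h1
  rwa [h2, add_zero] at h1

theorem IsBlockUnipotent.glLin_apply_of_le {m r : ℕ} {u : GL (Fin m) 𝔽} (hu : IsBlockUnipotent r u)
    (v : Fin m → 𝔽) {i : Fin m} (hi : r ≤ (i : ℕ)) : glLin u v i = v i := by
  rw [glLin_apply, Matrix.mulVec, dotProduct, Finset.sum_eq_single i]
  · rw [hu.1, one_mul]
  · intro j _ hj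
    rw [hu.2 i j hj.symm (by omega), zero_mul]
  · simp

theorem IsBlockUnipotent.glLin_eq_self {m r : ℕ} {u : GL (Fin m) 𝔽} (hu : IsBlockUnipotent r u)
    (v : Fin m → 𝔽) (hv : ∀ i : Fin m, r ≤ (i : ℕ) → v i = 0) : glLin u v = v := by
  funext i
  rw [glLin_apply, Matrix.mulVec, dotProduct, Finset.sum_eq_single i]
  · rw [hu.1, one_mul]
  · intro j _ hj
    by_cases h : r ≤ (j : ℕ)
    · rw [hv j h, mul_zero]
    · rw [hu.2 i j hj.symm (by omega), zero_mul]
  · simp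

/-- Every subspace is the image of a coordinate subspace under an element of `GL_m`. -/
theorem exists_glLin_mem_iff {m : ℕ} (U : Submodule 𝔽 (Fin m → 𝔽)) :
    ∃ g : GL (Fin m) 𝔽, ∀ v, glLin g v ∈ U ↔
      ∀ i : Fin m, Module.finrank 𝔽 U ≤ (i : ℕ) → v i = 0 := by
  have hcard : Module.finrank 𝔽 U + Module.finrank 𝔽 ((Fin m → 𝔽) ⧸ U) = m := by
    rw [add_comm, Submodule.finrank_quotient_add_finrank, Module.finrank_fin_fun]
  let b := ((Module.finBasis 𝔽 U).sumQuot (Module.finBasis 𝔽 ((Fin m → 𝔽) ⧸ U)))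
  have hb : ∀ w, w ∈ U ↔ ∀ j, b.repr w (Sum.inr j) = 0 := by
    intro w
    refine ⟨fun hw j => Module.Basis.sumQuot_repr_inr_of_mem _ _ w hw j, fun hw => ?_⟩
    rw [← Submodule.Quotient.mk_eq_zero, ← Submodule.mkQ_apply,
      ← (Module.finBasis 𝔽 ((Fin m → 𝔽) ⧸ U)).forall_coord_eq_zero_iff]
    intro j
    rw [Module.Basis.coord_apply, ← Module.Basis.sumQuot_repr_inr (Module.finBasis 𝔽 U)]
    exact hw j
  let e := finSumFinEquiv.trans (finCongr hcard)
  let c := b.reindex e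
  obtain ⟨g, hg⟩ := exists_glLin_eq c.equivFun.symm.toLinearMap c.equivFun.symm.injective
  refine ⟨g, fun v => ?_⟩
  have hrepr : ∀ k, b.repr (glLin g v) k = v (e k) := by
    intro k
    have h1 : c.equivFun (glLin g v) = v := by
      rw [hg]
      exact c.equivFun.apply_symm_apply v
    have h2 := congrFun h1 (e k)
    rw [Module.Basis.equivFun_apply, Module.Basis.repr_reindex_apply, e.symm_apply_apply] at h2
    exact h2
  rw [hb]
  refine ⟨fun h i hi => ?_, fun h j => ?_⟩
  · obtain ⟨k, rfl⟩ := e.surjective i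
    rcases k with k | k
    · simp only [e, Equiv.trans_apply, finSumFinEquiv_apply_left, finCongr_apply, Fin.val_cast,
        Fin.val_castAdd] at hi
      omega
    · rw [← hrepr, h]
  · rw [hrepr]
    exact h _ (by simp [e])

/-- A cuspidal representation has no nonzero vector fixed by the unipotent radical of the
stabilizer of a nontrivial proper subspace. -/
theorem IsCuspidal.eq_zero_of_fixed {m : ℕ} {V : Type*} [AddCommGroup V] [Module ℂ V]
    {π : Representation ℂ (GL (Fin m) 𝔽) V} (hπ : IsCuspidal π)
    (U : Submodule 𝔽 (Fin m → 𝔽)) (hbot : U ≠ ⊥) (htop : U ≠ ⊤) (v : V)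
    (hv : ∀ u : GL (Fin m) 𝔽, (∀ w, glLin u w - w ∈ U) → (∀ w ∈ U, glLin u w = w) →
      π u v = v) : v = 0 := by
  obtain ⟨g, hg⟩ := exists_glLin_mem_iff U
  have hpos : 0 < Module.finrank 𝔽 U := Nat.pos_of_ne_zero fun h => hbot (by simpa using h)
  have hlt : Module.finrank 𝔽 U < m := by
    simpa using Submodule.finrank_lt htop
  have h0 : π g⁻¹ v = 0 := by
    refine hπ.2 _ hpos hlt _ fun u hu => ?_
    have h1 : π (g * u * g⁻¹) v = v := by
      refine hv _ (fun w => ?_) fun w hw => ?_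
      · have h2 : glLin (g * u * g⁻¹) w - w = glLin g (glLin u (glLin g⁻¹ w) - glLin g⁻¹ w) := by
          simp
        rw [h2, hg]
        intro i hi
        rw [Pi.sub_apply, hu.glLin_apply_of_le _ hi, sub_self]
      · have h2 : glLin g (glLin g⁻¹ w) ∈ U := by simpa using hw
        rw [glLin_mul_apply, glLin_mul_apply, hu.glLin_eq_self _ ((hg _).1 h2),
          glLin_self_apply_inv]
    conv_rhs => rw [← h1]
    simp only [map_mul, Module.End.mul_apply, Representation.inv_self_apply]
  have h1 := congrArg (π g) h0
  rwa [Representation.self_inv_apply, map_zero] at h1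

end GLAction

section Block

variable {𝔽 : Type*} [Field 𝔽] {n₁ n₂ : ℕ}

/-- The inclusion of the first `n₁` coordinates into `𝔽^(n₁ + n₂)`. -/
def blockIncl (𝔽 : Type*) [Field 𝔽] (n₁ n₂ : ℕ) : (Fin n₁ → 𝔽) →ₗ[𝔽] (Fin (n₁ + n₂) → 𝔽) where
  toFun v := Fin.append v 0
  map_add' v w := by
    funext i
    refine Fin.addCases (fun j => ?_) (fun j => ?_) i <;> simp
  map_smul' c v := by
    funext i
    refine Fin.addCases (fun j => ?_) (fun j => ?_) i <;> simp

/-- The projection of `𝔽^(n₁ + n₂)` to the last `n₂` coordinates. -/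
def blockProj (𝔽 : Type*) [Field 𝔽] (n₁ n₂ : ℕ) : (Fin (n₁ + n₂) → 𝔽) →ₗ[𝔽] (Fin n₂ → 𝔽) :=
  LinearMap.funLeft 𝔽 𝔽 (Fin.natAdd n₁)

theorem blockIncl_castAdd (v : Fin n₁ → 𝔽) (i : Fin n₁) :
    blockIncl 𝔽 n₁ n₂ v (Fin.castAdd n₂ i) = v i :=
  Fin.append_left _ _ _

theorem blockIncl_natAdd (v : Fin n₁ → 𝔽) (i : Fin n₂) :
    blockIncl 𝔽 n₁ n₂ v (Fin.natAdd n₁ i) = 0 :=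
  Fin.append_right _ _ _

theorem blockProj_apply (w : Fin (n₁ + n₂) → 𝔽) (i : Fin n₂) :
    blockProj 𝔽 n₁ n₂ w i = w (Fin.natAdd n₁ i) := rfl

@[simp]
theorem blockProj_blockIncl (v : Fin n₁ → 𝔽) : blockProj 𝔽 n₁ n₂ (blockIncl 𝔽 n₁ n₂ v) = 0 :=
  funext fun i => blockIncl_natAdd v i

theorem blockIncl_injective : Function.Injective (blockIncl 𝔽 n₁ n₂) := fun v w h =>
  funext fun i => by rw [← blockIncl_castAdd (n₂ := n₂) v, h, blockIncl_castAdd]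

theorem exists_blockIncl_eq (w : Fin (n₁ + n₂) → 𝔽) (h : blockProj 𝔽 n₁ n₂ w = 0) :
    ∃ v, blockIncl 𝔽 n₁ n₂ v = w := by
  refine ⟨fun i => w (Fin.castAdd n₂ i), funext fun i => ?_⟩
  refine Fin.addCases (fun j => ?_) (fun j => ?_) i
  · rw [blockIncl_castAdd]
  · rw [blockIncl_natAdd]
    exact (congrFun h j).symm

theorem blockProj_surjective : Function.Surjective (blockProj 𝔽 n₁ n₂) := fun v =>
  ⟨Fin.append 0 v, funext fun _ => Fin.append_right _ _ _⟩

theorem blockIncl_single (j : Fin n₁) :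
    blockIncl 𝔽 n₁ n₂ (Pi.single j 1) = Pi.single (Fin.castAdd n₂ j) 1 := by
  funext i
  refine Fin.addCases (fun k => ?_) (fun k => ?_) i
  · rw [blockIncl_castAdd]
    simp [Pi.single_apply]
  · rw [blockIncl_natAdd, Pi.single_eq_of_ne]
    intro h
    have := congrArg Fin.val h
    rw [Fin.val_natAdd, Fin.val_castAdd] at this
    omega

theorem blockProj_single (j : Fin n₂) :
    blockProj 𝔽 n₁ n₂ (Pi.single (Fin.natAdd n₁ j) 1) = Pi.single j 1 := by
  funext i
  simp [blockProj_apply, Pi.single_apply]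

theorem exists_glLin_blockDiagonal (a : GL (Fin n₁) 𝔽) (d : GL (Fin n₂) 𝔽) :
    ∃ x : GL (Fin (n₁ + n₂)) 𝔽,
      (∀ v, glLin x (blockIncl 𝔽 n₁ n₂ v) = blockIncl 𝔽 n₁ n₂ (glLin a v)) ∧
      ∀ w, blockProj 𝔽 n₁ n₂ (glLin x w) = glLin d (blockProj 𝔽 n₁ n₂ w) := by
  obtain ⟨r, hr⟩ := (blockIncl 𝔽 n₁ n₂).exists_leftInverse_of_injective
    (LinearMap.ker_eq_bot.2 blockIncl_injective)
  obtain ⟨s, hs⟩ := (blockProj 𝔽 n₁ n₂).exists_rightInverse_of_surjective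
    (LinearMap.range_eq_top.2 blockProj_surjective)
  have hr' : ∀ v, r (blockIncl 𝔽 n₁ n₂ v) = v := LinearMap.congr_fun hr
  have hs' : ∀ v, blockProj 𝔽 n₁ n₂ (s v) = v := LinearMap.congr_fun hs
  obtain ⟨x, hx⟩ := exists_glLin_eq (blockIncl 𝔽 n₁ n₂ ∘ₗ glLin a ∘ₗ r +
      s ∘ₗ glLin d ∘ₗ blockProj 𝔽 n₁ n₂) <| by
    refine (injective_iff_map_eq_zero _).2 fun w hw => ?_
    have h1 : blockIncl 𝔽 n₁ n₂ (glLin a (r w)) + s (glLin d (blockProj 𝔽 n₁ n₂ w)) = 0 := hw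
    have h2 := congrArg (blockProj 𝔽 n₁ n₂) h1
    rw [map_add, hs', blockProj_blockIncl, zero_add, map_zero] at h2
    rw [h2, map_zero, add_zero] at h1
    have h3 : blockProj 𝔽 n₁ n₂ w = 0 := by
      rw [← glLin_inv_apply_self d (blockProj 𝔽 n₁ n₂ w), h2, map_zero]
    obtain ⟨v, rfl⟩ := exists_blockIncl_eq w h3
    rw [hr'] at h1
    have h4 := blockIncl_injective (h1.trans (map_zero _).symm)
    rw [← glLin_inv_apply_self a v, h4, map_zero, map_zero]
  exact ⟨x, fun v => by simp [hx, hr'], fun w => by simp [hx, hs']⟩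

theorem mem_parabolicGL_iff_s15 (g : GL (Fin (n₁ + n₂)) 𝔽) :
    g ∈ parabolicGL 𝔽 n₁ n₂ ↔
      ∀ v, blockProj 𝔽 n₁ n₂ (glLin g (blockIncl 𝔽 n₁ n₂ v)) = 0 := by
  change Matrix.BlockTriangular _ _ ↔ _
  refine ⟨fun h v => ?_, fun h i j hij => ?_⟩
  · suffices blockProj 𝔽 n₁ n₂ ∘ₗ glLin g ∘ₗ blockIncl 𝔽 n₁ n₂ = 0 from
      LinearMap.congr_fun this v
    refine LinearMap.pi_ext' fun j => LinearMap.ext_ring (funext fun i => ?_)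
    simp only [LinearMap.comp_apply, LinearMap.coe_single, blockIncl_single, blockProj_apply,
      glLin_single]
    exact h (by simp)
  · revert hij
    refine Fin.addCases (fun k => ?_) (fun k => ?_) i
    · simp
    · refine Fin.addCases (fun l => ?_) (fun l => ?_) j
      · intro _
        rw [← glLin_single, ← blockIncl_single]
        exact congrFun (h _) k
      · simp

section Rep

variable {V₁ V₂ : Type*} [AddCommGroup V₁] [Module ℂ V₁] [AddCommGroup V₂] [Module ℂ V₂]

/-- An operator on `V₁ ⊗ V₂` intertwines along `g` if it intertwines the actions of
`g * x * g⁻¹` and `x` whenever both are block upper-triangular. -/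
def IntertwinesAlong (π₁ : Representation ℂ (GL (Fin n₁) 𝔽) V₁)
    (π₂ : Representation ℂ (GL (Fin n₂) 𝔽) V₂) (g : GL (Fin (n₁ + n₂)) 𝔽)
    (T : V₁ ⊗[ℂ] V₂ →ₗ[ℂ] V₁ ⊗[ℂ] V₂) : Prop :=
  ∀ (x : GL (Fin (n₁ + n₂)) 𝔽) (a a' : GL (Fin n₁) 𝔽) (d d' : GL (Fin n₂) 𝔽),
    (∀ v, glLin x (blockIncl 𝔽 n₁ n₂ v) = blockIncl 𝔽 n₁ n₂ (glLin a v)) →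
    (∀ w, blockProj 𝔽 n₁ n₂ (glLin x w) = glLin d (blockProj 𝔽 n₁ n₂ w)) →
    (∀ v, glLin x (glLin g⁻¹ (blockIncl 𝔽 n₁ n₂ v)) =
      glLin g⁻¹ (blockIncl 𝔽 n₁ n₂ (glLin a' v))) →
    (∀ w, blockProj 𝔽 n₁ n₂ (glLin g (glLin x w)) =
      glLin d' (blockProj 𝔽 n₁ n₂ (glLin g w))) →
    ∀ t, T (TensorProduct.map (π₁ a') (π₂ d') t) = TensorProduct.map (π₁ a) (π₂ d) (T t)

variable {π₁ : Representation ℂ (GL (Fin n₁) 𝔽) V₁} {π₂ : Representation ℂ (GL (Fin n₂) 𝔽) V₂}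
  {g : GL (Fin (n₁ + n₂)) 𝔽} {T : V₁ ⊗[ℂ] V₂ →ₗ[ℂ] V₁ ⊗[ℂ] V₂}

theorem IntertwinesAlong.eq_zero_of_sup_ne_top [FiniteDimensional ℂ V₁]
    (hT : IntertwinesAlong π₁ π₂ g T) (hπ₂ : IsCuspidal π₂) (hg : g ∉ parabolicGL 𝔽 n₁ n₂)
    (hsup : ∃ w, ∀ v₁ v₂, w ≠ blockIncl 𝔽 n₁ n₂ v₁ + glLin g⁻¹ (blockIncl 𝔽 n₁ n₂ v₂)) :
    T = 0 := by
  let p : (Fin n₁ → 𝔽) →ₗ[𝔽] (Fin n₂ → 𝔽) :=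
    blockProj 𝔽 n₁ n₂ ∘ₗ glLin g⁻¹ ∘ₗ blockIncl 𝔽 n₁ n₂
  have hp : ∀ v, p v = blockProj 𝔽 n₁ n₂ (glLin g⁻¹ (blockIncl 𝔽 n₁ n₂ v)) := fun _ => rfl
  have hbot : LinearMap.range p ≠ ⊥ := by
    intro h
    refine hg (inv_mem_iff.1 ((mem_parabolicGL_iff_s15 _).2 fun v => ?_))
    rw [← hp, LinearMap.range_eq_bot.1 h, LinearMap.zero_apply]
  have htop : LinearMap.range p ≠ ⊤ := by
    intro h
    obtain ⟨w, hw⟩ := hsup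
    obtain ⟨v₂, hv₂⟩ := LinearMap.range_eq_top.1 h (blockProj 𝔽 n₁ n₂ w)
    obtain ⟨v₁, hv₁⟩ := exists_blockIncl_eq (w - glLin g⁻¹ (blockIncl 𝔽 n₁ n₂ v₂))
      (by rw [map_sub, ← hv₂, hp, sub_self])
    exact hw v₁ v₂ (by rw [hv₁, sub_add_cancel])
  refine LinearMap.ext fun t => eq_zero_of_contractLeft₁ _ fun f => ?_
  refine hπ₂.eq_zero_of_fixed _ hbot htop _ fun u hu hu' => ?_
  obtain ⟨s, hs⟩ := p.rangeRestrict.exists_rightInverse_of_surjective p.range_rangeRestrict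
  have hs' : ∀ y, p (s y) = y := fun y => congrArg Subtype.val (LinearMap.congr_fun hs y)
  let N : (Fin n₂ → 𝔽) →ₗ[𝔽] (Fin n₁ → 𝔽) :=
    s ∘ₗ (glLin u - LinearMap.id).codRestrict (LinearMap.range p) hu
  have hpN : ∀ w, p (N w) = glLin u w - w := fun w => hs' _
  have hNp : ∀ v, N (p v) = 0 := fun v => by
    have : (glLin u - LinearMap.id).codRestrict (LinearMap.range p) hu (p v) = 0 :=
      Subtype.ext (by simp [hu' _ (LinearMap.mem_range_self p v)])
    simp only [N, LinearMap.comp_apply, this, map_zero]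
  obtain ⟨x, hx⟩ := exists_glLin_eq_add
    (glLin g⁻¹ ∘ₗ blockIncl 𝔽 n₁ n₂ ∘ₗ N ∘ₗ blockProj 𝔽 n₁ n₂) fun v => by
      simp only [LinearMap.comp_apply, ← hp, hNp, map_zero]
  simp only [LinearMap.comp_apply] at hx
  have key := hT x 1 1 u 1 (fun v => by simp [hx])
    (fun w => by rw [hx, map_add, ← hp, hpN, add_sub_cancel])
    (fun v => by simp [hx, ← hp, hNp]) (fun w => by simp [hx]) t
  rw [map_one, map_one, TensorProduct.map_one, Module.End.one_apply] at key
  conv_rhs => rw [key]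
  exact (contractLeft₁_map_id f _ _).symm

theorem IntertwinesAlong.eq_zero_of_inf_ne_bot [FiniteDimensional ℂ V₂]
    (hT : IntertwinesAlong π₁ π₂ g T) (hπ₁ : IsCuspidal π₁) (hg : g ∉ parabolicGL 𝔽 n₁ n₂)
    (hinf : ∃ v ≠ 0, blockProj 𝔽 n₁ n₂ (glLin g (blockIncl 𝔽 n₁ n₂ v)) = 0) :
    T = 0 := by
  let j : (Fin n₁ → 𝔽) →ₗ[𝔽] (Fin n₂ → 𝔽) :=
    blockProj 𝔽 n₁ n₂ ∘ₗ glLin g ∘ₗ blockIncl 𝔽 n₁ n₂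
  have hj : ∀ v, j v = blockProj 𝔽 n₁ n₂ (glLin g (blockIncl 𝔽 n₁ n₂ v)) := fun _ => rfl
  have hbot : LinearMap.ker j ≠ ⊥ := by
    obtain ⟨v, hv0, hv⟩ := hinf
    exact (Submodule.ne_bot_iff _).2 ⟨v, hv, hv0⟩
  have htop : LinearMap.ker j ≠ ⊤ := by
    intro h
    refine hg ((mem_parabolicGL_iff_s15 _).2 fun v => ?_)
    rw [← hj, LinearMap.ker_eq_top.1 h, LinearMap.zero_apply]
  refine LinearMap.ext fun t => eq_zero_of_contractRight₂ _ fun f => ?_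
  refine hπ₁.eq_zero_of_fixed _ hbot htop _ fun u hu hu' => ?_
  obtain ⟨s, hs⟩ := j.rangeRestrict.exists_rightInverse_of_surjective j.range_rangeRestrict
  have hs' : ∀ y, j (s y) = y := fun y => congrArg Subtype.val (LinearMap.congr_fun hs y)
  obtain ⟨e, he⟩ := (LinearMap.range j).subtype.exists_leftInverse_of_injective
    (LinearMap.range j).ker_subtype
  have he' : ∀ y : LinearMap.range j, e y = y := LinearMap.congr_fun he
  let N : (Fin n₂ → 𝔽) →ₗ[𝔽] (Fin n₁ → 𝔽) := (glLin u - LinearMap.id) ∘ₗ s ∘ₗ e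
  have hjN : ∀ w, j (N w) = 0 := fun w => hu _
  have hNj : ∀ v, N (j v) = glLin u v - v := fun v => by
    have h1 : s (e (j v)) - v ∈ LinearMap.ker j := by
      rw [LinearMap.mem_ker, map_sub, hs', he' ⟨j v, LinearMap.mem_range_self j v⟩, sub_self]
    have h2 := hu' _ h1
    rw [map_sub] at h2
    change glLin u (s (e (j v))) - s (e (j v)) = _
    rw [sub_eq_sub_iff_sub_eq_sub, h2]
  obtain ⟨x, hx⟩ := exists_glLin_eq_add
    (blockIncl 𝔽 n₁ n₂ ∘ₗ N ∘ₗ blockProj 𝔽 n₁ n₂ ∘ₗ glLin g) fun v => by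
      simp only [LinearMap.comp_apply, ← hj, hjN, map_zero]
  simp only [LinearMap.comp_apply] at hx
  have key := hT x u 1 1 1
    (fun v => by rw [hx, ← hj, hNj, map_sub, add_sub_cancel]) (fun w => by simp [hx])
    (fun v => by simp [hx]) (fun w => by simp [hx, ← hj, hjN]) t
  rw [map_one, map_one, TensorProduct.map_one, Module.End.one_apply] at key
  conv_rhs => rw [key]
  exact (contractRight₂_map_id f _ _).symm

theorem IntertwinesAlong.eq_zero_of_isCompl {n : ℕ} {π₁ : Representation ℂ (GL (Fin n) 𝔽) V₁}
    {π₂ : Representation ℂ (GL (Fin n) 𝔽) V₂} {g : GL (Fin (n + n)) 𝔽}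
    {T : V₁ ⊗[ℂ] V₂ →ₗ[ℂ] V₁ ⊗[ℂ] V₂} [FiniteDimensional ℂ V₂]
    (hT : IntertwinesAlong π₁ π₂ g T) (hπ₁ : IsIrreducibleRep π₁) (hπ₂ : IsIrreducibleRep π₂)
    (hdist : ¬ RepIso π₁ π₂)
    (hinj : Function.Injective (blockProj 𝔽 n n ∘ₗ glLin g ∘ₗ blockIncl 𝔽 n n)) : T = 0 := by
  obtain ⟨c, hc⟩ := exists_glLin_eq _ hinj
  simp only [LinearMap.comp_apply] at hc
  have key : ∀ a t, T (TensorProduct.map LinearMap.id (π₂ (c * a * c⁻¹)) t) =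
      TensorProduct.map (π₁ a) LinearMap.id (T t) := by
    intro a t
    let r : (Fin (n + n) → 𝔽) →ₗ[𝔽] (Fin n → 𝔽) := glLin c⁻¹ ∘ₗ blockProj 𝔽 n n ∘ₗ glLin g
    have hr : ∀ w, r w = glLin c⁻¹ (blockProj 𝔽 n n (glLin g w)) := fun _ => rfl
    have hri : ∀ v, r (blockIncl 𝔽 n n v) = v := fun v => by
      rw [hr, ← hc, glLin_inv_apply_self]
    have hrg : ∀ v, r (glLin g⁻¹ (blockIncl 𝔽 n n v)) = 0 := fun v => by simp [hr]
    obtain ⟨x, hx⟩ := exists_glLin_eq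
        (LinearMap.id + blockIncl 𝔽 n n ∘ₗ (glLin a - LinearMap.id) ∘ₗ r) <| by
      refine (injective_iff_map_eq_zero _).2 fun w hw => ?_
      have h1 : w + blockIncl 𝔽 n n (glLin a (r w) - r w) = 0 := hw
      have h2 := congrArg r h1
      rw [map_add, hri, add_sub_cancel, map_zero] at h2
      have h3 : r w = 0 := by rw [← glLin_inv_apply_self a (r w), h2, map_zero]
      rwa [h3, map_zero, sub_zero, map_zero, add_zero] at h1
    have hx' : ∀ w, glLin x w = w + blockIncl 𝔽 n n (glLin a (r w) - r w) := hx
    have := hT x a 1 1 (c * a * c⁻¹) (fun v => by rw [hx', hri, map_sub, add_sub_cancel])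
      (fun w => by simp [hx']) (fun v => by simp [hx', hrg])
      (fun w => by
        rw [hx', map_add, map_add, ← hc, map_sub, hr]
        simp) t
    rwa [map_one, map_one] at this
  by_contra hT0
  apply hT0
  refine TensorProduct.ext' fun v w => eq_zero_of_contractRight₂ _ fun f => ?_
  let φ : V₂ →ₗ[ℂ] V₁ := contractRight₂ f ∘ₗ T ∘ₗ TensorProduct.mk ℂ V₁ V₂ v ∘ₗ π₂ c
  have hφdef : ∀ w, φ w = contractRight₂ f (T (v ⊗ₜ[ℂ] π₂ c w)) := fun _ => rfl
  have hφ : φ = 0 := by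
    by_contra hφ0
    refine hdist (hπ₂.repIso_of_ne_zero hπ₁ φ (fun a w => ?_) hφ0).symm
    rw [hφdef, hφdef, ← contractRight₂_map_id, ← key, TensorProduct.map_tmul, LinearMap.id_apply]
    simp only [map_mul, Module.End.mul_apply, Representation.inv_self_apply]
  have h := hφdef (π₂ c⁻¹ w)
  rw [hφ, LinearMap.zero_apply, Representation.self_inv_apply] at h
  exact h.symm

theorem IntertwinesAlong.eq_zero [FiniteDimensional ℂ V₁] [FiniteDimensional ℂ V₂]
    (hT : IntertwinesAlong π₁ π₂ g T) (hπ₁ : IsCuspidal π₁) (hπ₂ : IsCuspidal π₂)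
    (hdist : ∀ h : n₁ = n₂,
      ¬ RepIso (V₁ := V₁) (V₂ := V₂)
        (π₁.comp (Units.map
          ((Matrix.reindexAlgEquiv 𝔽 𝔽 (finCongr h.symm)).toRingEquiv.toMonoidHom)))
        π₂)
    (hg : g ∉ parabolicGL 𝔽 n₁ n₂) : T = 0 := by
  by_cases hsup : ∃ w, ∀ v₁ v₂,
      w ≠ blockIncl 𝔽 n₁ n₂ v₁ + glLin g⁻¹ (blockIncl 𝔽 n₁ n₂ v₂)
  · exact hT.eq_zero_of_sup_ne_top hπ₂ hg hsup
  by_cases hinf : ∃ v ≠ 0, blockProj 𝔽 n₁ n₂ (glLin g (blockIncl 𝔽 n₁ n₂ v)) = 0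
  · exact hT.eq_zero_of_inf_ne_bot hπ₁ hg hinf
  push Not at hsup hinf
  have hinj : Function.Injective (blockProj 𝔽 n₁ n₂ ∘ₗ glLin g ∘ₗ blockIncl 𝔽 n₁ n₂) :=
    (injective_iff_map_eq_zero _).2 fun v hv => by_contra fun hv0 => hinf v hv0 hv
  have hsurj : Function.Surjective (blockProj 𝔽 n₁ n₂ ∘ₗ glLin g ∘ₗ blockIncl 𝔽 n₁ n₂) := by
    intro y
    obtain ⟨w, rfl⟩ := blockProj_surjective (n₁ := n₁) y
    obtain ⟨v₁, v₂, h⟩ := hsup (glLin g⁻¹ w)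
    refine ⟨v₁, ?_⟩
    rw [← glLin_self_apply_inv g w, h]
    simp
  have hn : n₁ = n₂ := by
    simpa using (LinearEquiv.ofBijective _ ⟨hinj, hsurj⟩).finrank_eq
  subst hn
  exact hT.eq_zero_of_isCompl hπ₁.1 hπ₂.1 (hdist rfl) hinj

end Rep

end Block

/-- Let `𝔽` be a finite field with `q` elements and let `(π₁, V₁)`, `(π₂, V₂)` be
cuspidal representations of `GL_{n₁}(𝔽)` and `GL_{n₂}(𝔽)` which are not isomorphic (in
particular we assume it is not the case that `n₁ = n₂` and `π₁ ≅ π₂`). Let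
`G = GL_{n₁+n₂}(𝔽)`, let `P` be the block upper-triangular parabolic with Levi
`GL_{n₁} × GL_{n₂}`, and let `ρ` be the representation of `P` on `V₁ ⊗ V₂` given by
`ρ [[A, B], [0, D]] = π₁ A ⊗ π₂ D`. Then the induced representation `Ind_P^G ρ` is
irreducible. -/
theorem principal_series_distinct_cuspidal_irreducible (𝔽 : Type*) [Field 𝔽] [Fintype 𝔽]
    (q n₁ n₂ : ℕ) (hq : Fintype.card 𝔽 = q) (hn₁ : 1 ≤ n₁) (hn₂ : 1 ≤ n₂)
    (V₁ V₂ : Type*) [AddCommGroup V₁] [Module ℂ V₁] [FiniteDimensional ℂ V₁]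
    [AddCommGroup V₂] [Module ℂ V₂] [FiniteDimensional ℂ V₂]
    (π₁ : Representation ℂ (GL (Fin n₁) 𝔽) V₁) (hπ₁ : IsCuspidal π₁)
    (π₂ : Representation ℂ (GL (Fin n₂) 𝔽) V₂) (hπ₂ : IsCuspidal π₂)
    (hdist : ∀ h : n₁ = n₂,
      ¬ RepIso (V₁ := V₁) (V₂ := V₂)
        (π₁.comp (Units.map
          ((Matrix.reindexAlgEquiv 𝔽 𝔽 (finCongr h.symm)).toRingEquiv.toMonoidHom)))
        π₂)
    (ρ : Representation ℂ (parabolicGL 𝔽 n₁ n₂) (V₁ ⊗[ℂ] V₂))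
    (hρ : ∀ (p : parabolicGL 𝔽 n₁ n₂) (A : GL (Fin n₁) 𝔽) (D : GL (Fin n₂) 𝔽),
      (∀ i j : Fin n₁,
        ((p : GL (Fin (n₁ + n₂)) 𝔽) : Matrix (Fin (n₁ + n₂)) (Fin (n₁ + n₂)) 𝔽)
            (Fin.castAdd n₂ i) (Fin.castAdd n₂ j) = (A : Matrix (Fin n₁) (Fin n₁) 𝔽) i j) →
      (∀ i j : Fin n₂,
        ((p : GL (Fin (n₁ + n₂)) 𝔽) : Matrix (Fin (n₁ + n₂)) (Fin (n₁ + n₂)) 𝔽)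
            (Fin.natAdd n₁ i) (Fin.natAdd n₁ j) = (D : Matrix (Fin n₂) (Fin n₂) 𝔽) i j) →
      ρ p = TensorProduct.map (π₁ A) (π₂ D)) :
    IsIrreducibleRep (V := ↥(inducedSpace (parabolicGL 𝔽 n₁ n₂) ρ))
      (inducedRep (parabolicGL 𝔽 n₁ n₂) ρ) := by
  have hP : ∀ (x : GL (Fin (n₁ + n₂)) 𝔽) (hx : x ∈ parabolicGL 𝔽 n₁ n₂)
      (a : GL (Fin n₁) 𝔽) (d : GL (Fin n₂) 𝔽),
      (∀ v, glLin x (blockIncl 𝔽 n₁ n₂ v) = blockIncl 𝔽 n₁ n₂ (glLin a v)) →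
      (∀ w, blockProj 𝔽 n₁ n₂ (glLin x w) = glLin d (blockProj 𝔽 n₁ n₂ w)) →
      ρ ⟨x, hx⟩ = TensorProduct.map (π₁ a) (π₂ d) := by
    intro x hx a d ha hd
    refine hρ _ a d (fun i j => ?_) fun i j => ?_
    · rw [← glLin_single, ← glLin_single, ← blockIncl_single, ha, blockIncl_castAdd]
    · have h := congrFun (hd (Pi.single (Fin.natAdd n₁ j) 1)) i
      rwa [blockProj_single, blockProj_apply, glLin_single, glLin_single] at h
  have hmem : ∀ (x : GL (Fin (n₁ + n₂)) 𝔽) (a : GL (Fin n₁) 𝔽),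
      (∀ v, glLin x (blockIncl 𝔽 n₁ n₂ v) = blockIncl 𝔽 n₁ n₂ (glLin a v)) →
      x ∈ parabolicGL 𝔽 n₁ n₂ := fun x a ha =>
    (mem_parabolicGL_iff_s15 x).2 fun v => by rw [ha, blockProj_blockIncl]
  have : Nontrivial V₁ := hπ₁.1.nontrivial_s15
  have : Nontrivial V₂ := hπ₂.1.nontrivial_s15
  refine isIrreducibleRep_inducedRep _ ρ (fun T hT => ?_) fun g hg T hT => ?_
  · refine exists_eq_smul_of_commute_tensor hπ₁.1 hπ₂.1 T fun a d t => ?_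
    obtain ⟨x, hxa, hxd⟩ := exists_glLin_blockDiagonal a d
    rw [← hP x (hmem x a hxa) a d hxa hxd]
    exact hT _ t
  · have hT' : IntertwinesAlong π₁ π₂ g T := by
      intro x a a' d d' hxa hxd hxa' hxd' t
      have hya : ∀ v, glLin (g * x * g⁻¹) (blockIncl 𝔽 n₁ n₂ v) =
          blockIncl 𝔽 n₁ n₂ (glLin a' v) := fun v => by simp [hxa']
      have hyd : ∀ w, blockProj 𝔽 n₁ n₂ (glLin (g * x * g⁻¹) w) =
          glLin d' (blockProj 𝔽 n₁ n₂ w) := fun w => by simp [hxd']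
      rw [← hP x (hmem x a hxa) a d hxa hxd, ← hP _ (hmem _ a' hya) a' d' hya hyd]
      exact hT _ _ (by simp) t
    exact hT'.eq_zero hπ₁ hπ₂ hdist hg
end
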